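/- Let A be a commutative Noetherian local ring of Krull dimension one and let R = A[x_1,...,x_n] be a polynomial ring over A. Then for every ideal I of R and every integer i ≥ 0, the set of associated primes Ass_R H^i_I(R) is finite. -/

import Mathlib

namespace LCFin

open MvPolynomial Finset

section Leibniz

variable {A : Type*} [CommRing A] {n : ℕ}

/-- Taylor expansion `g ↦ g(x + t)`. -/
noncomputable def tau (A : Type*) [CommRing A] (n : ℕ) :
    MvPolynomial (Fin n) A →ₐ[A] MvPowerSeries (Fin n) (MvPolynomial (Fin n) A) :=
  aeval (fun i => MvPowerSeries.C (X i) + MvPowerSeries.X i)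

/-- Hasse derivatives of polynomials. -/
noncomputable def hd (c : Fin n →₀ ℕ) (g : MvPolynomial (Fin n) A) : MvPolynomial (Fin n) A :=
  MvPowerSeries.coeff c (tau A n g)

theorem tau_X (i : Fin n) : tau A n (X i) = MvPowerSeries.C (X i) + MvPowerSeries.X i := by
  simp [tau]

theorem tau_C (a : A) : tau A n (C a) = MvPowerSeries.C (C a) := by
  have := (tau A n).commutes a
  rw [MvPolynomial.algebraMap_eq] at this
  rw [this, MvPowerSeries.algebraMap_apply, MvPolynomial.algebraMap_eq]

theorem idx_induction {P : (Fin n →₀ ℕ) → Prop} (h0 : P 0)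
    (h1 : ∀ b i, P b → P (b + Finsupp.single i 1)) (b : Fin n →₀ ℕ) : P b := by
  induction hd : b.degree generalizing b with
  | zero => 
    rw [Finsupp.degree_eq_zero_iff] at hd
    exact hd ▸ h0
  | succ m ih =>
    have hb : b ≠ 0 := by rintro rfl; simp at hd
    obtain ⟨i, hi⟩ := Finsupp.ne_iff.1 hb
    have hle : Finsupp.single i 1 ≤ b := by
      simpa using Nat.one_le_iff_ne_zero.2 hi
    obtain ⟨b', rfl⟩ := exists_add_of_le hle
    rw [add_comm]
    apply h1
    apply ih
    rw [map_add, Finsupp.degree_single] at hd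
    omega

theorem leibniz {E : Type*} [Ring E] (ι : MvPolynomial (Fin n) A →+* E)
    (D : (Fin n →₀ ℕ) → E)
    (hC : ∀ a b, D b * ι (C a) = ι (C a) * D b)
    (hX : ∀ b i, D (b + Finsupp.single i 1) * ι (X i) =
      ι (X i) * D (b + Finsupp.single i 1) + D b)
    (hX0 : ∀ b i, b i = 0 → D b * ι (X i) = ι (X i) * D b)
    (g : MvPolynomial (Fin n) A) (c : Fin n →₀ ℕ) :
    D c * ι g = ∑ p ∈ antidiagonal c, ι (hd p.1 g) * D p.2 := by
  classical
  let 𝒯 : MvPowerSeries (Fin n) E := fun b => D b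
  have h𝒯 : ∀ b, MvPowerSeries.coeff b 𝒯 = D b := fun b => rfl
  have key : ∀ g : MvPolynomial (Fin n) A,
      𝒯 * MvPowerSeries.C (ι g) = MvPowerSeries.map ι (tau A n g) * 𝒯 := by
    intro g
    induction g using MvPolynomial.induction_on with
    | C a =>
      rw [tau_C, MvPowerSeries.map_C]
      ext b
      rw [MvPowerSeries.coeff_mul_C, MvPowerSeries.coeff_C_mul, h𝒯, hC]
    | add p q hp hq => simp only [map_add, mul_add, add_mul, hp, hq]
    | mul_X p i hp =>
      have hXi : 𝒯 * MvPowerSeries.C (ι (X i)) =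
          (MvPowerSeries.C (ι (X i)) + MvPowerSeries.X i) * 𝒯 := by
        ext b
        rw [MvPowerSeries.coeff_mul_C, add_mul, map_add, MvPowerSeries.coeff_C_mul, h𝒯,
          MvPowerSeries.X_def, MvPowerSeries.coeff_monomial_mul]
        by_cases hb : b i = 0
        · rw [hX0 b i hb, if_neg, add_zero]
          simp [hb]
        · have hle : Finsupp.single i 1 ≤ b := by
            simpa using Nat.one_le_iff_ne_zero.2 hb
          obtain ⟨b', rfl⟩ := exists_add_of_le hle
          rw [if_pos hle, add_comm (Finsupp.single i 1) b', hX, h𝒯]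
          simp
      rw [map_mul, map_mul, map_mul, map_mul, ← mul_assoc, hp, mul_assoc, hXi, tau_X]
      simp [mul_assoc]
  have := congrArg (MvPowerSeries.coeff c) (key g)
  rw [MvPowerSeries.coeff_mul_C, MvPowerSeries.coeff_mul, h𝒯] at this
  rw [this]
  simp only [MvPowerSeries.coeff_map, h𝒯, hd]

theorem hd_zero (g : MvPolynomial (Fin n) A) : hd 0 g = g := by
  have : (MvPowerSeries.constantCoeff (σ := Fin n) (R := MvPolynomial (Fin n) A)).comp
      (tau A n).toRingHom = RingHom.id _ := by
    apply MvPolynomial.ringHom_ext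
    · intro a; change MvPowerSeries.constantCoeff (tau A n (C a)) = _; simp only [tau_C]; simp
    · intro i; simp [tau_X]
  have h2 := congrArg (fun φ => φ g) this
  simpa [hd] using h2

theorem hd_mul_X (c : Fin n →₀ ℕ) (g : MvPolynomial (Fin n) A) (i : Fin n) :
    hd c (g * X i) = hd c g * X i +
      (if Finsupp.single i 1 ≤ c then hd (c - Finsupp.single i 1) g else 0) := by
  classical
  rw [hd, map_mul, tau_X, mul_add, map_add, MvPowerSeries.coeff_mul_C, MvPowerSeries.X_def,
    MvPowerSeries.coeff_mul_monomial]
  simp [hd]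

theorem hd_C_mul (c : Fin n →₀ ℕ) (r : A) (g : MvPolynomial (Fin n) A) :
    hd c (C r * g) = C r * hd c g := by
  rw [hd, map_mul, tau_C, MvPowerSeries.coeff_C_mul, hd]

theorem hd_add (c : Fin n →₀ ℕ) (f g : MvPolynomial (Fin n) A) :
    hd c (f + g) = hd c f + hd c g := by
  simp [hd]

theorem hd_monomial_top (a : Fin n →₀ ℕ) : ∀ (c : Fin n →₀ ℕ), a.degree ≤ c.degree →
    hd c (monomial a (1 : A)) = if a = c then 1 else 0 := by
  classical
  induction a using idx_induction with
  | h0 =>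
    intro c _
    have : (monomial (0 : Fin n →₀ ℕ) (1 : A)) = 1 := rfl
    rw [this, hd, map_one, MvPowerSeries.coeff_one]
    simp [eq_comm]
  | h1 b i ih =>
    intro c h
    rw [map_add, Finsupp.degree_single] at h
    have : (monomial (b + Finsupp.single i 1) (1 : A)) = monomial b 1 * X i := by
      rw [X, monomial_mul, one_mul]
    rw [this, hd_mul_X, ih c (by omega), if_neg (by rintro rfl; omega), zero_mul, zero_add]
    split_ifs with h1 h2 h2
    · subst h2
      rw [ih _ (by simp)]
      simp
    · obtain ⟨c', rfl⟩ := exists_add_of_le h1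
      rw [map_add, Finsupp.degree_single] at h
      rw [add_tsub_cancel_left, ih _ (by omega), if_neg]
      rintro rfl
      exact h2 (add_comm _ _)
    · subst h2
      exact absurd (by simp) h1
    · rfl

theorem hd_sum_top (g : MvPolynomial (Fin n) A) (c : Fin n →₀ ℕ)
    (h : ∀ a ∈ g.support, a.degree ≤ c.degree) : hd c g = C (coeff c g) := by
  classical
  have h0 : ∀ s : Finset (Fin n →₀ ℕ), (∀ a ∈ s, a.degree ≤ c.degree) →
      hd c (∑ a ∈ s, monomial a (coeff a g)) = ∑ a ∈ s, if a = c then C (coeff a g) else 0 := by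
    intro s hs
    induction s using Finset.induction_on with
    | empty => simp [hd]
    | insert a s ha ih =>
      rw [Finset.sum_insert ha, Finset.sum_insert ha, hd_add,
        ih (fun b hb => hs b (Finset.mem_insert_of_mem hb))]
      have : monomial a (coeff a g) = C (coeff a g) * monomial a 1 := by
        rw [C_mul_monomial, mul_one]
      rw [this, hd_C_mul, hd_monomial_top a c (hs a (Finset.mem_insert_self _ _))]
      simp
  conv_lhs => rw [g.as_sum]
  rw [h0 _ h, Finset.sum_ite_eq']
  split_ifs with hc
  · rfl
  · rw [notMem_support_iff.1 hc, map_zero]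

end Leibniz

end LCFin


namespace LCFin

open MvPolynomial Finset

section Bernstein

variable {k : Type*} [Field k] {n : ℕ} {M : Type*} [AddCommGroup M] [Module k M]

/-- Data of an action of the ring of differential operators, with a good filtration. -/
structure BData (k : Type*) [Field k] (n : ℕ) (M : Type*) [AddCommGroup M] [Module k M] where
  ι : MvPolynomial (Fin n) k →ₐ[k] Module.End k M
  D : (Fin n →₀ ℕ) → Module.End k M
  D0 : D 0 = 1
  hX : ∀ b i, D (b + Finsupp.single i 1) * ι (X i) =
      ι (X i) * D (b + Finsupp.single i 1) + D b
  hX0 : ∀ b i, b i = 0 → D b * ι (X i) = ι (X i) * D b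
  V : ℕ → Submodule k M
  mono : Monotone V
  exh : ∀ v, ∃ j, v ∈ V j
  fin : ∀ j, Module.Finite k (V j)
  Cst : ℕ
  bound : ∀ j, Module.finrank k (V j) ≤ Cst * (j + 1) ^ n
  XV : ∀ i j v, v ∈ V j → ι (X i) v ∈ V (j + 1)
  DV : ∀ b j v, v ∈ V j → D b v ∈ V (j + b.degree)

variable (B : BData k n M)

/-- Stable subspaces. -/
structure BData.Stable (L : Submodule k M) : Prop where
  hX : ∀ i v, v ∈ L → B.ι (X i) v ∈ L
  hD : ∀ b v, v ∈ L → B.D b v ∈ L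

theorem BData.ι_C (a : k) (v : M) : B.ι (C a) v = a • v := by
  rw [← MvPolynomial.algebraMap_eq, AlgHom.commutes, Module.algebraMap_end_apply]

theorem BData.Stable.ι {L : Submodule k M} (h : B.Stable L) (g : MvPolynomial (Fin n) k)
    (v : M) (hv : v ∈ L) : B.ι g v ∈ L := by
  induction g using MvPolynomial.induction_on generalizing v with
  | C a => rw [B.ι_C]; exact L.smul_mem _ hv
  | add p q hp hq => rw [map_add]; exact L.add_mem (hp _ hv) (hq _ hv)
  | mul_X p i hp => rw [map_mul]; exact hp _ (h.hX _ _ hv)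

theorem BData.monomial_V (a : Fin n →₀ ℕ) : ∀ (r : k) (j : ℕ) (v : M), v ∈ B.V j →
    B.ι (monomial a r) v ∈ B.V (j + a.degree) := by
  induction a using idx_induction with
  | h0 =>
    intro r j v hv
    have := B.ι_C r v
    rw [C_apply] at this
    rw [this]
    simpa using (B.V j).smul_mem r hv
  | h1 b i ih =>
    intro r j v hv
    have : (monomial (b + Finsupp.single i 1) r) = monomial b r * X i := by
      rw [X, monomial_mul, mul_one]
    rw [this, map_mul, Module.End.mul_apply]
    have := ih r _ _ (B.XV i j v hv)
    convert this using 2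
    rw [map_add, Finsupp.degree_single]; omega

theorem BData.ι_V (g : MvPolynomial (Fin n) k) (m : ℕ) (hg : ∀ a ∈ g.support, a.degree ≤ m)
    (j : ℕ) (v : M) (hv : v ∈ B.V j) : B.ι g v ∈ B.V (j + m) := by
  rw [g.as_sum, map_sum, LinearMap.sum_apply]
  refine Submodule.sum_mem _ fun a ha => ?_
  exact B.mono (Nat.add_le_add_left (hg a ha) j) (B.monomial_V a _ j v hv)

/-- The operator attached to a family of coefficients. -/
noncomputable def BData.op : ((Fin n →₀ ℕ) →₀ MvPolynomial (Fin n) k) →ₗ[k] Module.End k M :=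
  Finsupp.lsum k fun b => (LinearMap.mulRight k (B.D b)).comp B.ι.toLinearMap

theorem BData.op_single (b : Fin n →₀ ℕ) (g : MvPolynomial (Fin n) k) :
    B.op (Finsupp.single b g) = B.ι g * B.D b := by
  simp [BData.op]

theorem BData.op_apply_mem (P : Submodule k M) (G : (Fin n →₀ ℕ) →₀ MvPolynomial (Fin n) k)
    (v : M) (h : ∀ b ∈ G.support, B.ι (G b) (B.D b v) ∈ P) : B.op G v ∈ P := by
  rw [BData.op, Finsupp.lsum_apply, Finsupp.sum, LinearMap.sum_apply]
  exact Submodule.sum_mem _ fun b hb => h b hb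

/-- shifting the coefficients. -/
noncomputable def shiftG (β : Fin n →₀ ℕ) (G : (Fin n →₀ ℕ) →₀ MvPolynomial (Fin n) k) :
    (Fin n →₀ ℕ) →₀ MvPolynomial (Fin n) k :=
  Finsupp.comapDomain (fun b => b + β) G (fun _ _ _ _ h => add_right_cancel h)

theorem shiftG_apply (β b : Fin n →₀ ℕ) (G : (Fin n →₀ ℕ) →₀ MvPolynomial (Fin n) k) :
    shiftG β G b = G (b + β) := rfl

theorem BData.op_comm (i : Fin n) (G : (Fin n →₀ ℕ) →₀ MvPolynomial (Fin n) k) :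
    B.op G * B.ι (X i) = B.ι (X i) * B.op G + B.op (shiftG (Finsupp.single i 1) G) := by
  classical
  induction G using Finsupp.induction_linear with
  | zero =>
    have : shiftG (Finsupp.single i 1) (0 : (Fin n →₀ ℕ) →₀ MvPolynomial (Fin n) k) = 0 := by
      ext1 b; rfl
    simp [this]
  | add f g hf hg =>
    have : shiftG (Finsupp.single i 1) (f + g) =
        shiftG (Finsupp.single i 1) f + shiftG (Finsupp.single i 1) g := by
      ext1 b; rfl
    rw [this, map_add, map_add, add_mul, mul_add, hf, hg]; abel
  | single b g =>
    have hcomm : B.ι (X i) * B.ι g = B.ι g * B.ι (X i) := by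
      rw [← map_mul, mul_comm, map_mul]
    by_cases hb : b i = 0
    · have : shiftG (Finsupp.single i 1) (Finsupp.single b g) = 0 := by
        ext1 c
        rw [shiftG_apply, Finsupp.single_apply, if_neg]; rfl
        rintro rfl
        simp at hb
      rw [this, map_zero, add_zero, B.op_single, mul_assoc, B.hX0 b i hb, ← mul_assoc, ← mul_assoc,
        hcomm]
    · have hle : Finsupp.single i 1 ≤ b := by
        simpa using Nat.one_le_iff_ne_zero.2 hb
      obtain ⟨b', rfl⟩ := exists_add_of_le hle
      rw [add_comm (Finsupp.single i 1) b']
      have : shiftG (Finsupp.single i 1) (Finsupp.single (b' + Finsupp.single i 1) g) =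
          Finsupp.single b' g := by
        ext1 c
        rw [shiftG_apply, Finsupp.single_apply, Finsupp.single_apply]
        simp
      rw [this, B.op_single, B.op_single, mul_assoc, B.hX, mul_add, ← mul_assoc, ← mul_assoc,
        hcomm]

variable {B} {L L' : Submodule k M}

theorem BData.shift_maps (hL : B.Stable L) (hL' : B.Stable L')
    (G : (Fin n →₀ ℕ) →₀ MvPolynomial (Fin n) k) (J : ℕ)
    (β : Fin n →₀ ℕ) : ∀ J' : ℕ, J' + β.degree ≤ J → 
    (∀ v ∈ L ⊓ B.V J, B.op G v ∈ L') →
    ∀ v ∈ L ⊓ B.V J', B.op (shiftG β G) v ∈ L' := by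
  induction β using idx_induction with
  | h0 =>
    intro J' hJ h v hv
    have : shiftG 0 G = G := by ext1 b; rw [shiftG_apply, add_zero]
    rw [this]
    exact h v ⟨hv.1, B.mono (by omega) hv.2⟩
  | h1 b i ih =>
    intro J' hJ h v hv
    rw [map_add, Finsupp.degree_single] at hJ
    have ih' := ih (J' + 1) (by omega) h
    have e : shiftG (b + Finsupp.single i 1) G = shiftG (Finsupp.single i 1) (shiftG b G) := by
      ext1 c; rw [shiftG_apply, shiftG_apply, shiftG_apply]; congr 1; abel
    have := congrArg (fun φ => φ v) (B.op_comm i (shiftG b G))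
    simp only [Module.End.mul_apply, LinearMap.add_apply] at this
    rw [e, ← sub_eq_of_eq_add' this]
    refine L'.sub_mem (ih' _ ⟨hL.hX _ _ hv.1, B.XV _ _ _ hv.2⟩) (hL'.hX _ _ (ih' _ ⟨hv.1, ?_⟩))
    exact B.mono (by omega) hv.2

theorem BData.hd_maps (hL : B.Stable L) (hL' : B.Stable L')
    (g : MvPolynomial (Fin n) k) (J : ℕ) (h : ∀ v ∈ L ⊓ B.V J, B.ι g v ∈ L') (d : ℕ) :
    ∀ (c : Fin n →₀ ℕ) (J' : ℕ), c.degree = d → J' + d ≤ J →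
    ∀ v ∈ L ⊓ B.V J', B.ι (hd c g) v ∈ L' := by
  classical
  induction d using Nat.strong_induction_on with
  | _ d ih =>
  intro c J' hc hJ v hv
  have lb := leibniz (B.ι : MvPolynomial (Fin n) k →+* Module.End k M) B.D
    (fun a b => by
      ext v
      simp only [Module.End.mul_apply, RingHom.coe_coe, B.ι_C, map_smul]) B.hX B.hX0 g c
  have hmem : (c, (0 : Fin n →₀ ℕ)) ∈ antidiagonal c := by simp
  rw [← Finset.add_sum_erase _ _ hmem] at lb
  have := congrArg (fun φ => φ v) lb
  simp only [Module.End.mul_apply, LinearMap.add_apply, B.D0, RingHom.coe_coe,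
    Module.End.one_apply] at this
  rw [← sub_eq_of_eq_add this]
  refine L'.sub_mem (hL'.hD _ _ (h _ ⟨hv.1, B.mono (by omega) hv.2⟩)) ?_
  rw [LinearMap.sum_apply]
  refine Submodule.sum_mem _ fun p hp => ?_
  rw [Finset.mem_erase, HasAntidiagonal.mem_antidiagonal] at hp
  obtain ⟨hp1, hp2⟩ := hp
  have hdeg : p.1.degree + p.2.degree = d := by rw [← map_add, hp2, hc]
  have hlt : p.1.degree < d := by
    rcases Nat.eq_zero_or_pos p.2.degree with h0 | h0
    · rw [Finsupp.degree_eq_zero_iff] at h0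
      exfalso; apply hp1
      ext1
      · simpa [h0] using hp2
      · exact h0
    · omega
  refine ih _ hlt p.1 (J' + p.2.degree) rfl (by omega) (B.D p.2 v) ⟨hL.hD _ _ hv.1, B.DV _ _ _ hv.2⟩

theorem BData.op_inj (hL : B.Stable L) (hL' : B.Stable L') (j0 m : ℕ) (v : M)
    (hv : v ∈ L ⊓ B.V j0) (hvL : v ∉ L') (G : (Fin n →₀ ℕ) →₀ MvPolynomial (Fin n) k)
    (hG : ∀ b ∈ G.support, b.degree ≤ m) (hG' : ∀ b, ∀ a ∈ (G b).support, a.degree ≤ m)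
    (h : ∀ v ∈ L ⊓ B.V (j0 + 2 * m), B.op G v ∈ L') : G = 0 := by
  by_contra hne
  obtain ⟨β, hβ, hmax⟩ := G.support.exists_max_image Finsupp.degree
    (Finsupp.support_nonempty_iff.2 hne)
  have hs : shiftG β G = Finsupp.single 0 (G β) := by
    ext1 b
    by_cases hb : b = 0
    · subst hb; rw [shiftG_apply, zero_add, Finsupp.single_eq_same]
    · rw [shiftG_apply, Finsupp.single_eq_of_ne hb]
      by_contra hGb
      have := hmax _ (Finsupp.mem_support_iff.2 hGb)
      rw [map_add] at this
      exact hb ((Finsupp.degree_eq_zero_iff _).1 (by omega))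
  have h1 := BData.shift_maps hL hL' G (j0 + 2 * m) β (j0 + m) (by have := hG β hβ; omega) h
  rw [hs, B.op_single, B.D0, mul_one] at h1
  have hg : G β ≠ 0 := Finsupp.mem_support_iff.1 hβ
  obtain ⟨c, hc, hcmax⟩ := (G β).support.exists_max_image Finsupp.degree
    (MvPolynomial.support_nonempty.2 hg)
  have h2 := BData.hd_maps hL hL' (G β) (j0 + m) h1 c.degree c j0 rfl
    (by have := hG' β c hc; omega) v hv
  rw [hd_sum_top _ _ hcmax, B.ι_C] at h2
  exact hvL ((L'.smul_mem_iff (MvPolynomial.mem_support_iff.1 hc)).1 h2)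

/-- box of exponents -/
noncomputable def boxIdx {n j : ℕ} (a : Fin n → Fin (j + 1)) : Fin n →₀ ℕ :=
  Finsupp.equivFunOnFinite.symm fun i => (a i : ℕ)

theorem boxIdx_inj {n j : ℕ} : Function.Injective (boxIdx (n := n) (j := j)) := by
  intro a b h
  have := Finsupp.equivFunOnFinite.symm.injective h
  funext i
  exact Fin.ext (congrFun this i)

theorem boxIdx_degree {n j : ℕ} (a : Fin n → Fin (j + 1)) : (boxIdx a).degree ≤ n * j := by
  rw [Finsupp.degree_eq_sum]
  calc ∑ i, boxIdx a i ≤ ∑ i : Fin n, j := Finset.sum_le_sum fun i _ => Nat.lt_succ_iff.1 (a i).2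
    _ = n * j := by simp

/-- arrays of scalars to coefficient families -/
noncomputable def arr (k : Type*) [Field k] (n j : ℕ) :
    ((Fin n → Fin (j + 1)) → (Fin n → Fin (j + 1)) → k) →ₗ[k]
      ((Fin n →₀ ℕ) →₀ MvPolynomial (Fin n) k) :=
  ∑ b, (Finsupp.lsingle (boxIdx b)).comp
    ((∑ a, (monomial (boxIdx a)).comp (LinearMap.proj a)).comp (LinearMap.proj b))

theorem arr_apply (j : ℕ) (c : (Fin n → Fin (j + 1)) → (Fin n → Fin (j + 1)) → k) :
    arr k n j c = ∑ b, Finsupp.single (boxIdx b) (∑ a, monomial (boxIdx a) (c b a)) := by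
  simp only [arr, LinearMap.sum_apply, LinearMap.comp_apply, LinearMap.proj_apply,
    Finsupp.lsingle_apply]

theorem arr_apply_apply (j : ℕ) (c : (Fin n → Fin (j + 1)) → (Fin n → Fin (j + 1)) → k)
    (b : Fin n → Fin (j + 1)) :
    arr k n j c (boxIdx b) = (∑ a, monomial (boxIdx a) (c b a)) := by
  classical
  rw [arr_apply, Finsupp.finsetSum_apply, Finset.sum_eq_single b]
  · simp
  · intro b' _ hb
    exact Finsupp.single_eq_of_ne (fun h => hb (boxIdx_inj h).symm)
  · simp

theorem arr_inj (j : ℕ) (c : (Fin n → Fin (j + 1)) → (Fin n → Fin (j + 1)) → k)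
    (h : arr k n j c = 0) : c = 0 := by
  classical
  funext b a
  have h1 := congrArg (fun G => coeff (boxIdx a) (G (boxIdx b))) h
  simp only [arr_apply_apply, coeff_sum, coeff_monomial, Finsupp.coe_zero, Pi.zero_apply,
    coeff_zero] at h1
  rw [Finset.sum_eq_single a] at h1
  · simpa using h1
  · intro a' _ ha
    exact if_neg fun h => ha (boxIdx_inj h)
  · simp

theorem arr_supp (j : ℕ) (c : (Fin n → Fin (j + 1)) → (Fin n → Fin (j + 1)) → k) :
    ∀ b ∈ (arr k n j c).support, ∃ b' : Fin n → Fin (j + 1), b = boxIdx b' := by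
  classical
  intro b hb
  by_contra hcon
  push Not at hcon
  rw [Finsupp.mem_support_iff, arr_apply, Finsupp.finsetSum_apply] at hb
  exact hb (Finset.sum_eq_zero fun b' _ => Finsupp.single_eq_of_ne (hcon b'))

theorem arr_deg (j : ℕ) (c : (Fin n → Fin (j + 1)) → (Fin n → Fin (j + 1)) → k) :
    ∀ b ∈ (arr k n j c).support, b.degree ≤ n * j := by
  intro b hb
  obtain ⟨b', rfl⟩ := arr_supp j c b hb
  exact boxIdx_degree b'

theorem arr_deg' (j : ℕ) (c : (Fin n → Fin (j + 1)) → (Fin n → Fin (j + 1)) → k) :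
    ∀ b, ∀ a ∈ (arr k n j c b).support, a.degree ≤ n * j := by
  classical
  intro b a ha
  by_cases hb : b ∈ (arr k n j c).support
  · obtain ⟨b', rfl⟩ := arr_supp j c b hb
    rw [arr_apply_apply, mem_support_iff, coeff_sum] at ha
    obtain ⟨a', _, ha'⟩ := Finset.exists_ne_zero_of_sum_ne_zero ha
    rw [coeff_monomial] at ha'
    have : boxIdx a' = a := by
      by_contra h; rw [if_neg h] at ha'; exact ha' rfl
    rw [← this]; exact boxIdx_degree a'
  · rw [Finsupp.notMem_support_iff.1 hb] at ha
    simp at ha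

theorem BData.dim_step (hL : B.Stable L) (hL' : B.Stable L') (hle : L' ≤ L) (j0 j : ℕ) (v : M)
    (hv : v ∈ L ⊓ B.V j0) (hvL : v ∉ L') :
    (j + 1) ^ (2 * n) + Module.finrank k (B.V (j0 + 2 * (n * j))) *
      Module.finrank k (L' ⊓ B.V (j0 + 4 * (n * j)) : Submodule k M) ≤
     Module.finrank k (B.V (j0 + 2 * (n * j))) *
      Module.finrank k (L ⊓ B.V (j0 + 4 * (n * j)) : Submodule k M) := by
  classical
  set J := j0 + 2 * (n * j) with hJ
  set J' := j0 + 4 * (n * j) with hJ'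
  have := B.fin J
  have := B.fin J'
  let P : Submodule k M := L ⊓ B.V J
  let P' : Submodule k M := L ⊓ B.V J'
  let Q : Submodule k (M ⧸ L') := P'.map L'.mkQ
  have finP : Module.Finite k P := Submodule.finiteDimensional_of_le (inf_le_right : P ≤ B.V J)
  have finP' : Module.Finite k P' :=
    Submodule.finiteDimensional_of_le (inf_le_right : P' ≤ B.V J')
  have hmap : ∀ (c : (Fin n → Fin (j + 1)) → (Fin n → Fin (j + 1)) → k) (x : P),
      B.op (arr k n j c) x ∈ P' := by
    intro c x
    refine B.op_apply_mem P' _ _ fun b hb => ⟨?_, ?_⟩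
    · exact hL.ι B _ _ (hL.hD _ _ x.2.1)
    · refine B.mono ?_ (B.ι_V _ (n * j) (arr_deg' j c b) _ _ (B.DV b _ _ x.2.2))
      have := arr_deg j c b hb
      omega
  let Φ : ((Fin n → Fin (j + 1)) → (Fin n → Fin (j + 1)) → k) →ₗ[k] (P →ₗ[k] Q) :=
    { toFun := fun c => (L'.mkQ ∘ₗ (B.op (arr k n j c)) ∘ₗ P.subtype).codRestrict Q
        (fun x => Submodule.mem_map_of_mem (hmap c x))
      map_add' := by
        intro c d; ext x; simp
      map_smul' := by
        intro c d; ext x; simp }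
  have hΦ : Function.Injective Φ := by
    refine (injective_iff_map_eq_zero Φ).2 ?_
    intro c hc
    apply arr_inj
    refine BData.op_inj hL hL' j0 (n * j) v hv hvL _ (arr_deg j c) (arr_deg' j c) ?_
    intro w hw
    have := congrArg (fun φ => ((φ ⟨w, hw⟩ : Q) : M ⧸ L')) hc
    simpa [Φ] using this
  have h1 := LinearMap.finrank_le_finrank_of_injective hΦ
  rw [Module.finrank_linearMap] at h1
  have h2 : Module.finrank k ((Fin n → Fin (j + 1)) → (Fin n → Fin (j + 1)) → k) =
      (j + 1) ^ (2 * n) := by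
    rw [Module.finrank_pi_fintype]
    simp [← pow_add, two_mul]
  rw [h2] at h1
  have h3 : Module.finrank k P ≤ Module.finrank k (B.V J) :=
    Submodule.finrank_mono (inf_le_right : P ≤ B.V J)
  have h4 : Module.finrank k Q + Module.finrank k (L' ⊓ B.V J' : Submodule k M) =
      Module.finrank k P' := by
    have := LinearMap.finrank_range_add_finrank_ker (L'.mkQ.domRestrict P')
    rw [LinearMap.range_domRestrict] at this
    rw [← this]
    congr 1
    have e : LinearMap.ker (L'.mkQ.domRestrict P') =
        Submodule.comap P'.subtype (L' ⊓ B.V J') := by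
      ext x
      simp only [LinearMap.mem_ker, LinearMap.domRestrict_apply, Submodule.mkQ_apply,
        Submodule.Quotient.mk_eq_zero, Submodule.mem_comap, Submodule.subtype_apply,
        Submodule.mem_inf]
      exact ⟨fun h => ⟨h, x.2.2⟩, fun h => h.1⟩
    rw [e]
    exact (Submodule.comapSubtypeEquivOfLe (inf_le_inf_right _ hle)).finrank_eq.symm
  change _ ≤ _ * Module.finrank k P'
  rw [← h4, mul_add]
  exact Nat.add_le_add_right (h1.trans (Nat.mul_le_mul_right _ h3)) _

theorem BData.chain_bound (B : BData k n M) (s : ℕ → Submodule k M) (l : ℕ)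
    (hs : ∀ i ≤ l, B.Stable (s i)) (hlt : ∀ i < l, s i < s (i + 1)) :
    l ≤ B.Cst * (2 * n + 1) ^ n * (B.Cst * (4 * n + 1) ^ n) := by
  classical
  have hex : ∀ i < l, ∃ v j, v ∈ s (i + 1) ⊓ B.V j ∧ v ∉ s i := by
    intro i hi
    obtain ⟨v, hv, hv'⟩ := SetLike.exists_of_lt (hlt i hi)
    obtain ⟨j, hj⟩ := B.exh v
    exact ⟨v, j, ⟨hv, hj⟩, hv'⟩
  have hj0 : ∃ j0, ∀ i < l, ∃ v, v ∈ s (i + 1) ⊓ B.V j0 ∧ v ∉ s i := by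
    choose! v j h1 h2 using hex
    refine ⟨(Finset.range l).sup j, fun i hi => ⟨v i, ⟨(h1 i hi).1, ?_⟩, h2 i hi⟩⟩
    exact B.mono (Finset.le_sup (f := j) (Finset.mem_range.2 hi)) (h1 i hi).2
  obtain ⟨j0, hj0⟩ := hj0
  set J := j0 + 2 * (n * j0) with hJ
  set J' := j0 + 4 * (n * j0) with hJ'
  have key : ∀ i ≤ l, i * (j0 + 1) ^ (2 * n) ≤ Module.finrank k (B.V J) *
      Module.finrank k (s i ⊓ B.V J' : Submodule k M) := by
    intro i
    induction i with
    | zero => intro _; simp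
    | succ i ih =>
      intro hi
      obtain ⟨v, hv, hv'⟩ := hj0 i (by omega)
      have h1 := BData.dim_step (hs (i + 1) hi) (hs i (by omega)) (hlt i (by omega)).le j0 j0 v hv hv'
      have h2 := ih (by omega)
      rw [← hJ, ← hJ'] at h1
      rw [add_mul, one_mul]
      omega
  have h1 := key l le_rfl
  have := B.fin J'
  have h2 : Module.finrank k (s l ⊓ B.V J' : Submodule k M) ≤ Module.finrank k (B.V J') :=
    Submodule.finrank_mono inf_le_right
  have h3 : J + 1 ≤ (2 * n + 1) * (j0 + 1) := by rw [hJ]; nlinarith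
  have h4 : J' + 1 ≤ (4 * n + 1) * (j0 + 1) := by rw [hJ']; nlinarith
  have h5 : l * (j0 + 1) ^ (2 * n) ≤
      (B.Cst * (2 * n + 1) ^ n * (B.Cst * (4 * n + 1) ^ n)) * (j0 + 1) ^ (2 * n) := by
    calc l * (j0 + 1) ^ (2 * n) ≤ _ := h1
      _ ≤ (B.Cst * (J + 1) ^ n) * (B.Cst * (J' + 1) ^ n) :=
        Nat.mul_le_mul (B.bound J) (h2.trans (B.bound J'))
      _ ≤ (B.Cst * ((2 * n + 1) * (j0 + 1)) ^ n) * (B.Cst * ((4 * n + 1) * (j0 + 1)) ^ n) := by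
        gcongr
      _ = _ := by rw [mul_pow, mul_pow, two_mul n, pow_add]; ring
  exact Nat.le_of_mul_le_mul_right h5 (by positivity)

end Bernstein

end LCFin


namespace LCFin

open MvPolynomial Finset

section Box

variable {A : Type*} [CommRing A] {n : ℕ}

/-- Polynomials with all exponents at most `m`. -/
def InBox (m : ℕ) (g : MvPolynomial (Fin n) A) : Prop := ∀ i, degreeOf i g ≤ m

theorem InBox.mono {m m' : ℕ} (h : m ≤ m') {g : MvPolynomial (Fin n) A} (hg : InBox m g) :
    InBox m' g := fun i => (hg i).trans h

theorem InBox.mul {m m' : ℕ} {g g' : MvPolynomial (Fin n) A} (hg : InBox m g)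
    (hg' : InBox m' g') : InBox (m + m') (g * g') := fun i =>
  (degreeOf_mul_le i g g').trans (Nat.add_le_add (hg i) (hg' i))

theorem InBox.pow {m : ℕ} {g : MvPolynomial (Fin n) A} (hg : InBox m g) (k : ℕ) :
    InBox (m * k) (g ^ k) := by
  intro i
  refine (degreeOf_pow_le i g k).trans ?_
  rw [mul_comm]
  exact Nat.mul_le_mul_right _ (hg i)

theorem InBox.add {m : ℕ} {g g' : MvPolynomial (Fin n) A} (hg : InBox m g)
    (hg' : InBox m g') : InBox m (g + g') := fun i =>
  (degreeOf_add_le i g g').trans (max_le (hg i) (hg' i))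

theorem InBox.neg {m : ℕ} {g : MvPolynomial (Fin n) A} (hg : InBox m g) : InBox m (-g) := fun i => by
  rw [degreeOf_neg]; exact hg i

theorem InBox.sub {m : ℕ} {g g' : MvPolynomial (Fin n) A} (hg : InBox m g)
    (hg' : InBox m g') : InBox m (g - g') := by
  rw [sub_eq_add_neg]; exact hg.add hg'.neg

theorem InBox.zero {m : ℕ} : InBox m (0 : MvPolynomial (Fin n) A) := fun i => by
  rw [degreeOf_zero]; exact Nat.zero_le _

theorem InBox.sum {ι : Type*} {m : ℕ} (s : Finset ι) (g : ι → MvPolynomial (Fin n) A)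
    (h : ∀ i ∈ s, InBox m (g i)) : InBox m (∑ i ∈ s, g i) := by
  classical
  induction s using Finset.induction_on with
  | empty => simpa using InBox.zero
  | insert a s ha ih =>
    rw [Finset.sum_insert ha]
    exact (h a (mem_insert_self _ _)).add (ih fun i hi => h i (mem_insert_of_mem hi))

theorem InBox.X {i : Fin n} : InBox 1 (X i : MvPolynomial (Fin n) A) := by
  classical
  intro j
  rcases subsingleton_or_nontrivial A with h | h
  · rw [Subsingleton.elim (MvPolynomial.X i : MvPolynomial (Fin n) A) 0, degreeOf_zero]; simp
  · rw [degreeOf_X]; split_ifs <;> simp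

theorem InBox.C_mul {m : ℕ} (a : A) {g : MvPolynomial (Fin n) A} (hg : InBox m g) :
    InBox m (C a * g) := fun i => (degreeOf_C_mul_le g i a).trans (hg i)

theorem InBox.exists (g : MvPolynomial (Fin n) A) : ∃ m, InBox m g :=
  ⟨Finset.univ.sup fun i => degreeOf i g, fun i => Finset.le_sup (f := fun i => degreeOf i g)
    (Finset.mem_univ i)⟩

theorem degreeOf_hd_monomial (l : Fin n) (a : Fin n →₀ ℕ) : ∀ c : Fin n →₀ ℕ,
    degreeOf l (hd c (monomial a (1 : A))) ≤ a l := by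
  classical
  induction a using idx_induction with
  | h0 =>
    intro c
    have : (monomial (0 : Fin n →₀ ℕ) (1 : A)) = C 1 := rfl
    rw [this, hd, tau_C, MvPowerSeries.coeff_C]
    split_ifs <;> simp [degreeOf_zero, degreeOf_one]
  | h1 b i ih =>
    intro c
    have : (monomial (b + Finsupp.single i 1) (1 : A)) = monomial b 1 * X i := by
      rw [X, monomial_mul, one_mul]
    rw [this, hd_mul_X]
    refine (degreeOf_add_le _ _ _).trans (max_le ?_ ?_)
    · rw [Finsupp.add_apply]
      by_cases hl : l = i
      · subst hl
        refine (degreeOf_mul_le _ _ _).trans (Nat.add_le_add (ih c) ?_)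
        simpa using InBox.X (i := l) l
      · rw [degreeOf_mul_X_of_ne _ hl]
        exact (ih c).trans (Nat.le_add_right _ _)
    · split_ifs
      · exact (ih _).trans (by simp)
      · simp

theorem InBox.hd {m : ℕ} {g : MvPolynomial (Fin n) A} (hg : InBox m g) (c : Fin n →₀ ℕ) :
    InBox m (hd c g) := by
  have h0 : LCFin.hd c g = ∑ a ∈ g.support, C (coeff a g) * LCFin.hd c (monomial a 1) := by
    conv_lhs => rw [g.as_sum]
    have : ∀ s : Finset (Fin n →₀ ℕ), LCFin.hd c (∑ a ∈ s, monomial a (coeff a g)) =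
      ∑ a ∈ s, C (coeff a g) * LCFin.hd c (monomial a 1) := by
      classical
      intro s
      induction s using Finset.induction_on with
      | empty => simp [LCFin.hd]
      | insert a s ha ih =>
        rw [Finset.sum_insert ha, Finset.sum_insert ha, hd_add, ih, ← hd_C_mul, C_mul_monomial,
          mul_one]
    exact this _
  rw [h0]
  refine InBox.sum _ _ fun a ha => InBox.C_mul _ fun i => ?_
  exact (degreeOf_hd_monomial i a c).trans ((monomial_le_degreeOf i ha).trans (hg i))

end Box

section Loc

variable {A : Type*} [CommRing A] {n : ℕ}

/-- localization of the polynomial ring. -/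
abbrev Loc (f : MvPolynomial (Fin n) A) : Type _ := Localization.Away f

/-- Taylor expansion to the localization, on polynomials -/
noncomputable def tauR (f : MvPolynomial (Fin n) A) :
    MvPolynomial (Fin n) A →ₐ[A] MvPowerSeries (Fin n) (Loc f) :=
  AlgHom.comp (MvPowerSeries.mapAlgHom (IsScalarTower.toAlgHom A (MvPolynomial (Fin n) A) (Loc f)))
    (tau A n)

theorem coeff_tauR (f g : MvPolynomial (Fin n) A) (b : Fin n →₀ ℕ) :
    MvPowerSeries.coeff b (tauR f g) = algebraMap (MvPolynomial (Fin n) A) (Loc f) (hd b g) := by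
  simp [tauR, hd, MvPowerSeries.mapAlgHom_apply]

theorem tauR_unit (f : MvPolynomial (Fin n) A) (y : Submonoid.powers f) :
    IsUnit (tauR f y) := by
  rw [MvPowerSeries.isUnit_iff_constantCoeff, ← MvPowerSeries.coeff_zero_eq_constantCoeff_apply,
    coeff_tauR, hd_zero]
  exact IsLocalization.map_units (Loc f) y

/-- Taylor expansion on the localization -/
noncomputable def tauL (f : MvPolynomial (Fin n) A) :
    Loc f →ₐ[A] MvPowerSeries (Fin n) (Loc f) :=
  IsLocalization.liftAlgHom (M := Submonoid.powers f) (f := tauR f) (tauR_unit f)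

theorem tauL_algebraMap (f g : MvPolynomial (Fin n) A) :
    tauL f (algebraMap (MvPolynomial (Fin n) A) (Loc f) g) = tauR f g := by
  rw [tauL, IsLocalization.liftAlgHom_apply, IsLocalization.lift_eq]; rfl

/-- Hasse derivatives on the localization -/
noncomputable def dl (f : MvPolynomial (Fin n) A) (b : Fin n →₀ ℕ) : Loc f →ₗ[A] Loc f :=
  ((MvPowerSeries.coeff (R := Loc f) b).restrictScalars A).comp (tauL f).toLinearMap

theorem dl_apply (f : MvPolynomial (Fin n) A) (b : Fin n →₀ ℕ) (u : Loc f) :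
    dl f b u = MvPowerSeries.coeff b (tauL f u) := rfl

theorem dl_algebraMap (f : MvPolynomial (Fin n) A) (b : Fin n →₀ ℕ) (g) :
    dl f b (algebraMap (MvPolynomial (Fin n) A) (Loc f) g) = algebraMap (MvPolynomial (Fin n) A) (Loc f) (hd b g) := by
  rw [dl_apply, tauL_algebraMap, coeff_tauR]

theorem dl_zero (f : MvPolynomial (Fin n) A) : dl f 0 = LinearMap.id := by
  have : ((MvPowerSeries.constantCoeff (σ := Fin n) (R := Loc f)).comp
      (tauL f).toRingHom) = RingHom.id _ := by
    apply IsLocalization.ringHom_ext (Submonoid.powers f)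
    refine RingHom.ext fun g => ?_
    have h := tauL_algebraMap f g
    simp only [RingHom.comp_apply, RingHom.id_apply]
    change MvPowerSeries.constantCoeff (tauL f (algebraMap (MvPolynomial (Fin n) A) (Loc f) g)) = _
    rw [h, ← MvPowerSeries.coeff_zero_eq_constantCoeff_apply, coeff_tauR, hd_zero]
  ext1 u
  have := congrArg (fun φ => φ u) this
  exact this

theorem dl_mul (f g : MvPolynomial (Fin n) A) (b : Fin n →₀ ℕ) (u : Loc f) :
    dl f b (algebraMap (MvPolynomial (Fin n) A) (Loc f) g * u) =
      ∑ p ∈ antidiagonal b, algebraMap (MvPolynomial (Fin n) A) (Loc f) (hd p.1 g) * dl f p.2 u := by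
  classical
  rw [dl_apply, map_mul, tauL_algebraMap, MvPowerSeries.coeff_mul]
  simp only [coeff_tauR, dl_apply]

theorem dl_X (f : MvPolynomial (Fin n) A) (b : Fin n →₀ ℕ) (i : Fin n) (u : Loc f) :
    dl f b (algebraMap (MvPolynomial (Fin n) A) (Loc f) (X i) * u) = algebraMap (MvPolynomial (Fin n) A) (Loc f) (X i) * dl f b u +
      if Finsupp.single i 1 ≤ b then dl f (b - Finsupp.single i 1) u else 0 := by
  classical
  have e : tauR f (X i) = MvPowerSeries.C (algebraMap (MvPolynomial (Fin n) A) (Loc f) (X i)) + MvPowerSeries.X i := by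
    change MvPowerSeries.map (algebraMap (MvPolynomial (Fin n) A) (Loc f)) (tau A n (X i)) = _
    rw [tau_X, map_add, MvPowerSeries.map_C, MvPowerSeries.map_X]
  rw [dl_apply, map_mul, tauL_algebraMap, e, add_mul, map_add, MvPowerSeries.coeff_C_mul,
    MvPowerSeries.X_def, MvPowerSeries.coeff_monomial_mul, one_mul]
  rfl

/-- restriction maps -/
noncomputable def res (g h : MvPolynomial (Fin n) A) (hgh : g ∣ h) :
    Loc g →ₐ[MvPolynomial (Fin n) A] Loc h :=
  IsLocalization.liftAlgHom (M := Submonoid.powers g) (f := Algebra.ofId _ (Loc h)) (by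
    rintro ⟨_, k, rfl⟩
    simp only [Algebra.ofId_apply, map_pow]
    apply IsUnit.pow
    exact isUnit_of_dvd_unit (map_dvd (algebraMap (MvPolynomial (Fin n) A) (Loc h)) hgh)
      (IsLocalization.map_units (Loc h) (⟨h, Submonoid.mem_powers h⟩ : Submonoid.powers h)))

theorem res_ext (g : MvPolynomial (Fin n) A) {P : Type*} [CommRing P]
    [Algebra (MvPolynomial (Fin n) A) P]
    (φ ψ : Loc g →ₐ[MvPolynomial (Fin n) A] P) : φ = ψ := by
  have := IsLocalization.algHom_subsingleton (Submonoid.powers g) (S := Loc g) (P := P)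
  exact Subsingleton.elim _ _

theorem res_dl (g h : MvPolynomial (Fin n) A) (hgh : g ∣ h) (b : Fin n →₀ ℕ) (u : Loc g) :
    res g h hgh (dl g b u) = dl h b (res g h hgh u) := by
  have : (MvPowerSeries.map (σ := Fin n) (res g h hgh).toRingHom).comp (tauL g).toRingHom =
      (tauL h).toRingHom.comp (res g h hgh).toRingHom := by
    apply IsLocalization.ringHom_ext (Submonoid.powers g)
    refine RingHom.ext fun x => ?_
    change MvPowerSeries.map (σ := Fin n) (res g h hgh).toRingHom (tauL g (algebraMap (MvPolynomial (Fin n) A) (Loc g) x)) =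
      tauL h (res g h hgh (algebraMap (MvPolynomial (Fin n) A) (Loc g) x))
    rw [AlgHom.commutes, tauL_algebraMap, tauL_algebraMap]
    ext b
    rw [MvPowerSeries.coeff_map, coeff_tauR, coeff_tauR]
    exact AlgHom.commutes _ _
  have := congrArg (fun φ => MvPowerSeries.coeff b (φ u)) this
  simpa [MvPowerSeries.coeff_map, dl_apply] using this

/-- the filtration -/
def InW (f : MvPolynomial (Fin n) A) (k m : ℕ) (u : Loc f) : Prop :=
  ∃ h, InBox m h ∧ algebraMap (MvPolynomial (Fin n) A) (Loc f) (f ^ k) * u = algebraMap (MvPolynomial (Fin n) A) (Loc f) h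

theorem InW.dl_aux (f : MvPolynomial (Fin n) A) (d : ℕ) (hd' : InBox d f) (m : ℕ) (k : ℕ) :
    ∀ (N : ℕ) (b : Fin n →₀ ℕ), b.degree = N → ∀ u, InW f k m u →
      InW f (k + N) (m + d * N) (dl f b u) := by
  classical
  induction k with
  | zero =>
    rintro N b hb u ⟨h, hh, e⟩
    rw [pow_zero, map_one, one_mul] at e
    subst e
    refine ⟨f ^ N * hd b h, ?_, ?_⟩
    · rw [add_comm]
      exact (hd'.pow N).mul (hh.hd b)
    · rw [dl_algebraMap, zero_add, map_mul]
  | succ k ihk =>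
    intro N
    induction N using Nat.strong_induction_on with
    | _ N ihN =>
    rintro b hb u hu
    have hu' := hu
    obtain ⟨h, hh, e⟩ := hu
    have hfu : InW f k m (algebraMap (MvPolynomial (Fin n) A) (Loc f) f * u) := ⟨h, hh, by
      rw [← e, pow_succ, map_mul, mul_assoc]⟩
    obtain ⟨h1, hh1, e1⟩ := ihk N b hb _ hfu
    have hmem : ((0 : Fin n →₀ ℕ), b) ∈ antidiagonal b := by simp
    rw [dl_mul, ← Finset.add_sum_erase _ _ hmem] at e1
    simp only [hd_zero] at e1
    have hrest : ∀ p ∈ (antidiagonal b).erase (0, b), ∃ h2, InBox (m + d * N) h2 ∧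
        algebraMap (MvPolynomial (Fin n) A) (Loc f) (f ^ (k + N)) * (algebraMap (MvPolynomial (Fin n) A) (Loc f) (hd p.1 f) * dl f p.2 u) =
          algebraMap (MvPolynomial (Fin n) A) (Loc f) h2 := by
      intro p hp
      rw [Finset.mem_erase, HasAntidiagonal.mem_antidiagonal] at hp
      obtain ⟨hp1, hp2⟩ := hp
      have hdeg : p.1.degree + p.2.degree = N := by rw [← map_add, hp2, hb]
      have hpos : 0 < p.1.degree := by
        rcases Nat.eq_zero_or_pos p.1.degree with h0 | h0
        · rw [Finsupp.degree_eq_zero_iff] at h0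
          exfalso; apply hp1
          ext1
          · exact h0
          · simpa [h0] using hp2
        · exact h0
      obtain ⟨h2, hh2, e2⟩ := ihN p.2.degree (by omega) p.2 rfl u hu'
      refine ⟨f ^ (p.1.degree - 1) * hd p.1 f * h2, ?_, ?_⟩
      · have := ((hd'.pow (p.1.degree - 1)).mul (hd'.hd p.1)).mul hh2
        refine this.mono (le_of_eq ?_)
        rw [← hdeg]
        obtain ⟨q, hq⟩ : ∃ q, p.1.degree = q + 1 := ⟨p.1.degree - 1, by omega⟩
        rw [hq, Nat.add_sub_cancel]; ring
      · have : k + N = (p.1.degree - 1) + (k + 1 + p.2.degree) := by omega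
        rw [this, pow_add, map_mul, map_mul, map_mul, ← e2]
        ring
    choose! h2 hh2 e2 using hrest
    refine ⟨h1 - ∑ p ∈ (antidiagonal b).erase (0, b), h2 p, hh1.sub (InBox.sum _ _ hh2), ?_⟩
    rw [map_sub, ← e1, map_sum, mul_add, Finset.mul_sum, Finset.sum_congr rfl e2,
      add_sub_cancel_right]
    rw [show k + 1 + N = (k + N) + 1 by ring, pow_succ, map_mul, mul_assoc]

theorem InW.dl {f : MvPolynomial (Fin n) A} {d : ℕ} (hd' : InBox d f) {j : ℕ} {u : Loc f}
    (hu : InW f j ((d + 1) * j) u) (b : Fin n →₀ ℕ) :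
    InW f (j + b.degree) ((d + 1) * (j + b.degree)) (dl f b u) := by
  obtain ⟨h, hh, e⟩ := InW.dl_aux f d hd' _ j _ b rfl u hu
  exact ⟨h, hh.mono (by nlinarith), e⟩

theorem InW.X {f : MvPolynomial (Fin n) A} {d : ℕ} (hd' : InBox d f) {j : ℕ} {u : Loc f}
    (hu : InW f j ((d + 1) * j) u) (i : Fin n) :
    InW f (j + 1) ((d + 1) * (j + 1)) (algebraMap (MvPolynomial (Fin n) A) (Loc f) (X i) * u) := by
  obtain ⟨h, hh, e⟩ := hu
  refine ⟨f * MvPolynomial.X i * h, ?_, ?_⟩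
  · exact ((hd'.mul InBox.X).mul hh).mono (by nlinarith)
  · rw [map_mul, ← e, pow_succ, map_mul, map_mul]; ring

theorem InW.mono {f : MvPolynomial (Fin n) A} {d : ℕ} (hd' : InBox d f) {j j' : ℕ} (hj : j ≤ j')
    {u : Loc f} (hu : InW f j ((d + 1) * j) u) : InW f j' ((d + 1) * j') u := by
  obtain ⟨h, hh, e⟩ := hu
  obtain ⟨q, rfl⟩ := Nat.exists_eq_add_of_le hj
  refine ⟨f ^ q * h, ?_, ?_⟩
  · exact ((hd'.pow q).mul hh).mono (by nlinarith)
  · rw [map_mul, ← e, pow_add, map_mul]; ring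

theorem InW.exh {f : MvPolynomial (Fin n) A} {d : ℕ} (hd' : InBox d f) (u : Loc f) :
    ∃ j, InW f j ((d + 1) * j) u := by
  obtain ⟨⟨h, ⟨_, k, rfl⟩⟩, e⟩ := IsLocalization.surj (Submonoid.powers f) u
  obtain ⟨m, hm⟩ := InBox.exists h
  refine ⟨k + m, f ^ m * h, ?_, ?_⟩
  · exact ((hd'.pow m).mul hm).mono (by nlinarith)
  · rw [map_mul, ← e, pow_add, map_mul]; ring

/-- the spanning set of the filtration step -/
noncomputable def wgen (f : MvPolynomial (Fin n) A) (j m : ℕ) (a : Fin n → Fin (m + 1)) : Loc f :=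
  IsLocalization.mk' (Loc f) (monomial (boxIdx a) (1 : A)) (⟨f ^ j, Submonoid.mem_powers_iff _ _ |>.2 ⟨j, rfl⟩⟩ : Submonoid.powers f)

theorem inW_wgen (f : MvPolynomial (Fin n) A) (j m : ℕ) (a : Fin n → Fin (m + 1)) :
    InW f j m (wgen f j m a) := by
  refine ⟨monomial (boxIdx a) 1, ?_, ?_⟩
  · intro i
    rcases subsingleton_or_nontrivial A with h | h
    · rw [Subsingleton.elim (monomial (boxIdx a) (1 : A)) 0, degreeOf_zero]; simp
    · rw [degreeOf_monomial_eq _ _ one_ne_zero]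
      exact Nat.lt_succ_iff.1 (a i).2
  · rw [mul_comm, wgen]
    exact IsLocalization.mk'_spec (Loc f) _ (⟨f ^ j, Submonoid.mem_powers_iff _ _ |>.2 ⟨j, rfl⟩⟩ : Submonoid.powers f)

theorem InW.mem_span {f : MvPolynomial (Fin n) A} {j m : ℕ} {u : Loc f} (hu : InW f j m u) :
    u ∈ Submodule.span A (Set.range (wgen f j m)) := by
  obtain ⟨h, hh, e⟩ := hu
  have hunit := IsLocalization.map_units (Loc f) (⟨f ^ j, Submonoid.mem_powers_iff _ _ |>.2 ⟨j, rfl⟩⟩ : Submonoid.powers f)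
  have hu : u = ∑ a ∈ h.support, coeff a h • IsLocalization.mk' (Loc f) (monomial a (1 : A))
      (⟨f ^ j, Submonoid.mem_powers_iff _ _ |>.2 ⟨j, rfl⟩⟩ : Submonoid.powers f) := by
    apply hunit.mul_left_cancel
    refine e.trans ?_
    conv_lhs => rw [h.as_sum]
    rw [map_sum, Finset.mul_sum]
    refine Finset.sum_congr rfl fun a _ => ?_
    have e1 : monomial a (coeff a h) = coeff a h • monomial a (1 : A) := by
      rw [smul_monomial, smul_eq_mul, mul_one]
    have e2 : algebraMap (MvPolynomial (Fin n) A) (Loc f) (monomial a (1 : A)) =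
        algebraMap (MvPolynomial (Fin n) A) (Loc f) (f ^ j) *
        IsLocalization.mk' (Loc f) (monomial a (1 : A))
          (⟨f ^ j, Submonoid.mem_powers_iff _ _ |>.2 ⟨j, rfl⟩⟩ : Submonoid.powers f) :=
      (IsLocalization.mk'_spec' (Loc f) _ (⟨f ^ j, Submonoid.mem_powers_iff _ _ |>.2 ⟨j, rfl⟩⟩ : Submonoid.powers f)).symm
    have e3 : ∀ g, algebraMap (MvPolynomial (Fin n) A) (Loc f) (coeff a h • g) =
        coeff a h • algebraMap (MvPolynomial (Fin n) A) (Loc f) g := fun g =>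
      map_smul (IsScalarTower.toAlgHom A (MvPolynomial (Fin n) A) (Loc f)) _ _
    rw [e1, e3, e2]
    exact (mul_smul_comm _ _ _).symm
  rw [hu]
  refine Submodule.sum_mem _ fun a ha => Submodule.smul_mem _ _ (Submodule.subset_span ?_)
  refine ⟨fun i => ⟨a i, Nat.lt_succ_iff.2 ((monomial_le_degreeOf i ha).trans (hh i))⟩, ?_⟩
  rw [wgen]
  congr 2
  congr 1
  ext i; rfl

end Loc

end LCFin


namespace LCFin

open MvPolynomial Finset TensorProduct

section

variable {A : Type*} [CommRing A] {n : ℕ} (κ : Type*) [Field κ] [Algebra A κ]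
  (f : MvPolynomial (Fin n) A)

/-- multiplication operators -/
noncomputable def iotaK : MvPolynomial (Fin n) κ →ₐ[κ] Module.End κ (κ ⊗[A] Loc f) :=
  (Algebra.lmul κ (κ ⊗[A] Loc f)).comp
    (aeval fun i => (1 : κ) ⊗ₜ[A] algebraMap (MvPolynomial (Fin n) A) (Loc f) (X i))

theorem iotaK_X (i : Fin n) (a : κ) (u : Loc f) : iotaK κ f (X i) (a ⊗ₜ u) =
    a ⊗ₜ (algebraMap (MvPolynomial (Fin n) A) (Loc f) (X i) * u) := by
  simp [iotaK]

theorem dlK_hX (b : Fin n →₀ ℕ) (i : Fin n) :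
    ((dl f (b + Finsupp.single i 1)).baseChange κ : Module.End κ (κ ⊗[A] Loc f)) * iotaK κ f (X i) =
      iotaK κ f (X i) * (dl f (b + Finsupp.single i 1)).baseChange κ + (dl f b).baseChange κ := by
  ext u
  simp only [TensorProduct.AlgebraTensorModule.curry_apply, LinearMap.restrictScalars_comp,
    LinearMap.restrictScalars_self, TensorProduct.curry_apply, LinearMap.coe_restrictScalars,
    Module.End.mul_apply, LinearMap.add_apply, iotaK_X, LinearMap.baseChange_tmul]
  rw [dl_X, if_pos (by simp), TensorProduct.tmul_add, add_tsub_cancel_right]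

theorem dlK_hX0 (b : Fin n →₀ ℕ) (i : Fin n) (hb : b i = 0) :
    ((dl f b).baseChange κ : Module.End κ (κ ⊗[A] Loc f)) * iotaK κ f (X i) =
      iotaK κ f (X i) * (dl f b).baseChange κ := by
  ext u
  simp only [TensorProduct.AlgebraTensorModule.curry_apply, LinearMap.restrictScalars_comp,
    LinearMap.restrictScalars_self, TensorProduct.curry_apply, LinearMap.coe_restrictScalars,
    Module.End.mul_apply, iotaK_X, LinearMap.baseChange_tmul]
  rw [dl_X, if_neg (by simp [hb]), add_zero]

/-- filtration on the base change -/
noncomputable def VK (d j : ℕ) : Submodule κ (κ ⊗[A] Loc f) :=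
  Submodule.span κ (Set.range fun a => (1 : κ) ⊗ₜ[A] wgen f j ((d + 1) * j) a)

theorem InW.mem_VK {d j : ℕ} {u : Loc f} (hu : InW f j ((d + 1) * j) u) (a : κ) :
    a ⊗ₜ[A] u ∈ VK κ f d j := by
  have h := hu.mem_span
  clear hu
  have h1 : (1 : κ) ⊗ₜ[A] u ∈ VK κ f d j := by
    induction h using Submodule.span_induction with
    | mem x hx =>
      obtain ⟨a, rfl⟩ := hx
      exact Submodule.subset_span ⟨a, rfl⟩
    | zero => rw [TensorProduct.tmul_zero]; exact Submodule.zero_mem _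
    | add x y _ _ hx hy => rw [TensorProduct.tmul_add]; exact Submodule.add_mem _ hx hy
    | smul r x _ hx =>
      rw [← TensorProduct.smul_tmul, ← Algebra.algebraMap_eq_smul_one]
      have := (VK κ f d j).smul_mem (algebraMap A κ r) hx
      rwa [TensorProduct.smul_tmul', smul_eq_mul, mul_one] at this
  have := (VK κ f d j).smul_mem a h1
  rwa [TensorProduct.smul_tmul', smul_eq_mul, mul_one] at this

theorem VK_induction {d j : ℕ} (P : Submodule κ (κ ⊗[A] Loc f))
    (φ : Module.End κ (κ ⊗[A] Loc f))
    (h : ∀ u, InW f j ((d + 1) * j) u → φ ((1 : κ) ⊗ₜ u) ∈ P) (v : κ ⊗[A] Loc f)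
    (hv : v ∈ VK κ f d j) : φ v ∈ P := by
  have : VK κ f d j ≤ P.comap φ := by
    rw [VK, Submodule.span_le]
    rintro _ ⟨a, rfl⟩
    exact h _ (inW_wgen f j _ a)
  exact this hv

theorem VK_mono {d : ℕ} (hd' : InBox d f) : Monotone (VK κ f d) := by
  intro j j' hj v hv
  exact VK_induction κ f (VK κ f d j') LinearMap.id (fun u hu => (hu.mono hd' hj).mem_VK κ f 1) v hv

theorem exists_BData : Nonempty (Σ' B : BData κ n (κ ⊗[A] Loc f),
    (∀ i, B.ι (X i) = iotaK κ f (X i)) ∧ (∀ b, B.D b = (dl f b).baseChange κ)) := by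
  obtain ⟨d, hd'⟩ := InBox.exists f
  refine ⟨⟨{
    ι := iotaK κ f
    D := fun b => (dl f b).baseChange κ
    D0 := ?_
    hX := dlK_hX κ f
    hX0 := dlK_hX0 κ f
    V := VK κ f d
    mono := VK_mono κ f hd'
    exh := ?_
    fin := ?_
    Cst := (d + 1) ^ n
    bound := ?_
    XV := ?_
    DV := ?_ }, fun i => rfl, fun b => rfl⟩⟩
  · rw [dl_zero, LinearMap.baseChange_id]; rfl
  · intro v
    induction v using TensorProduct.induction_on with
    | zero => exact ⟨0, Submodule.zero_mem _⟩
    | tmul a u =>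
      obtain ⟨j, hj⟩ := InW.exh hd' u
      exact ⟨j, hj.mem_VK κ f a⟩
    | add x y hx hy =>
      obtain ⟨j, hj⟩ := hx
      obtain ⟨j', hj'⟩ := hy
      exact ⟨max j j', Submodule.add_mem _ (VK_mono κ f hd' (le_max_left _ _) hj)
        (VK_mono κ f hd' (le_max_right _ _) hj')⟩
  · intro j
    exact Module.Finite.span_of_finite κ (Set.finite_range _)
  · intro j
    refine (finrank_range_le_card _).trans ?_
    rw [Fintype.card_fun, Fintype.card_fin, Fintype.card_fin, ← mul_pow]
    gcongr
    nlinarith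
  · intro i j v hv
    refine VK_induction κ f _ (iotaK κ f (X i)) (fun u hu => ?_) v hv
    rw [iotaK_X]
    exact (hu.X hd' i).mem_VK κ f 1
  · intro b j v hv
    refine VK_induction κ f _ ((dl f b).baseChange κ) (fun u hu => ?_) v hv
    rw [LinearMap.baseChange_tmul]
    exact (hu.dl hd' b).mem_VK κ f 1

end

end LCFin


namespace LCFin

open MvPolynomial Finset TensorProduct

section SRing

variable (A : Type*) [CommRing A] (n : ℕ) (A' : Type*) [CommRing A']

/-- Relations defining the ring of differential operators. -/
inductive SRel : FreeAlgebra A' (MvPolynomial (Fin n) A ⊕ (Fin n →₀ ℕ)) →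
    FreeAlgebra A' (MvPolynomial (Fin n) A ⊕ (Fin n →₀ ℕ)) → Prop
  | one : SRel (FreeAlgebra.ι A' (Sum.inl 1)) 1
  | mul (r s) : SRel (FreeAlgebra.ι A' (Sum.inl (r * s)))
      (FreeAlgebra.ι A' (Sum.inl r) * FreeAlgebra.ι A' (Sum.inl s))
  | add (r s) : SRel (FreeAlgebra.ι A' (Sum.inl (r + s)))
      (FreeAlgebra.ι A' (Sum.inl r) + FreeAlgebra.ι A' (Sum.inl s))
  | D0 : SRel (FreeAlgebra.ι A' (Sum.inr 0)) 1
  | DC (a b) : SRel (FreeAlgebra.ι A' (Sum.inr b) * FreeAlgebra.ι A' (Sum.inl (C a)))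
      (FreeAlgebra.ι A' (Sum.inl (C a)) * FreeAlgebra.ι A' (Sum.inr b))
  | DX (b i) : SRel (FreeAlgebra.ι A' (Sum.inr (b + Finsupp.single i 1)) *
        FreeAlgebra.ι A' (Sum.inl (X i)))
      (FreeAlgebra.ι A' (Sum.inl (X i)) * FreeAlgebra.ι A' (Sum.inr (b + Finsupp.single i 1)) +
        FreeAlgebra.ι A' (Sum.inr b))
  | DX0 (b i) (h : b i = 0) :
      SRel (FreeAlgebra.ι A' (Sum.inr b) * FreeAlgebra.ι A' (Sum.inl (X i)))
        (FreeAlgebra.ι A' (Sum.inl (X i)) * FreeAlgebra.ι A' (Sum.inr b))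

/-- The ring of differential operators. -/
def SR : Type _ := RingQuot (SRel A n A')

noncomputable instance : Ring (SR A n A') := inferInstanceAs (Ring (RingQuot (SRel A n A')))
noncomputable instance : Algebra A' (SR A n A') :=
  inferInstanceAs (Algebra A' (RingQuot (SRel A n A')))

/-- quotient map -/
noncomputable def mkS : FreeAlgebra A' (MvPolynomial (Fin n) A ⊕ (Fin n →₀ ℕ)) →ₐ[A'] SR A n A' :=
  RingQuot.mkAlgHom A' (SRel A n A')

theorem mkS_rel {x y} (h : SRel A n A' x y) : mkS A n A' x = mkS A n A' y :=
  RingQuot.mkAlgHom_rel A' h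

/-- functions in the ring of differential operators -/
noncomputable def jS : MvPolynomial (Fin n) A →+* SR A n A' :=
  RingHom.mk' { toFun := fun r => mkS A n A' (FreeAlgebra.ι A' (Sum.inl r))
                map_one' := by rw [mkS_rel A n A' SRel.one, map_one]
                map_mul' := fun r s => by rw [mkS_rel A n A' (SRel.mul r s), map_mul] }
    (fun r s => by
      change mkS A n A' (FreeAlgebra.ι A' (Sum.inl (r + s))) = _
      rw [mkS_rel A n A' (SRel.add r s), map_add]; rfl)

/-- divided power derivations -/
noncomputable def DS (b : Fin n →₀ ℕ) : SR A n A' := mkS A n A' (FreeAlgebra.ι A' (Sum.inr b))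

theorem jS_apply (r) : jS A n A' r = mkS A n A' (FreeAlgebra.ι A' (Sum.inl r)) := rfl

theorem DS_zero : DS A n A' 0 = 1 := by
  rw [DS, mkS_rel A n A' SRel.D0, map_one]

theorem DS_C (a b) : DS A n A' b * jS A n A' (C a) = jS A n A' (C a) * DS A n A' b := by
  rw [DS, jS_apply, ← map_mul, mkS_rel A n A' (SRel.DC a b), map_mul]

theorem DS_X (b i) : DS A n A' (b + Finsupp.single i 1) * jS A n A' (X i) =
    jS A n A' (X i) * DS A n A' (b + Finsupp.single i 1) + DS A n A' b := by
  rw [DS, DS, jS_apply, ← map_mul, mkS_rel A n A' (SRel.DX b i), map_add, map_mul]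

theorem DS_X0 (b i) (h : b i = 0) : DS A n A' b * jS A n A' (X i) =
    jS A n A' (X i) * DS A n A' b := by
  rw [DS, jS_apply, ← map_mul, mkS_rel A n A' (SRel.DX0 b i h), map_mul]

theorem DS_leibniz (g : MvPolynomial (Fin n) A) (c : Fin n →₀ ℕ) :
    DS A n A' c * jS A n A' g =
      ∑ p ∈ antidiagonal c, jS A n A' (hd p.1 g) * DS A n A' p.2 :=
  leibniz (jS A n A') (DS A n A') (fun a b => DS_C A n A' a b) (DS_X A n A') (DS_X0 A n A') g c

variable {A n A'}

theorem SR_induction {P : SR A n A' → Prop} (hA : ∀ a, P (algebraMap A' _ a))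
    (hj : ∀ r, P (jS A n A' r)) (hD : ∀ b, P (DS A n A' b))
    (hmul : ∀ x y, P x → P y → P (x * y)) (hadd : ∀ x y, P x → P y → P (x + y)) (s) : P s := by
  obtain ⟨x, rfl⟩ := RingQuot.mkAlgHom_surjective A' (SRel A n A') s
  change P (mkS A n A' x)
  induction x using FreeAlgebra.induction with
  | grade0 r => rw [AlgHom.commutes]; exact hA r
  | grade1 x =>
    rcases x with r | b
    · exact hj r
    · exact hD b
  | mul a b ha hb => rw [map_mul]; exact hmul _ _ ha hb
  | add a b ha hb => rw [map_add]; exact hadd _ _ ha hb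

noncomputable instance : Module (MvPolynomial (Fin n) A) (SR A n A') :=
  Module.compHom _ (jS A n A')

theorem smul_SR (r : MvPolynomial (Fin n) A) (s : SR A n A') : r • s = jS A n A' r * s := rfl

theorem smul_eq_jS {M : Type*} [AddCommGroup M] [Module (SR A n A') M]
    [Module (MvPolynomial (Fin n) A) M] [IsScalarTower (MvPolynomial (Fin n) A) (SR A n A') M]
    (r : MvPolynomial (Fin n) A) (m : M) : r • m = jS A n A' r • m := by
  have := smul_assoc r (1 : SR A n A') m
  rw [one_smul, smul_SR, mul_one] at this
  exact this.symm

/-- linearity from generators -/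
def mkLin {M M' : Type*} [AddCommGroup M] [Module (SR A n A') M] [AddCommGroup M']
    [Module (SR A n A') M'] (φ : M →+ M')
    (hA : ∀ a m, φ (algebraMap A' (SR A n A') a • m) = algebraMap A' (SR A n A') a • φ m)
    (hj : ∀ r m, φ (jS A n A' r • m) = jS A n A' r • φ m)
    (hD : ∀ b m, φ (DS A n A' b • m) = DS A n A' b • φ m) : M →ₗ[SR A n A'] M' :=
  { toFun := φ
    map_add' := map_add φ
    map_smul' := fun s => by
      induction s using SR_induction with
      | hA a => exact hA a
      | hj r => exact hj r
      | hD b => exact hD b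
      | hmul x y hx hy => intro m; simp only [RingHom.id_apply] at *; rw [mul_smul, hx, hy, mul_smul]
      | hadd x y hx hy =>
        intro m; simp only [RingHom.id_apply] at *; rw [add_smul, map_add, hx, hy, add_smul] }

theorem mkLin_apply {M M' : Type*} [AddCommGroup M] [Module (SR A n A') M] [AddCommGroup M']
    [Module (SR A n A') M'] (φ : M →+ M') (hA hj hD) (m : M) :
    mkLin (A := A) (n := n) (A' := A') φ hA hj hD m = φ m := rfl

/-- submodules from generators -/
def mkSub {M : Type*} [AddCommGroup M] [Module (SR A n A') M] (G : AddSubgroup M)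
    (hA : ∀ a, ∀ m ∈ G, algebraMap A' (SR A n A') a • m ∈ G)
    (hj : ∀ r, ∀ m ∈ G, jS A n A' r • m ∈ G)
    (hD : ∀ b, ∀ m ∈ G, DS A n A' b • m ∈ G) : Submodule (SR A n A') M :=
  { G with
    smul_mem' := fun s => by
      induction s using SR_induction with
      | hA a => exact fun {m} => hA a m
      | hj r => exact fun {m} => hj r m
      | hD b => exact fun {m} => hD b m
      | hmul x y hx hy => intro m hm; rw [mul_smul]; exact hx (hy hm)
      | hadd x y hx hy => intro m hm; rw [add_smul]; exact G.add_mem (hx hm) (hy hm) }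

end SRing

section FiniteAss

variable {A : Type*} [CommRing A] {n : ℕ} {A' : Type*} [CommRing A']


theorem torsion_D {M : Type*} [AddCommGroup M] [Module (SR A n A') M]
    (r : MvPolynomial (Fin n) A) (k : ℕ) (q : M) (hq : jS A n A' (r ^ k) • q = 0) (d : ℕ) :
    ∀ b : Fin n →₀ ℕ, b.degree = d → ∃ N, jS A n A' (r ^ N) • (DS A n A' b • q) = 0 := by
  classical
  induction d using Nat.strong_induction_on with
  | _ d ih =>
  intro b hb
  have h := congrArg (fun s => s • q) (DS_leibniz A n A' (r ^ k) b)
  simp only [mul_smul, hq, smul_zero, Finset.sum_smul] at h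
  have hmem : ((0 : Fin n →₀ ℕ), b) ∈ antidiagonal b := by simp
  rw [← Finset.add_sum_erase _ _ hmem] at h
  simp only [hd_zero] at h
  have hrest : ∀ p ∈ (antidiagonal b).erase (0, b), ∃ N,
      jS A n A' (r ^ N) • (jS A n A' (hd p.1 (r ^ k)) • DS A n A' p.2 • q) = 0 := by
    intro p hp
    rw [Finset.mem_erase, HasAntidiagonal.mem_antidiagonal] at hp
    obtain ⟨hp1, hp2⟩ := hp
    have hdeg : p.1.degree + p.2.degree = d := by rw [← map_add, hp2, hb]
    have hpos : 0 < p.1.degree := by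
      rcases Nat.eq_zero_or_pos p.1.degree with h0 | h0
      · rw [Finsupp.degree_eq_zero_iff] at h0
        exfalso; apply hp1
        ext1
        · exact h0
        · simpa [h0] using hp2
      · exact h0
    obtain ⟨N, hN⟩ := ih p.2.degree (by omega) p.2 rfl
    refine ⟨N, ?_⟩
    rw [← mul_smul, ← map_mul, mul_comm, map_mul, mul_smul, hN, smul_zero]
  choose! N hN using hrest
  refine ⟨(∑ p ∈ (antidiagonal b).erase (0, b), N p) + k, ?_⟩
  rw [pow_add, map_mul, mul_smul, eq_neg_of_add_eq_zero_left h.symm, smul_neg, Finset.smul_sum,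
    Finset.sum_eq_zero, neg_zero]
  intro p hp
  obtain ⟨c, hc⟩ := Nat.exists_eq_add_of_le (Finset.single_le_sum (f := N)
    (fun _ _ => Nat.zero_le _) hp)
  rw [hc, add_comm, pow_add, map_mul, mul_smul, hN p hp, smul_zero]

/-- torsion submodule -/
def torS (A' : Type*) [CommRing A'] (M : Type*) [AddCommGroup M] [Module (SR A n A') M]
    (r : MvPolynomial (Fin n) A) : Submodule (SR A n A') M :=
  mkSub
    { carrier := {q | ∃ k, jS A n A' (r ^ k) • q = 0}
      zero_mem' := ⟨0, smul_zero _⟩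
      add_mem' := by
        rintro x y ⟨k, hk⟩ ⟨l, hl⟩
        refine ⟨k + l, ?_⟩
        rw [smul_add]
        nth_rw 1 [add_comm k l]
        rw [pow_add, pow_add, map_mul, map_mul, mul_smul, mul_smul, hk, hl, smul_zero, smul_zero,
          add_zero]
      neg_mem' := by
        rintro x ⟨k, hk⟩
        exact ⟨k, by rw [smul_neg, hk, neg_zero]⟩ }
    (by
      rintro a m ⟨k, hk⟩
      exact ⟨k, by rw [← mul_smul, ← Algebra.commutes, mul_smul, hk, smul_zero]⟩)
    (by
      rintro a m ⟨k, hk⟩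
      exact ⟨k, by rw [← mul_smul, ← map_mul, mul_comm, map_mul, mul_smul, hk, smul_zero]⟩)
    (by
      rintro b m ⟨k, hk⟩
      exact torsion_D r k m hk _ b rfl)

theorem mem_torS (M : Type*) [AddCommGroup M] [Module (SR A n A') M]
    (r : MvPolynomial (Fin n) A) (q : M) : q ∈ torS A' M r ↔ ∃ k, jS A n A' (r ^ k) • q = 0 :=
  Iff.rfl

theorem ass_simple [IsNoetherianRing A] (M : Type*) [AddCommGroup M] [Module (SR A n A') M]
    [Module (MvPolynomial (Fin n) A) M] [IsScalarTower (MvPolynomial (Fin n) A) (SR A n A') M]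
    [IsSimpleModule (SR A n A') M] : (associatedPrimes (MvPolynomial (Fin n) A) M).Finite := by
  apply Set.Subsingleton.finite
  have key : ∀ P ∈ associatedPrimes (MvPolynomial (Fin n) A) M,
      ∀ P' ∈ associatedPrimes (MvPolynomial (Fin n) A) M, P ≤ P' := by
    intro P hP P' hP' r hr
    rw [AssociatedPrimes.mem_iff, isAssociatedPrime_iff] at hP hP'
    obtain ⟨hPp, x, hx⟩ := hP
    obtain ⟨hPp', x', hx'⟩ := hP'
    have hx0 : x ≠ 0 := by
      rintro rfl
      apply hPp.ne_top
      rw [hx, Ideal.eq_top_iff_one, Submodule.mem_colon_singleton]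
      simp
    have hrx : r • x = 0 := by
      rw [hx, Submodule.mem_colon_singleton] at hr
      simpa using hr
    have hmem : x ∈ torS A' M r := ⟨1, by rw [pow_one, ← smul_eq_jS, hrx]⟩
    have htop : torS A' M r = ⊤ := by
      rcases eq_bot_or_eq_top (torS A' M r) with h | h
      · rw [h, Submodule.mem_bot] at hmem; exact absurd hmem hx0
      · exact h
    have hmem' : x' ∈ torS A' M r := htop ▸ Submodule.mem_top
    obtain ⟨k, hk⟩ := hmem'
    rw [← smul_eq_jS] at hk
    apply hPp'.mem_of_pow_mem k
    rw [hx', Submodule.mem_colon_singleton, hk]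
    exact Submodule.zero_mem _
  intro P hP P' hP'
  exact le_antisymm (key P hP P' hP') (key P' hP' P hP)

theorem ass_finite [IsNoetherianRing A] (M : Type*) [AddCommGroup M] [Module (SR A n A') M]
    (h : IsFiniteLength (SR A n A') M) : ∀ (_ : Module (MvPolynomial (Fin n) A) M)
    (_ : IsScalarTower (MvPolynomial (Fin n) A) (SR A n A') M),
    (associatedPrimes (MvPolynomial (Fin n) A) M).Finite := by
  induction h with
  | of_subsingleton =>
    intro _ _
    rw [associatedPrimes.eq_empty_of_subsingleton]
    exact Set.finite_empty
  | @of_simple_quotient M _ _ N _ hN ih =>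
    intro _ _
    refine Set.Finite.subset (Set.Finite.union (ih inferInstance inferInstance)
      (ass_simple (A' := A') (M ⧸ N))) ?_
    refine associatedPrimes.subset_union_of_exact (f := N.subtype.restrictScalars (MvPolynomial (Fin n) A))
      (g := N.mkQ.restrictScalars (MvPolynomial (Fin n) A)) N.injective_subtype ?_
    exact LinearMap.exact_subtype_mkQ N

end FiniteAss

end LCFin


namespace LCFin

open MvPolynomial Finset TensorProduct

section TL

variable {A : Type*} [CommRing A] {n : ℕ} (A' : Type*) [CommRing A'] [Algebra A A']
  (N : Type*) [AddCommGroup N] [Module A N] [Module A' N] [IsScalarTower A A' N]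
  (f : MvPolynomial (Fin n) A)

/-- `N ⊗ R_f` with an action of differential operators. -/
def TL (_A' : Type*) {A : Type*} [CommRing A] {n : ℕ}
    (N : Type*) [AddCommGroup N] [Module A N] (f : MvPolynomial (Fin n) A) : Type _ :=
  N ⊗[A] Loc f

noncomputable instance : AddCommGroup (TL A' N f) := inferInstanceAs (AddCommGroup (N ⊗[A] Loc f))
noncomputable instance : Module A' (TL A' N f) := inferInstanceAs (Module A' (N ⊗[A] Loc f))

variable {N} in
/-- pure tensors -/
noncomputable def tm (x : N) (u : Loc f) : TL A' N f := x ⊗ₜ[A] u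

/-- operators on the tensor product -/
noncomputable def opT (φ : Loc f →ₗ[A] Loc f) : Module.End A' (TL A' N f) :=
  TensorProduct.AlgebraTensorModule.lTensor A' N φ

theorem opT_tm (φ : Loc f →ₗ[A] Loc f) (x : N) (u : Loc f) :
    opT A' N f φ (tm A' f x u) = tm A' f x (φ u) := rfl

variable {A' N f} in
theorem TL_induction {P : TL A' N f → Prop} (h0 : P 0) (ht : ∀ x u, P (tm A' f x u))
    (hadd : ∀ x y, P x → P y → P (x + y)) (z) : P z :=
  TensorProduct.induction_on z h0 ht hadd

theorem tm_add (x : N) (u v : Loc f) : tm A' f x (u + v) = tm A' f x u + tm A' f x v :=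
  TensorProduct.tmul_add _ _ _

theorem add_tm (x y : N) (u : Loc f) : tm A' f (x + y) u = tm A' f x u + tm A' f y u :=
  TensorProduct.add_tmul _ _ _

theorem tm_zero (x : N) : tm A' f x 0 = 0 := TensorProduct.tmul_zero _ _

theorem opT_one : opT A' N f LinearMap.id = 1 :=
  TensorProduct.AlgebraTensorModule.lTensor_id

theorem opT_comp (φ ψ : Loc f →ₗ[A] Loc f) :
    opT A' N f (φ ∘ₗ ψ) = opT A' N f φ * opT A' N f ψ :=
  TensorProduct.AlgebraTensorModule.lTensor_comp φ ψ

theorem opT_add (φ ψ : Loc f →ₗ[A] Loc f) :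
    opT A' N f (φ + ψ) = opT A' N f φ + opT A' N f ψ :=
  map_add (TensorProduct.AlgebraTensorModule.lTensor (R := A) A' N) φ ψ

/-- multiplication by a polynomial on the localization -/
noncomputable def mulL (r : MvPolynomial (Fin n) A) : Loc f →ₗ[A] Loc f :=
  LinearMap.mulLeft A (algebraMap (MvPolynomial (Fin n) A) (Loc f) r)

theorem mulL_apply (r : MvPolynomial (Fin n) A) (u : Loc f) :
  mulL f r u = algebraMap (MvPolynomial (Fin n) A) (Loc f) r * u := rfl

/-- the action -/
noncomputable def actS : SR A n A' →ₐ[A'] Module.End A' (TL A' N f) :=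
  RingQuot.liftAlgHom A' ⟨FreeAlgebra.lift A'
    (Sum.elim (fun r => opT A' N f (mulL f r)) (fun b => opT A' N f (dl f b))), by
    intro x y h
    induction h with
    | one =>
      simp only [FreeAlgebra.lift_ι_apply, Sum.elim_inl, map_one]
      rw [← opT_one A' N f]; congr 1; ext u; simp [mulL_apply]
    | mul r s =>
      simp only [FreeAlgebra.lift_ι_apply, Sum.elim_inl, map_mul]
      rw [← opT_comp]; congr 1; ext u; simp [mulL_apply, mul_assoc]
    | add r s =>
      simp only [FreeAlgebra.lift_ι_apply, Sum.elim_inl, map_add]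
      rw [← opT_add]; congr 1; ext u; simp [mulL_apply, add_mul]
    | D0 =>
      simp only [FreeAlgebra.lift_ι_apply, Sum.elim_inr, map_one]
      rw [← opT_one A' N f, dl_zero]
    | DC a b =>
      simp only [FreeAlgebra.lift_ι_apply, Sum.elim_inl, Sum.elim_inr, map_mul]
      rw [← opT_comp, ← opT_comp]; congr 1; ext u
      have hC : algebraMap (MvPolynomial (Fin n) A) (Loc f) (C a) = algebraMap A (Loc f) a := by
        rw [← MvPolynomial.algebraMap_eq, ← IsScalarTower.algebraMap_apply]
      simp only [LinearMap.comp_apply, mulL_apply, hC, ← Algebra.smul_def, map_smul]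
    | DX b i =>
      simp only [FreeAlgebra.lift_ι_apply, Sum.elim_inl, Sum.elim_inr, map_mul, map_add]
      rw [← opT_comp, ← opT_comp, ← opT_add]; congr 1; ext u
      simp only [LinearMap.comp_apply, mulL_apply, LinearMap.add_apply]
      rw [dl_X, if_pos (by simp), add_tsub_cancel_right]
    | DX0 b i h =>
      simp only [FreeAlgebra.lift_ι_apply, Sum.elim_inl, Sum.elim_inr, map_mul]
      rw [← opT_comp, ← opT_comp]; congr 1; ext u
      simp only [LinearMap.comp_apply, mulL_apply]
      rw [dl_X, if_neg (by simp [h]), add_zero]⟩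

theorem actS_j (r) : actS A' N f (jS A n A' r) = opT A' N f (mulL f r) := by
  refine (RingQuot.liftAlgHom_mkAlgHom_apply A' _ _ _).trans ?_
  rw [FreeAlgebra.lift_ι_apply]; rfl

theorem actS_D (b) : actS A' N f (DS A n A' b) = opT A' N f (dl f b) := by
  refine (RingQuot.liftAlgHom_mkAlgHom_apply A' _ _ _).trans ?_
  rw [FreeAlgebra.lift_ι_apply]; rfl

noncomputable instance : Module (SR A n A') (TL A' N f) :=
  Module.compHom _ (actS A' N f).toRingHom

noncomputable instance : Module (MvPolynomial (Fin n) A) (TL A' N f) :=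
  Module.compHom _ (jS A n A')

instance : IsScalarTower (MvPolynomial (Fin n) A) (SR A n A') (TL A' N f) :=
  ⟨fun r s m => by rw [smul_SR, mul_smul]; rfl⟩

theorem S_smul_def (s : SR A n A') (z : TL A' N f) : s • z = actS A' N f s z := rfl

theorem alg_smul (a : A') (z : TL A' N f) : algebraMap A' (SR A n A') a • z = a • z := by
  rw [S_smul_def, AlgHom.commutes, Module.algebraMap_end_apply]

theorem smul_tm (a : A') (x : N) (u : Loc f) : a • tm A' f x u = tm A' f (a • x) u := rfl

theorem jS_smul_tm (r : MvPolynomial (Fin n) A) (x : N) (u : Loc f) :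
    jS A n A' r • tm A' f x u = tm A' f x (algebraMap (MvPolynomial (Fin n) A) (Loc f) r * u) := by
  rw [S_smul_def, actS_j]; rfl

theorem r_smul_tm (r : MvPolynomial (Fin n) A) (x : N) (u : Loc f) :
    r • tm A' f x u = tm A' f x (algebraMap (MvPolynomial (Fin n) A) (Loc f) r * u) :=
  jS_smul_tm A' N f r x u

theorem D_smul_tm (b : Fin n →₀ ℕ) (x : N) (u : Loc f) :
    DS A n A' b • tm A' f x u = tm A' f x (dl f b u) := by
  rw [S_smul_def, actS_D]; rfl

variable {N} {N' : Type*} [AddCommGroup N'] [Module A N'] [Module A' N'] [IsScalarTower A A' N']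
  {N'' : Type*} [AddCommGroup N''] [Module A N''] [Module A' N''] [IsScalarTower A A' N'']

/-- functoriality in the module, additive version -/
noncomputable def TLmapAdd (φ : N →ₗ[A'] N') : TL A' N f →+ TL A' N' f :=
  (LinearMap.rTensor (Loc f) (φ.restrictScalars A)).toAddMonoidHom

theorem TLmapAdd_tm (φ : N →ₗ[A'] N') (x : N) (u : Loc f) :
    TLmapAdd A' f φ (tm A' f x u) = tm A' f (φ x) u := rfl

/-- functoriality in the module -/
noncomputable def TLmap (φ : N →ₗ[A'] N') : TL A' N f →ₗ[SR A n A'] TL A' N' f :=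
  mkLin (A := A) (n := n) (A' := A') (TLmapAdd A' f φ)
    (fun a m => by
      simp only [alg_smul]
      induction m using TL_induction with
      | h0 => rw [smul_zero, map_zero, smul_zero]
      | ht x u => rw [TLmapAdd_tm, smul_tm, smul_tm, TLmapAdd_tm, map_smul]
      | hadd x y hx hy => rw [smul_add, map_add, hx, hy, map_add, smul_add])
    (fun r m => by
      induction m using TL_induction with
      | h0 => rw [smul_zero, map_zero, smul_zero]
      | ht x u => rw [TLmapAdd_tm, jS_smul_tm, jS_smul_tm, TLmapAdd_tm]
      | hadd x y hx hy => rw [smul_add, map_add, hx, hy, map_add, smul_add])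
    (fun r m => by
      induction m using TL_induction with
      | h0 => rw [smul_zero, map_zero, smul_zero]
      | ht x u => rw [TLmapAdd_tm, D_smul_tm, D_smul_tm, TLmapAdd_tm]
      | hadd x y hx hy => rw [smul_add, map_add, hx, hy, map_add, smul_add])

theorem TLmap_tm (φ : N →ₗ[A'] N') (x : N) (u : Loc f) :
    TLmap A' f φ (tm A' f x u) = tm A' f (φ x) u := rfl

theorem TLmap_eq (φ : N →ₗ[A'] N') (z : TL A' N f) :
    TLmap A' f φ z = LinearMap.rTensor (Loc f) (φ.restrictScalars A) z := rfl

theorem TLmap_exact (φ : N →ₗ[A'] N') (ψ : N' →ₗ[A'] N'') (h : Function.Exact φ ψ)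
    (hψ : Function.Surjective ψ) : Function.Exact (TLmap A' f φ) (TLmap A' f ψ) :=
  rTensor_exact (f := φ.restrictScalars A) (g := ψ.restrictScalars A) (Loc f) h hψ

theorem TLmap_surj (φ : N →ₗ[A'] N') (h : Function.Surjective φ) :
    Function.Surjective (TLmap A' f φ) :=
  LinearMap.rTensor_surjective (Loc f) (g := φ.restrictScalars A) h

instance flat_Loc : Module.Flat A (Loc f) :=
  Module.Flat.trans A (MvPolynomial (Fin n) A) (Loc f)

theorem TLmap_exact' (φ : N →ₗ[A'] N') (ψ : N' →ₗ[A'] N'') (h : Function.Exact φ ψ) :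
    Function.Exact (TLmap A' f φ) (TLmap A' f ψ) :=
  Module.Flat.rTensor_exact (Loc f) (f := φ.restrictScalars A) (g := ψ.restrictScalars A) h

variable {f} in
/-- restriction maps, additive version -/
noncomputable def TLresAdd {g : MvPolynomial (Fin n) A} (h : f ∣ g) :
    TL A' N f →+ TL A' N g :=
  (LinearMap.lTensor N ((res f g h).toLinearMap.restrictScalars A)).toAddMonoidHom

variable {f} in
theorem TLresAdd_tm {g : MvPolynomial (Fin n) A} (h : f ∣ g) (x : N) (u : Loc f) :
    TLresAdd A' h (tm A' f x u) = tm A' g x (res f g h u) := rfl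

variable {f} in
/-- restriction maps -/
noncomputable def TLres {g : MvPolynomial (Fin n) A} (h : f ∣ g) :
    TL A' N f →ₗ[SR A n A'] TL A' N g :=
  mkLin (A := A) (n := n) (A' := A') (TLresAdd A' h)
    (fun a m => by
      simp only [alg_smul]
      induction m using TL_induction with
      | h0 => rw [smul_zero, map_zero, smul_zero]
      | ht x u => rw [TLresAdd_tm, smul_tm, smul_tm, TLresAdd_tm]
      | hadd x y hx hy => rw [smul_add, map_add, hx, hy, map_add, smul_add])
    (fun r m => by
      induction m using TL_induction with
      | h0 => rw [smul_zero, map_zero, smul_zero]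
      | ht x u => rw [TLresAdd_tm, jS_smul_tm, jS_smul_tm, TLresAdd_tm, map_mul, AlgHom.commutes]
      | hadd x y hx hy => rw [smul_add, map_add, hx, hy, map_add, smul_add])
    (fun r m => by
      induction m using TL_induction with
      | h0 => rw [smul_zero, map_zero, smul_zero]
      | ht x u => rw [TLresAdd_tm, D_smul_tm, D_smul_tm, TLresAdd_tm, res_dl]
      | hadd x y hx hy => rw [smul_add, map_add, hx, hy, map_add, smul_add])

variable {f}

theorem TLres_tm {g : MvPolynomial (Fin n) A} (h : f ∣ g) (x : N) (u : Loc f) :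
    TLres A' h (tm A' f x u) = tm A' g x (res f g h u) := rfl

theorem TLres_TLres {g k : MvPolynomial (Fin n) A} (h : f ∣ g) (h' : g ∣ k) (z : TL A' N f) :
    TLres A' h' (TLres A' h z) = TLres A' (h.trans h') z := by
  induction z using TL_induction with
  | h0 => simp
  | ht x u =>
    rw [TLres_tm, TLres_tm, TLres_tm]
    have := congrArg (fun φ => φ u) (res_ext f ((res g k h').comp (res f g h))
      (res f k (h.trans h')))
    simp only [AlgHom.comp_apply] at this
    rw [this]
  | hadd x y hx hy => rw [map_add, map_add, hx, hy, map_add]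

theorem TLres_TLmap {g : MvPolynomial (Fin n) A} (h : f ∣ g) (φ : N →ₗ[A'] N') (z : TL A' N f) :
    TLres A' h (TLmap A' f φ z) = TLmap A' g φ (TLres A' h z) := by
  induction z using TL_induction with
  | h0 => simp
  | ht x u => rfl
  | hadd x y hx hy => rw [map_add, map_add, hx, hy, map_add, map_add]

end TL

section FL

variable {A : Type*} [CommRing A] {n : ℕ} {A' : Type*} [CommRing A'] [Algebra A A']

theorem finLen_of_bound {S M : Type*} [Ring S] [AddCommGroup M] [Module S M] (B : ℕ)
    (h : ∀ (s : ℕ → Submodule S M) (l : ℕ), (∀ i < l, s i < s (i + 1)) → l ≤ B) :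
    IsFiniteLength S M := by
  rw [← Module.length_ne_top_iff, Module.length_ne_top_iff_finiteDimensionalOrder]
  by_contra hcon
  have hinf : InfiniteDimensionalOrder (Submodule S M) := SetRel.not_finiteDimensional_iff.1 hcon
  let p := LTSeries.withLength (Submodule S M) (B + 1)
  have hl : p.length = B + 1 := LTSeries.length_withLength _ _
  have := h (fun i => if hi : i < p.length + 1 then p ⟨i, hi⟩ else ⊤) (B + 1) (by
    intro i hi
    rw [dif_pos (by omega), dif_pos (by omega)]
    exact p.step ⟨i, by omega⟩)
  omega

/-- identification with the tensor product -/
noncomputable def toTL (A' : Type*) [CommRing A'] [Algebra A A']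
    (N : Type*) [AddCommGroup N] [Module A N] [Module A' N]
    [IsScalarTower A A' N] (f : MvPolynomial (Fin n) A) : (N ⊗[A] Loc f) ≃ₗ[A'] TL A' N f :=
  LinearEquiv.refl A' (N ⊗[A] Loc f)

theorem toTL_tmul (N : Type*) [AddCommGroup N] [Module A N] [Module A' N]
    [IsScalarTower A A' N] (f : MvPolynomial (Fin n) A) (x : N) (u : Loc f) :
    toTL A' N f (x ⊗ₜ[A] u) = tm A' f x u := rfl

theorem finLen_field (κ : Type*) [Field κ] [Algebra A κ] [Algebra A' κ] [IsScalarTower A A' κ]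
    (hsurj : Function.Surjective (algebraMap A' κ)) (f : MvPolynomial (Fin n) A) :
    IsFiniteLength (SR A n A') (TL A' κ f) := by
  obtain ⟨B, hι, hD⟩ := exists_BData κ f
  let toK : Submodule (SR A n A') (TL A' κ f) → Submodule κ (κ ⊗[A] Loc f) := fun P =>
    { carrier := {z | toTL A' κ f z ∈ P}
      zero_mem' := by simp only [Set.mem_setOf_eq, map_zero]; exact P.zero_mem
      add_mem' := fun {x y} ha hb => by
        simp only [Set.mem_setOf_eq, map_add] at *; exact P.add_mem ha hb
      smul_mem' := by
        intro c z hz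
        obtain ⟨a, rfl⟩ := hsurj c
        simp only [Set.mem_setOf_eq] at *
        have h1 := P.smul_mem (algebraMap A' (SR A n A') a) hz
        rw [alg_smul, ← map_smul] at h1
        rw [algebraMap_smul]; exact h1 }
  have hmem : ∀ P z, z ∈ toK P ↔ toTL A' κ f z ∈ P := fun P z => Iff.rfl
  refine finLen_of_bound (B.Cst * (2 * n + 1) ^ n * (B.Cst * (4 * n + 1) ^ n)) fun s l hs =>
    B.chain_bound (fun i => toK (s i)) l ?_ ?_
  · intro i _
    constructor
    · intro j v hv
      rw [hι, hmem]
      have h1 := (s i).smul_mem (jS A n A' (X j)) ((hmem _ _).1 hv)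
      convert h1 using 1
      clear h1 hv
      induction v using TensorProduct.induction_on with
      | zero => rw [map_zero, map_zero, smul_zero]
      | tmul a u => rw [iotaK_X, toTL_tmul, toTL_tmul, jS_smul_tm]
      | add x y hx hy => rw [map_add, map_add, hx, hy, map_add, smul_add]
    · intro b v hv
      rw [hD, hmem]
      have h1 := (s i).smul_mem (DS A n A' b) ((hmem _ _).1 hv)
      convert h1 using 1
      clear h1 hv
      induction v using TensorProduct.induction_on with
      | zero => rw [map_zero, map_zero, smul_zero]
      | tmul a u => rw [LinearMap.baseChange_tmul, toTL_tmul, toTL_tmul, D_smul_tm]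
      | add x y hx hy => rw [map_add, map_add, hx, hy, map_add, smul_add]
  · intro i hi
    refine lt_of_le_of_ne (fun z hz => (hs i hi).le hz) fun h => (hs i hi).ne ?_
    ext z
    have := SetLike.ext_iff.1 h ((toTL A' κ f).symm z)
    rw [hmem, hmem, LinearEquiv.apply_symm_apply] at this
    exact this

theorem TL_finLen (f : MvPolynomial (Fin n) A) (N : Type*) [AddCommGroup N] [Module A' N]
    (h : IsFiniteLength A' N) : ∀ (_ : Module A N) (_ : IsScalarTower A A' N),
    IsFiniteLength (SR A n A') (TL A' N f) := by
  induction h with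
  | @of_subsingleton N _ _ _ =>
    intro _ _
    have : Subsingleton (TL A' N f) := inferInstanceAs (Subsingleton (N ⊗[A] Loc f))
    exact IsFiniteLength.of_subsingleton
  | @of_simple_quotient M _ _ N hs hN ih =>
    intro _ _
    have h1 := ih inferInstance inferInstance
    have h2 : IsFiniteLength (SR A n A') (TL A' (M ⧸ N) f) := by
      obtain ⟨m, hm, ⟨e⟩⟩ := isSimpleModule_iff_quot_maximal.1 hs
      letI : Field (A' ⧸ m) := Ideal.Quotient.field m
      have h3 := finLen_field (A := A) (n := n) (A' := A') (A' ⧸ m) Ideal.Quotient.mk_surjective f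
      refine IsFiniteLength.of_surjective h3 (f := TLmap A' f e.symm.toLinearMap)
        (TLmap_surj _ _ _ e.symm.surjective)
    rw [isFiniteLength_iff_isNoetherian_isArtinian] at h1 h2 ⊢
    obtain ⟨_, _⟩ := h1
    obtain ⟨_, _⟩ := h2
    have hex := TLmap_exact A' f N.subtype N.mkQ (LinearMap.exact_subtype_mkQ N) N.mkQ_surjective
    exact ⟨isNoetherian_of_range_eq_ker _ _ (LinearMap.exact_iff.1 hex).symm,
      isArtinian_of_range_eq_ker _ _ (LinearMap.exact_iff.1 hex).symm⟩

end FL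

end LCFin


namespace LCFin

open MvPolynomial Finset TensorProduct

section Flip

variable {A : Type*} [CommRing A] {n : ℕ} (A' : Type*) [CommRing A'] [Algebra A A']
  (N : Type*) [AddCommGroup N] [Module A N] [Module A' N] [IsScalarTower A A' N]
  (f : MvPolynomial (Fin n) A)

/-- additive version of `flipE` -/
noncomputable def flipAdd : TL A' N f ≃+ (Loc f ⊗[A] N) :=
  (TensorProduct.comm A N (Loc f)).toAddEquiv

theorem flipAdd_tm (x : N) (u : Loc f) : flipAdd A' N f (tm A' f x u) = u ⊗ₜ[A] x := rfl

/-- swap the factors -/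
noncomputable def flipE : TL A' N f ≃ₗ[MvPolynomial (Fin n) A] (Loc f ⊗[A] N) :=
  { flipAdd A' N f with
    map_smul' := fun r z => by
      change flipAdd A' N f (r • z) = r • flipAdd A' N f z
      induction z using TL_induction with
      | h0 => rw [smul_zero, map_zero, smul_zero]
      | ht x u =>
        rw [r_smul_tm, flipAdd_tm, flipAdd_tm, TensorProduct.smul_tmul', Algebra.smul_def]
      | hadd x y hx hy => rw [smul_add, map_add, hx, hy, map_add, smul_add] }

theorem flipE_tm (x : N) (u : Loc f) : flipE A' N f (tm A' f x u) = u ⊗ₜ[A] x := rfl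

theorem isUnit_Loc {g : MvPolynomial (Fin n) A} (h : g ∣ f) :
    IsUnit (algebraMap (MvPolynomial (Fin n) A) (Loc f) g) :=
  isUnit_of_dvd_unit (map_dvd (algebraMap (MvPolynomial (Fin n) A) (Loc f)) h)
      (IsLocalization.map_units (Loc f) (⟨f, Submonoid.mem_powers f⟩ : Submonoid.powers f))

/-- elements dividing `f` act bijectively -/
theorem TL_bij {g : MvPolynomial (Fin n) A} (h : g ∣ f) :
    Function.Bijective (fun z : TL A' N f => g • z) := by
  obtain ⟨v, hv⟩ := isUnit_Loc f h
  have hinv : ∀ z : TL A' N f, opT A' N f (LinearMap.mulLeft A (↑v⁻¹ : Loc f)) (g • z) = z := by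
    intro z
    induction z using TL_induction with
    | h0 => rw [smul_zero, map_zero]
    | ht x u =>
      rw [r_smul_tm, opT_tm, LinearMap.mulLeft_apply, ← hv, Units.inv_mul_cancel_left]
    | hadd x y hx hy => rw [smul_add, map_add, hx, hy]
  have hinv' : ∀ z : TL A' N f, g • opT A' N f (LinearMap.mulLeft A (↑v⁻¹ : Loc f)) z = z := by
    intro z
    induction z using TL_induction with
    | h0 => rw [map_zero, smul_zero]
    | ht x u =>
      rw [opT_tm, r_smul_tm, LinearMap.mulLeft_apply, ← hv, Units.mul_inv_cancel_left]
    | hadd x y hx hy => rw [map_add, smul_add, hx, hy]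
  exact Function.bijective_iff_has_inverse.2 ⟨_, hinv, hinv'⟩

variable {f} in
theorem isLocMod_res {a g : MvPolynomial (Fin n) A} (hg : f ∣ g) (ha : g = a * f) :
    IsLocalizedModule (Submonoid.powers a) (res f g hg).toLinearMap where
  map_units := by
    rintro ⟨_, k, rfl⟩
    simp only [map_pow]
    apply IsUnit.pow
    rw [Module.End.isUnit_iff]
    obtain ⟨v, hv⟩ := isUnit_Loc g (⟨f, ha⟩ : a ∣ g)
    refine Function.bijective_iff_has_inverse.2 ⟨fun z => (↑v⁻¹ : Loc g) * z, ?_, ?_⟩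
    · intro z; simp [Module.algebraMap_end_apply, Algebra.smul_def, ← hv]
    · intro z; simp [Module.algebraMap_end_apply, Algebra.smul_def, ← hv]
  surj := by
    intro y
    obtain ⟨⟨p, ⟨_, k, rfl⟩⟩, hk⟩ := IsLocalization.surj (Submonoid.powers g) y
    simp only at hk
    obtain ⟨v, hv⟩ := isUnit_Loc f (dvd_refl f)
    refine ⟨⟨(↑v⁻¹ : Loc f) ^ k * algebraMap _ _ p, ⟨_, k, rfl⟩⟩, ?_⟩
    simp only [AlgHom.toLinearMap_apply, map_mul, map_pow, AlgHom.commutes, Submonoid.smul_def]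
    have hgk : algebraMap _ (Loc g) (g ^ k) = algebraMap _ (Loc g) ((a * f) ^ k) :=
      congrArg _ (by rw [← ha])
    rw [← hk, Algebra.smul_def, hgk, map_pow, map_pow, map_mul, mul_pow]
    have h1 : res f g hg (↑v⁻¹ : Loc f) * algebraMap _ (Loc g) f = 1 := by
      rw [← AlgHom.commutes (res f g hg), ← map_mul, ← hv, Units.inv_mul, map_one]
    calc _ = (res f g hg (↑v⁻¹ : Loc f) * algebraMap _ (Loc g) f) ^ k *
          (algebraMap _ (Loc g) a ^ k * y) := by rw [h1]; simp
      _ = _ := by ring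
  exists_of_eq := by
    intro x y hxy
    simp only [AlgHom.toLinearMap_apply] at hxy
    obtain ⟨⟨p, ⟨_, k, rfl⟩⟩, hk⟩ := IsLocalization.surj (Submonoid.powers f) x
    obtain ⟨⟨q, ⟨_, l, rfl⟩⟩, hl⟩ := IsLocalization.surj (Submonoid.powers f) y
    simp only at hk hl
    have h1 : algebraMap _ (Loc g) (f ^ l * p) = algebraMap _ (Loc g) (f ^ k * q) := by
      rw [← AlgHom.commutes (res f g hg), ← AlgHom.commutes (res f g hg),
        map_mul (algebraMap _ (Loc f)) (f ^ l), ← hk, map_mul (algebraMap _ (Loc f)) (f ^ k), ← hl]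
      simp only [map_mul, hxy]
      ring
    obtain ⟨⟨_, m, rfl⟩, hm⟩ := (IsLocalization.eq_iff_exists (Submonoid.powers g) _).1 h1
    simp only at hm
    refine ⟨⟨_, m, rfl⟩, ?_⟩
    simp only [Submonoid.smul_def, Algebra.smul_def]
    have hu := isUnit_Loc f (dvd_refl f)
    apply (hu.pow (m + k + l)).mul_left_cancel
    have h2 := congrArg (algebraMap _ (Loc f)) hm
    rw [ha] at h2
    simp only [map_mul, map_pow, mul_pow] at h2 hk hl ⊢
    rw [← hk, ← hl] at h2
    linear_combination h2

variable {f N} in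
theorem TLres_flip {g : MvPolynomial (Fin n) A} (h : f ∣ g) (z : TL A' N f) :
    flipE A' N g (TLres A' h z) =
      AlgebraTensorModule.rTensor A N (res f g h).toLinearMap (flipE A' N f z) := by
  induction z using TL_induction with
  | h0 => simp only [map_zero]
  | ht x u => rw [TLres_tm, flipE_tm, flipE_tm]; rfl
  | hadd x y hx hy => simp only [map_add, hx, hy]

variable {f N} in
theorem TLres_ker {a g : MvPolynomial (Fin n) A} (hg : f ∣ g) (ha : g = a * f) (z : TL A' N f)
    (hz : TLres A' hg z = 0) : ∃ k : ℕ, a ^ k • z = 0 := by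
  have := isLocMod_res hg ha
  have h1 : AlgebraTensorModule.rTensor A N (res f g hg).toLinearMap (flipE A' N f z) =
      AlgebraTensorModule.rTensor A N (res f g hg).toLinearMap 0 := by
    rw [← TLres_flip, hz, map_zero, map_zero]
  obtain ⟨⟨_, k, rfl⟩, hk⟩ :=
    IsLocalizedModule.exists_of_eq (S := Submonoid.powers a) h1
  refine ⟨k, (flipE A' N f).injective ?_⟩
  rw [map_smul, map_zero]
  rw [smul_zero] at hk
  exact hk

variable {f N} in
theorem TLres_lift {a g : MvPolynomial (Fin n) A} (hg : f ∣ g) (ha : g = a * f) (z : TL A' N g) :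
    ∃ (k : ℕ) (y : TL A' N f), TLres A' hg y = a ^ k • z := by
  have := isLocMod_res hg ha
  obtain ⟨⟨y, ⟨_, k, rfl⟩⟩, hk⟩ :=
    IsLocalizedModule.surj (S := Submonoid.powers a)
      (AlgebraTensorModule.rTensor A N (res f g hg).toLinearMap) (flipE A' N g z)
  refine ⟨k, (flipE A' N f).symm y, (flipE A' N g).injective ?_⟩
  rw [map_smul, TLres_flip, LinearEquiv.apply_symm_apply]
  exact hk.symm

end Flip

section BC

variable {A : Type*} [CommRing A] {n : ℕ} (t : A) (A' : Type*) [CommRing A'] [Algebra A A']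
  (f : MvPolynomial (Fin n) A)

/-- change of the coefficient ring -/
noncomputable def TLbcAdd : TL A A f →+ TL A' A' f :=
  (AlgebraTensorModule.rTensor A (Loc f) (Algebra.linearMap A A')).toAddMonoidHom

theorem TLbcAdd_tm (x : A) (u : Loc f) :
  TLbcAdd A' f (tm A f x u) = tm A' f (algebraMap A A' x) u := rfl

/-- change of the coefficient ring -/
noncomputable def TLbc : TL A A f →ₗ[MvPolynomial (Fin n) A] TL A' A' f :=
  { TLbcAdd A' f with
    map_smul' := fun r z => by
      change TLbcAdd A' f (r • z) = r • TLbcAdd A' f z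
      induction z using TL_induction with
      | h0 => rw [smul_zero, map_zero, smul_zero]
      | ht x u => rw [r_smul_tm, TLbcAdd_tm, TLbcAdd_tm, r_smul_tm]
      | hadd x y hx hy => rw [smul_add, map_add, hx, hy, map_add, smul_add] }

theorem TLbc_tm (x : A) (u : Loc f) :
  TLbc A' f (tm A f x u) = tm A' f (algebraMap A A' x) u := rfl

variable {f} in
theorem TLbc_TLres {g : MvPolynomial (Fin n) A} (h : f ∣ g) (z : TL A A f) :
    TLbc A' g (TLres A h z) = TLres A' h (TLbc A' f z) := by
  induction z using TL_induction with
  | h0 => simp only [map_zero]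
  | ht x u => rfl
  | hadd x y hx hy => simp only [map_add, hx, hy]

/-- constants -/
theorem C_smul (N : Type*) [AddCommGroup N] [Module A N] [Module A' N] [IsScalarTower A A' N]
    (a : A) (z : TL A' N f) : (C a : MvPolynomial (Fin n) A) • z = algebraMap A A' a • z := by
  induction z using TL_induction with
  | h0 => simp only [smul_zero]
  | ht x u =>
    rw [r_smul_tm, smul_tm, algebraMap_smul, ← MvPolynomial.algebraMap_eq,
      ← IsScalarTower.algebraMap_apply, ← Algebra.smul_def]
    exact (TensorProduct.smul_tmul _ _ _).symm
  | hadd x y hx hy => simp only [smul_add, hx, hy]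

theorem C_smul' (N : Type*) [AddCommGroup N] [Module A N]
    (a : A) (z : TL A N f) : (C a : MvPolynomial (Fin n) A) • z =
      TLmap A f (a • LinearMap.id) z := by
  induction z using TL_induction with
  | h0 => simp only [smul_zero, map_zero]
  | ht x u =>
    rw [r_smul_tm, TLmap_tm, ← MvPolynomial.algebraMap_eq,
      ← IsScalarTower.algebraMap_apply, ← Algebra.smul_def]
    exact (TensorProduct.smul_tmul _ _ _).symm
  | hadd x y hx hy => simp only [smul_add, map_add, hx, hy]

variable [IsLocalization.Away t A']

theorem TLbc_ker (z : TL A A f) (hz : TLbc A' f z = 0) :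
    ∃ k : ℕ, (C t : MvPolynomial (Fin n) A) ^ k • z = 0 := by
  obtain ⟨⟨_, k, rfl⟩, hk⟩ := IsLocalizedModule.exists_of_eq (S := Submonoid.powers t)
    (f := AlgebraTensorModule.rTensor A (Loc f) (Algebra.linearMap A A'))
    (x₁ := z) (x₂ := 0) (by rw [map_zero]; exact hz)
  refine ⟨k, ?_⟩
  rw [smul_zero] at hk
  rw [← C_pow, C_smul]
  exact hk

theorem TLbc_lift (z : TL A' A' f) :
    ∃ (k : ℕ) (y : TL A A f), TLbc A' f y = (C t : MvPolynomial (Fin n) A) ^ k • z := by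
  obtain ⟨⟨y, ⟨_, k, rfl⟩⟩, hk⟩ := IsLocalizedModule.surj (S := Submonoid.powers t)
    (f := AlgebraTensorModule.rTensor A (Loc f) (Algebra.linearMap A A')) z
  refine ⟨k, y, ?_⟩
  rw [← C_pow, C_smul]
  exact hk.symm.trans (algebraMap_smul (M := A' ⊗[A] Loc f) A' (t ^ k) z).symm

end BC

end LCFin


namespace LCFin

open MvPolynomial Finset TensorProduct

section Cech

variable {A : Type*} [CommRing A] {n : ℕ} {r : ℕ} (F : Fin r → MvPolynomial (Fin n) A)

/-- product of a sequence of generators -/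
noncomputable def pr {p : ℕ} (s : Fin p → Fin r) : MvPolynomial (Fin n) A := ∏ k, F (s k)

theorem pr_succAbove {p : ℕ} (s : Fin (p + 1) → Fin r) (k : Fin (p + 1)) :
    pr F s = F (s k) * pr F (s ∘ k.succAbove) :=
  Fin.prod_univ_succAbove _ k

theorem pr_dvd {p : ℕ} (s : Fin (p + 1) → Fin r) (k : Fin (p + 1)) :
    pr F (s ∘ k.succAbove) ∣ pr F s := ⟨F (s k), by rw [pr_succAbove F s k, mul_comm]⟩

theorem pr_cons {p : ℕ} (j : Fin r) (s : Fin p → Fin r) :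
    pr F (Fin.cons j s : Fin (p + 1) → Fin r) = F j * pr F s := by
  simp [pr, Fin.prod_univ_succ]

variable (A' : Type*) [CommRing A'] [Algebra A A']
  (N : Type*) [AddCommGroup N] [Module A N] [Module A' N] [IsScalarTower A A' N]

/-- terms of the Cech complex -/
abbrev CK (p : ℕ) : Type _ := ∀ s : Fin p → Fin r, TL A' N (pr F s)

/-- the differential of the Cech complex -/
noncomputable def dK (p : ℕ) : CK F A' N p →ₗ[SR A n A'] CK F A' N (p + 1) :=
  LinearMap.pi fun s => ∑ k : Fin (p + 1),
    ((-1 : ℤ) ^ (k : ℕ)) • (TLres A' (pr_dvd F s k) ∘ₗ LinearMap.proj (s ∘ k.succAbove))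

theorem dK_apply (p : ℕ) (z : CK F A' N p) (s : Fin (p + 1) → Fin r) :
    dK F A' N p z s = ∑ k : Fin (p + 1),
      ((-1 : ℤ) ^ (k : ℕ)) • TLres A' (pr_dvd F s k) (z (s ∘ k.succAbove)) := by
  simp [dK]

variable {N}

theorem TLres_congr {p : ℕ} (z : CK F A' N p) {s s' : Fin p → Fin r} (h : s = s')
    {g : MvPolynomial (Fin n) A} (h1 : pr F s ∣ g) (h2 : pr F s' ∣ g) :
    TLres A' h1 (z s) = TLres A' h2 (z s') := by
  subst h; rfl

theorem TLres_zsmul {f g : MvPolynomial (Fin n) A} (h : f ∣ g) (m : ℤ) (z : TL A' N f) :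
    TLres A' h (m • z) = m • TLres A' h z := map_zsmul _ _ _

theorem dK_dK (p : ℕ) (z : CK F A' N p) : dK F A' N (p + 1) (dK F A' N p z) = 0 := by
  funext s
  rw [dK_apply]
  simp only [dK_apply, map_sum, TLres_zsmul, TLres_TLres, Finset.smul_sum, Pi.zero_apply]
  rw [Finset.sum_sigma']
  refine Finset.sum_involution (fun x _ => ⟨x.1.succAbove x.2, x.2.predAbove x.1⟩) ?_ ?_ ?_ ?_
  · rintro ⟨i, j⟩ _
    simp only [smul_smul, ← pow_add]
    rw [Fin.neg_one_pow_succAbove_add_predAbove]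
    have h : (s ∘ (i.succAbove j).succAbove) ∘ (j.predAbove i).succAbove =
        (s ∘ i.succAbove) ∘ j.succAbove := by
      funext k
      simp only [Function.comp_apply]
      rw [Fin.succAbove_succAbove_succAbove_predAbove]
    rw [TLres_congr F A' z h _ ((pr_dvd F (s ∘ i.succAbove) j).trans (pr_dvd F s i)), neg_smul]
    exact add_neg_cancel _
  · rintro ⟨i, j⟩ _ _ h
    exact Fin.succAbove_ne i j (congrArg Sigma.fst h)
  · intros; simp
  · rintro ⟨i, j⟩ _
    simp only
    rw [Fin.succAbove_succAbove_predAbove, Fin.predAbove_predAbove_succAbove]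

variable {N' : Type*} [AddCommGroup N'] [Module A N'] [Module A' N'] [IsScalarTower A A' N']
  {N'' : Type*} [AddCommGroup N''] [Module A N''] [Module A' N''] [IsScalarTower A A' N'']

/-- functoriality -/
noncomputable def CKmap (φ : N →ₗ[A'] N') (p : ℕ) :
    CK F A' N p →ₗ[SR A n A'] CK F A' N' p :=
  LinearMap.pi fun s => TLmap A' (pr F s) φ ∘ₗ LinearMap.proj s

theorem CKmap_apply (φ : N →ₗ[A'] N') (p : ℕ) (z : CK F A' N p) (s) :
    CKmap F A' φ p z s = TLmap A' (pr F s) φ (z s) := rfl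

theorem dK_CKmap (φ : N →ₗ[A'] N') (p : ℕ) (z : CK F A' N p) :
    dK F A' N' p (CKmap F A' φ p z) = CKmap F A' φ (p + 1) (dK F A' N p z) := by
  funext s
  simp only [CKmap_apply, dK_apply, map_sum, map_zsmul, TLres_TLmap]

theorem CKmap_surj (φ : N →ₗ[A'] N') (h : Function.Surjective φ) (p : ℕ) :
    Function.Surjective (CKmap F A' φ p) := fun z => by
  choose y hy using fun s => TLmap_surj A' (pr F s) φ h (z s)
  exact ⟨y, funext hy⟩

theorem CKmap_exact (φ : N →ₗ[A'] N') (ψ : N' →ₗ[A'] N'') (h : Function.Exact φ ψ) (p : ℕ)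
    (z : CK F A' N' p) (hz : CKmap F A' ψ p z = 0) : ∃ y, CKmap F A' φ p y = z := by
  choose y hy using fun s => (TLmap_exact' A' (pr F s) φ ψ h (z s)).1 (congrFun hz s)
  exact ⟨y, funext hy⟩

theorem CK_finLen (p : ℕ) (h : IsFiniteLength A' N) :
    IsFiniteLength (SR A n A') (CK F A' N p) := by
  have h1 : ∀ s : Fin p → Fin r, IsFiniteLength (SR A n A') (TL A' N (pr F s)) := fun s =>
    TL_finLen (pr F s) N h inferInstance inferInstance
  simp only [isFiniteLength_iff_isNoetherian_isArtinian] at h1 ⊢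
  have := fun s => (h1 s).1
  have := fun s => (h1 s).2
  exact ⟨inferInstance, inferInstance⟩

theorem exists_common {ι : Type*} [Fintype ι] (P : ι → ℕ → Prop)
    (hmono : ∀ i k l, k ≤ l → P i k → P i l) (h : ∀ i, ∃ k, P i k) : ∃ k, ∀ i, P i k := by
  choose k hk using h
  exact ⟨Finset.univ.sup k, fun i => hmono i _ _ (Finset.le_sup (Finset.mem_univ i)) (hk i)⟩

theorem TLres_R {f g : MvPolynomial (Fin n) A} (h : f ∣ g) (a : MvPolynomial (Fin n) A)
    (z : TL A' N f) : TLres A' h (a • z) = a • TLres A' h z :=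
  ((TLres A' h).restrictScalars (MvPolynomial (Fin n) A)).map_smul a z

theorem dK_R (p : ℕ) (a : MvPolynomial (Fin n) A)
    (z : CK F A' N p) : dK F A' N p (a • z) = a • dK F A' N p z :=
  ((dK F A' N p).restrictScalars (MvPolynomial (Fin n) A)).map_smul a z

/-- the cohomology is torsion -/
theorem dK_torsion (q : ℕ) (z : CK F A' N (q + 1)) (hz : dK F A' N (q + 1) z = 0) (j : Fin r) :
    ∃ (k : ℕ) (y : CK F A' N q), F j ^ k • z = dK F A' N q y := by
  have hd : ∀ {p : ℕ} (s : Fin p → Fin r), pr F s ∣ pr F (Fin.cons j s : Fin (p + 1) → Fin r) :=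
    fun s => ⟨F j, by rw [pr_cons, mul_comm]⟩
  obtain ⟨k, hk⟩ := exists_common
    (fun (s : Fin q → Fin r) k => ∃ y : TL A' N (pr F s), TLres A' (hd s) y =
      F j ^ k • z (Fin.cons j s)) (by
      rintro s k l hkl ⟨y, hy⟩
      refine ⟨F j ^ (l - k) • y, ?_⟩
      rw [TLres_R, hy, smul_smul, ← pow_add, Nat.sub_add_cancel hkl])
    (fun s => TLres_lift A' (hd s) (pr_cons F j s) (z (Fin.cons j s)))
  choose y hy using hk
  have key : ∀ s : Fin (q + 1) → Fin r,
      TLres A' (hd s) (dK F A' N q y s) = F j ^ k • TLres A' (hd s) (z s) := by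
    intro s
    have h1 := congrFun hz (Fin.cons j s : Fin (q + 2) → Fin r)
    rw [dK_apply, Fin.sum_univ_succ] at h1
    simp only [Fin.val_zero, pow_zero, one_smul, Pi.zero_apply, Fin.val_succ] at h1
    have e0 : (Fin.cons j s : Fin (q + 2) → Fin r) ∘ (0 : Fin (q + 2)).succAbove = s := by
      funext k; simp
    rw [TLres_congr F A' z e0 _ (hd s)] at h1
    rw [eq_neg_of_add_eq_zero_left h1, dK_apply]
    simp only [map_sum, TLres_zsmul, TLres_TLres]
    rw [smul_neg, Finset.smul_sum, ← Finset.sum_neg_distrib]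
    refine Finset.sum_congr rfl fun l _ => ?_
    have hd2 : pr F (Fin.cons j (s ∘ l.succAbove) : Fin (q + 1) → Fin r) ∣
        pr F (Fin.cons j s : Fin (q + 2) → Fin r) := by
      rw [pr_cons, pr_cons]; exact mul_dvd_mul_left _ (pr_dvd F s l)
    have e1 : (Fin.cons j s : Fin (q + 2) → Fin r) ∘ (l.succ).succAbove =
        Fin.cons j (s ∘ l.succAbove) := by
      funext k
      refine Fin.cases ?_ (fun k => ?_) k <;> simp
    rw [TLres_congr F A' z e1 _ hd2,
      ← TLres_TLres A' (hd (s ∘ l.succAbove)) hd2, hy, TLres_R, pow_succ]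
    rw [smul_comm (F j ^ k), ← smul_neg]
    simp
  obtain ⟨m, hm⟩ := exists_common
    (fun (s : Fin (q + 1) → Fin r) m => F j ^ m • (F j ^ k • z s - dK F A' N q y s) = 0) (by
      rintro s k l hkl h
      rw [← Nat.sub_add_cancel hkl, pow_add, mul_smul, h, smul_zero])
    (fun s => TLres_ker A' (hd s) (pr_cons F j s) _ (by rw [map_sub, TLres_R, key, sub_self]))
  refine ⟨m + k, F j ^ m • y, ?_⟩
  rw [dK_R, pow_add, mul_smul]
  funext s
  have := hm s
  rw [smul_sub, sub_eq_zero] at this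
  exact this

theorem dK_torsion0 (z : CK F A' N 0) (hz : dK F A' N 0 z = 0) (j : Fin r) :
    ∃ (k : ℕ), F j ^ k • z = 0 := by
  obtain ⟨k, hk⟩ := TLres_ker A' (f := pr F (Fin.elim0 : Fin 0 → Fin r))
    (g := pr F (fun _ : Fin 1 => j)) (a := F j) (by simp [pr]) (by simp [pr]) (z Fin.elim0) (by
      have h1 := congrFun hz (fun _ => j)
      rw [dK_apply] at h1
      simp only [Fin.sum_univ_succ, Fin.val_zero, pow_zero, one_smul, Finset.univ_eq_empty,
        Finset.sum_empty, add_zero] at h1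
      exact (TLres_congr F A' z (Subsingleton.elim _ _) _ _).trans h1)
  refine ⟨k, ?_⟩
  funext s
  rw [Subsingleton.elim s Fin.elim0]
  exact hk

theorem CK_bij (q : ℕ) (j : Fin (q + 1)) (s : Fin (q + 1) → Fin r) :
    Function.Bijective (fun z : TL A' N (pr F s) => F (s j) • z) :=
  TL_bij A' N (pr F s) ⟨_, pr_succAbove F s j⟩

end Cech

end LCFin


namespace LCFin

open MvPolynomial Finset TensorProduct

section FLgen

variable {S : Type*} [Ring S] {M V Q Z : Type*} [AddCommGroup M] [Module S M]
  [AddCommGroup V] [Module S V] [AddCommGroup Q] [Module S Q] [AddCommGroup Z] [Module S Z]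

theorem finLen_sub (h : IsFiniteLength S M) (P : Submodule S M) : IsFiniteLength S P :=
  h.of_injective P.injective_subtype

theorem finLen_quot (h : IsFiniteLength S M) (P : Submodule S M) : IsFiniteLength S (M ⧸ P) :=
  h.of_surjective P.mkQ_surjective

theorem finLen_range (h : IsFiniteLength S M) (φ : M →ₗ[S] V) :
    IsFiniteLength S (LinearMap.range φ) :=
  h.of_surjective φ.surjective_rangeRestrict

theorem finLen_of_ker_range (φ : M →ₗ[S] V) (h1 : IsFiniteLength S (LinearMap.ker φ))
    (h2 : IsFiniteLength S (LinearMap.range φ)) : IsFiniteLength S M := by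
  rw [isFiniteLength_iff_isNoetherian_isArtinian] at h1 h2 ⊢
  obtain ⟨_, _⟩ := h1
  obtain ⟨_, _⟩ := h2
  have hex : LinearMap.range (LinearMap.ker φ).subtype = LinearMap.ker φ.rangeRestrict := by
    rw [Submodule.range_subtype, LinearMap.ker_rangeRestrict]
  exact ⟨isNoetherian_of_range_eq_ker _ _ hex, isArtinian_of_range_eq_ker _ _ hex⟩

theorem finLen_aux (π : V →ₗ[S] M) (ρ : V →ₗ[S] Q) (φ : Z →ₗ[S] M) (hQ : IsFiniteLength S Q)
    (hZ : IsFiniteLength S Z) (h : ∀ v, ρ v = 0 → π v ∈ LinearMap.range φ) :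
    IsFiniteLength S (LinearMap.range π) := by
  let X := LinearMap.range φ
  have hX : IsFiniteLength S X := finLen_range hZ φ
  let g : LinearMap.range π →ₗ[S] M ⧸ X := X.mkQ ∘ₗ (LinearMap.range π).subtype
  refine finLen_of_ker_range g ?_ ?_
  · refine hX.of_injective (f := LinearMap.codRestrict X
      ((LinearMap.range π).subtype ∘ₗ (LinearMap.ker g).subtype) ?_) ?_
    · rintro ⟨x, hx⟩
      exact (Submodule.Quotient.mk_eq_zero X).1 hx
    · intro x y hxy
      have := congrArg Subtype.val hxy
      exact Subtype.ext (Subtype.ext this)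
  · have h3 : IsFiniteLength S (V ⧸ LinearMap.ker ρ) :=
      (finLen_sub hQ (LinearMap.range ρ)).of_surjective
          (f := (ρ.quotKerEquivRange.symm : LinearMap.range ρ →ₗ[S] V ⧸ LinearMap.ker ρ))
          ρ.quotKerEquivRange.symm.surjective
    have hle : LinearMap.ker ρ ≤ LinearMap.ker (X.mkQ ∘ₗ π) := fun v hv =>
      (Submodule.Quotient.mk_eq_zero X).2 (h v hv)
    refine (finLen_range h3 ((LinearMap.ker ρ).liftQ (X.mkQ ∘ₗ π) hle)).of_injective
      (f := Submodule.inclusion ?_) (Submodule.inclusion_injective _)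
    rintro _ ⟨⟨_, v, rfl⟩, rfl⟩
    exact ⟨Submodule.Quotient.mk v, rfl⟩

theorem finLen_core {K0 K1 K2 Kb Kk : Type*} [AddCommGroup K0] [Module S K0]
    [AddCommGroup K1] [Module S K1] [AddCommGroup K2] [Module S K2]
    [AddCommGroup Kb] [Module S Kb] [AddCommGroup Kk] [Module S Kk]
    (d0 : K0 →ₗ[S] K1) (d1 : K1 →ₗ[S] K2) (hdd : ∀ y, d1 (d0 y) = 0)
    (τ0 : K0 →ₗ[S] K0) (τ1 : K1 →ₗ[S] K1) (hτ : ∀ y, d0 (τ0 y) = τ1 (d0 y))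
    (σ : K0 →ₗ[S] Kb) (Bb : Submodule S Kb) (hσ : ∀ y, σ y ∈ Bb → ∃ b y1, d0 b = 0 ∧ y = τ0 y1 + b)
    (κ : Kk →ₗ[S] K1) (hκ : ∀ z, τ1 z = 0 → ∃ w, κ w = z)
    (hb : IsFiniteLength S Kb) (hk : IsFiniteLength S Kk) :
    ∃ W : Submodule S (LinearMap.ker d1 ⧸ (LinearMap.range d0).comap (LinearMap.ker d1).subtype),
      IsFiniteLength S W ∧ ∀ z : LinearMap.ker d1, (∃ y, d0 y = τ1 z.1) →
        Submodule.mkQ _ z ∈ W := by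
  let Z := LinearMap.ker d1
  let ev : (Z × K0) →ₗ[S] K1 :=
    τ1 ∘ₗ Z.subtype ∘ₗ LinearMap.fst _ _ _ - d0 ∘ₗ LinearMap.snd _ _ _
  let V := LinearMap.ker ev
  have hV : ∀ z y, (z, y) ∈ V ↔ τ1 z.1 = d0 y := fun z y => by
    rw [LinearMap.mem_ker, LinearMap.sub_apply, sub_eq_zero]; rfl
  let cl := Submodule.mkQ ((LinearMap.range d0).comap (LinearMap.ker d1).subtype)
  have hcl : ∀ z, cl z = 0 ↔ ∃ y, d0 y = z.1 := fun z => Submodule.Quotient.mk_eq_zero _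
  let π := cl ∘ₗ LinearMap.fst _ _ _ ∘ₗ V.subtype
  let ρ : V →ₗ[S] Kb ⧸ Bb := Submodule.mkQ _ ∘ₗ σ ∘ₗ LinearMap.snd _ _ _ ∘ₗ V.subtype
  let Z0 := LinearMap.ker (d1 ∘ₗ κ)
  let φ := cl ∘ₗ LinearMap.codRestrict Z (κ ∘ₗ Z0.subtype) (fun z => z.2)
  refine ⟨LinearMap.range π, finLen_aux π ρ φ (finLen_quot hb _) (finLen_sub hk _) ?_, ?_⟩
  · rintro ⟨⟨z, y⟩, hzy⟩ hρ
    rw [hV] at hzy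
    have hy : σ y ∈ Bb := (Submodule.Quotient.mk_eq_zero _).1 hρ
    obtain ⟨b, y1, hb, rfl⟩ := hσ y hy
    have h3 : τ1 (z.1 - d0 y1) = 0 := by
      rw [map_sub, hzy, ← hτ, map_add, hb, add_zero, sub_self]
    obtain ⟨z0, hz0⟩ := hκ _ h3
    have hz0' : z0 ∈ Z0 := by
      rw [LinearMap.mem_ker, LinearMap.comp_apply, hz0, map_sub, hdd, sub_zero]
      exact z.2
    refine ⟨⟨z0, hz0'⟩, ?_⟩
    rw [← sub_eq_zero]
    change cl _ - cl z = 0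
    rw [← map_sub, hcl]
    refine ⟨-y1, ?_⟩
    change _ = κ z0 - z.1
    rw [hz0, map_neg]; abel
  · rintro z ⟨y, hy⟩
    exact ⟨⟨(z, y), (hV _ _).2 hy.symm⟩, rfl⟩

end FLgen

section Ass

variable {A : Type*} [CommRing A] {n : ℕ} {r : ℕ} (F : Fin r → MvPolynomial (Fin n) A)
variable (A' : Type*) [CommRing A'] [Algebra A A']
  (N : Type*) [AddCommGroup N] [Module A N] [Module A' N] [IsScalarTower A A' N]

/-- Cech cohomology in degree `q + 1`. -/
abbrev TS (q : ℕ) : Type _ := LinearMap.ker (dK F A' N (q + 1)) ⧸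
    (LinearMap.range (dK F A' N q)).comap (LinearMap.ker (dK F A' N (q + 1))).subtype

/-- the class of a cocycle -/
noncomputable def clS (q : ℕ) : LinearMap.ker (dK F A' N (q + 1)) →ₗ[SR A n A'] TS F A' N q :=
  Submodule.mkQ _

theorem clS_surj (q : ℕ) : Function.Surjective (clS F A' N q) := Submodule.mkQ_surjective _

theorem clS_eq_zero (q : ℕ) (z : LinearMap.ker (dK F A' N (q + 1))) :
    clS F A' N q z = 0 ↔ ∃ y, dK F A' N q y = z.1 :=
  Submodule.Quotient.mk_eq_zero _

theorem clS_R (q : ℕ) (a : MvPolynomial (Fin n) A) (z : LinearMap.ker (dK F A' N (q + 1))) :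
    clS F A' N q (a • z) = a • clS F A' N q z :=
  ((clS F A' N q).restrictScalars (MvPolynomial (Fin n) A)).map_smul a z

/-- coboundaries -/
noncomputable def Bd : ∀ q : ℕ, Submodule (SR A n A') (CK F A' N q)
  | 0 => ⊥
  | q + 1 => LinearMap.range (dK F A' N q)

theorem Bd_le (q : ℕ) (b : CK F A' N q) (hb : b ∈ Bd F A' N q) : dK F A' N q b = 0 := by
  cases q with
  | zero => rw [(Submodule.mem_bot _).1 hb, map_zero]
  | succ q => obtain ⟨c, rfl⟩ := hb; exact dK_dK F A' q c

theorem ass_tors [IsNoetherianRing A] (t : A)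
    (h1 : IsFiniteLength A (A ⧸ Ideal.span {t}))
    (h2 : IsFiniteLength A (LinearMap.ker (t • (LinearMap.id : A →ₗ[A] A)))) (q : ℕ) :
    {P ∈ associatedPrimes (MvPolynomial (Fin n) A) (TS F A A q) | C t ∈ P}.Finite := by
  let τ : A →ₗ[A] A := t • LinearMap.id
  let κ : LinearMap.ker τ →ₗ[A] A := (LinearMap.ker τ).subtype
  let σ : A →ₗ[A] A ⧸ Ideal.span {t} := Submodule.mkQ _
  have hκ : Function.Exact κ τ := LinearMap.exact_subtype_ker_map τ
  have hσ : Function.Exact τ σ := by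
    rw [LinearMap.exact_iff]
    ext x
    simp only [σ, Submodule.ker_mkQ, τ, LinearMap.mem_range, LinearMap.smul_apply,
      LinearMap.id_apply, Ideal.mem_span_singleton', smul_eq_mul, mul_comm]
  have hCt : ∀ p (z : CK F A A p), (C t : MvPolynomial (Fin n) A) • z = CKmap F A τ p z :=
    fun p z => funext fun s => C_smul' (pr F s) A t (z s)
  obtain ⟨W, hfl, hW⟩ := finLen_core (dK F A A q) (dK F A A (q + 1)) (dK_dK F A q)
    (CKmap F A τ q) (CKmap F A τ (q + 1)) (dK_CKmap F A τ q) (CKmap F A σ q)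
    (Bd F A (A ⧸ Ideal.span {t}) q) (by
      intro y hy
      obtain ⟨b, hb, hyb⟩ : ∃ b ∈ Bd F A A q, CKmap F A σ q (y - b) = 0 := by
        cases q with
        | zero =>
          exact ⟨0, Submodule.zero_mem _, by rw [sub_zero]; exact (Submodule.mem_bot _).1 hy⟩
        | succ q =>
          obtain ⟨w, hw⟩ := hy
          obtain ⟨v, rfl⟩ := CKmap_surj F A σ (Submodule.mkQ_surjective _) q w
          exact ⟨dK F A A q v, ⟨v, rfl⟩, by rw [map_sub, ← hw, dK_CKmap, sub_self]⟩
      obtain ⟨y1, hy1⟩ := CKmap_exact F A τ σ hσ q _ hyb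
      exact ⟨b, y1, Bd_le F A A q b hb, by rw [hy1, sub_add_cancel]⟩)
    (CKmap F A κ (q + 1)) (CKmap_exact F A κ τ hκ (q + 1))
    (CK_finLen F A q h1) (CK_finLen F A (q + 1) h2)
  refine (ass_finite _ hfl inferInstance inferInstance).subset ?_
  rintro P ⟨hP, htP⟩
  rw [AssociatedPrimes.mem_iff, isAssociatedPrime_iff] at hP ⊢
  obtain ⟨hPp, m, hm⟩ := hP
  refine ⟨hPp, ?_⟩
  have htm : (C t : MvPolynomial (Fin n) A) • m = 0 := by
    have := hm ▸ htP
    rwa [Submodule.mem_colon_singleton] at this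
  have hmπ : m ∈ W := by
    obtain ⟨z, rfl⟩ := clS_surj F A A q m
    rw [← clS_R, clS_eq_zero] at htm
    obtain ⟨y, hy⟩ := htm
    refine hW z ⟨y, ?_⟩
    rw [hy, ← hCt]; rfl
  refine ⟨⟨m, hmπ⟩, ?_⟩
  rw [hm]
  ext a
  rw [Submodule.mem_colon_singleton, Submodule.mem_colon_singleton, Submodule.mem_bot,
    Submodule.mem_bot, ← Subtype.coe_inj]
  rfl

theorem ass_loc [IsNoetherianRing A] (t : A) [IsLocalization.Away t A']
    (h : IsFiniteLength A' A') (q : ℕ) :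
    {P ∈ associatedPrimes (MvPolynomial (Fin n) A) (TS F A A q) | C t ∉ P}.Finite := by
  have hfl : IsFiniteLength (SR A n A') (TS F A' A' q) :=
    finLen_quot (finLen_sub (CK_finLen F A' (q + 1) h) _) _
  refine (ass_finite _ hfl inferInstance inferInstance).subset ?_
  let R := MvPolynomial (Fin n) A
  let bc : ∀ p, CK F A A p →ₗ[R] CK F A' A' p := fun p =>
    LinearMap.pi fun s => TLbc A' (pr F s) ∘ₗ LinearMap.proj s
  have hbc : ∀ p z s, bc p z s = TLbc A' (pr F s) (z s) := fun p z s => rfl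
  have hdbc : ∀ p z, dK F A' A' p (bc p z) = bc (p + 1) (dK F A A p z) := fun p z => by
    funext s
    rw [hbc]
    simp only [dK_apply, map_sum, map_zsmul, TLbc_TLres, hbc]
  have hker : ∀ p z, bc p z = 0 → ∃ k : ℕ, (C t : R) ^ k • z = 0 := by
    intro p z hz
    obtain ⟨k, hk⟩ := exists_common (fun s (k : ℕ) => (C t : R) ^ k • z s = 0) (by
      intro s k l hkl h
      rw [← Nat.sub_add_cancel hkl, pow_add, mul_smul, h, smul_zero])
      (fun s => TLbc_ker t A' (pr F s) (z s) (congrFun hz s))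
    exact ⟨k, funext hk⟩
  have hlift : ∀ p z, ∃ (k : ℕ) (y : _), bc p y = (C t : R) ^ k • z := by
    intro p z
    obtain ⟨k, hk⟩ := exists_common (fun s (k : ℕ) => ∃ y, TLbc A' (pr F s) y =
      (C t : R) ^ k • z s) (by
      rintro s k l hkl ⟨y, hy⟩
      refine ⟨(C t : R) ^ (l - k) • y, ?_⟩
      rw [map_smul, hy, smul_smul, ← pow_add, Nat.sub_add_cancel hkl])
      (fun s => TLbc_lift t A' (pr F s) (z s))
    choose y hy using hk
    exact ⟨k, y, funext hy⟩
  rintro P ⟨hP, htP⟩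
  rw [AssociatedPrimes.mem_iff, isAssociatedPrime_iff] at hP ⊢
  obtain ⟨hPp, m, hm⟩ := hP
  refine ⟨hPp, ?_⟩
  obtain ⟨z, rfl⟩ := clS_surj F A A q m
  let z' : LinearMap.ker (dK F A' A' (q + 1)) := ⟨bc _ z.1, by
    rw [LinearMap.mem_ker, hdbc, LinearMap.mem_ker.1 z.2, map_zero]⟩
  refine ⟨clS F A' A' q z', ?_⟩
  ext a
  rw [Submodule.mem_colon_singleton, Submodule.mem_bot, ← clS_R, clS_eq_zero]
  have hmem : ∀ a, a ∈ P ↔ ∃ y, dK F A A q y = a • z.1 := fun a => by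
    rw [hm, Submodule.mem_colon_singleton, Submodule.mem_bot, ← clS_R, clS_eq_zero]; rfl
  constructor
  · intro ha
    obtain ⟨y, hy⟩ := (hmem a).1 ha
    refine ⟨bc q y, ?_⟩
    rw [hdbc, hy, map_smul]; rfl
  · rintro ⟨y', hy'⟩
    obtain ⟨k, y, hy⟩ := hlift q y'
    have h1 : bc (q + 1) (((C t) ^ k * a) • z.1 - dK F A A q y) = 0 := by
      rw [map_sub, ← hdbc, hy, dK_R, hy', map_smul, mul_smul, sub_eq_zero]; rfl
    obtain ⟨l, hl⟩ := hker _ _ h1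
    have h2 : (C t) ^ l * ((C t) ^ k * a) ∈ P := by
      rw [hmem]
      refine ⟨(C t : R) ^ l • y, ?_⟩
      rw [smul_sub, sub_eq_zero] at hl
      rw [dK_R, ← hl, smul_smul]
    rcases hPp.mem_or_mem h2 with h3 | h3
    · exact absurd (hPp.mem_of_pow_mem _ h3) htP
    · rcases hPp.mem_or_mem h3 with h3 | h3
      · exact absurd (hPp.mem_of_pow_mem _ h3) htP
      · exact h3

theorem finLen_of_torsion {A : Type*} [CommRing A] [IsNoetherianRing A] (t : A)
    (h : IsFiniteLength A (A ⧸ Ideal.span {t})) (M : Type*) [AddCommGroup M] [Module A M]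
    [Module.Finite A M] (ht : ∀ m : M, t • m = 0) : IsFiniteLength A M := by
  obtain ⟨k, s, hs⟩ := Module.Finite.exists_fin (R := A) (M := M)
  have hle : ∀ m : M, Ideal.span {t} ≤ LinearMap.ker (LinearMap.toSpanSingleton A M m) := by
    intro m x hx
    obtain ⟨a, rfl⟩ := Ideal.mem_span_singleton'.1 hx
    simp [mul_smul, ht]
  let g : (Fin k → A ⧸ Ideal.span {t}) →ₗ[A] M :=
    ∑ i, (Submodule.liftQ _ _ (hle (s i))) ∘ₗ LinearMap.proj i
  have hg : Function.Surjective g := by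
    rw [← LinearMap.range_eq_top, ← top_le_iff, ← hs, Submodule.span_le]
    rintro _ ⟨i, rfl⟩
    refine ⟨Pi.single i (Submodule.Quotient.mk 1), ?_⟩
    simp only [g, LinearMap.sum_apply, LinearMap.comp_apply, LinearMap.proj_apply]
    rw [Finset.sum_eq_single i]
    · rw [Pi.single_eq_same]
      erw [Submodule.liftQ_apply]
      simp
    · intro j _ hj
      rw [Pi.single_eq_of_ne hj, map_zero]
    · simp
  refine IsFiniteLength.of_surjective ?_ hg
  rw [isFiniteLength_iff_isNoetherian_isArtinian] at h ⊢
  obtain ⟨_, _⟩ := h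
  exact ⟨inferInstance, inferInstance⟩

theorem exists_t (A : Type*) [CommRing A] [IsNoetherianRing A] [IsLocalRing A]
    (hA : ringKrullDim A = 1) : ∃ t : A, IsFiniteLength A (A ⧸ Ideal.span {t}) ∧
      IsFiniteLength A (LinearMap.ker (t • (LinearMap.id : A →ₗ[A] A))) ∧
      IsFiniteLength (Localization.Away t) (Localization.Away t) := by
  have h1 : Ring.KrullDimLE 1 A := Ring.krullDimLE_iff.2 (by rw [hA]; rfl)
  rw [Ring.krullDimLE_one_iff] at h1
  have h0 : ¬ Ring.KrullDimLE 0 A := fun h => by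
    have := Ring.krullDimLE_iff.1 h
    rw [hA] at this
    exact absurd this (by decide)
  have hfin := minimalPrimes.finite_of_isNoetherianRing A
  obtain ⟨t, htm, ht⟩ : ∃ t ∈ IsLocalRing.maximalIdeal A, ∀ p ∈ minimalPrimes A, t ∉ p := by
    by_contra hcon
    push Not at hcon
    have hsub : (IsLocalRing.maximalIdeal A : Set A) ⊆ ⋃ i ∈ (hfin.toFinset : Set (Ideal A)),
        ((fun i => i) i : Ideal A) := by
      intro x hx
      obtain ⟨p, hp, hxp⟩ := hcon x hx
      simp only [Set.mem_iUnion]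
      exact ⟨p, by simpa using hp, hxp⟩
    rw [Ideal.subset_union_prime ⊥ ⊥ (fun i hi _ _ => (hfin.mem_toFinset.1 hi).1.1)] at hsub
    obtain ⟨p, hp, hle⟩ := hsub
    have hp := hfin.mem_toFinset.1 hp
    apply h0
    rw [Ring.krullDimLE_zero_iff]
    intro I hI
    have h2 : I ≤ IsLocalRing.maximalIdeal A := IsLocalRing.le_maximalIdeal hI.ne_top
    have h3 : IsLocalRing.maximalIdeal A ≤ I := hle.trans (hp.2 ⟨hI, bot_le⟩ (h2.trans hle))
    rw [le_antisymm h2 h3]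
    infer_instance
  have hart : IsArtinianRing (A ⧸ Ideal.span {t}) := by
    have : Ring.KrullDimLE 0 (A ⧸ Ideal.span {t}) := by
      rw [Ring.krullDimLE_zero_iff]
      intro I hI
      have h2 : (I.comap (Ideal.Quotient.mk (Ideal.span {t}))).IsPrime := hI.comap _
      have h3 : t ∈ I.comap (Ideal.Quotient.mk (Ideal.span {t})) := by
        rw [Ideal.mem_comap, Ideal.Quotient.eq_zero_iff_mem.2 (Ideal.mem_span_singleton_self t)]
        exact I.zero_mem
      rcases h1 _ h2 with h4 | h4
      · exact absurd h3 (ht _ h4)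
      · have h5 := Ideal.map_eq_top_or_isMaximal_of_surjective
          (Ideal.Quotient.mk (Ideal.span {t})) Ideal.Quotient.mk_surjective h4
        rw [Ideal.map_comap_of_surjective _ Ideal.Quotient.mk_surjective] at h5
        exact h5.resolve_left hI.ne_top
    exact IsNoetherianRing.isArtinianRing_of_krullDimLE_zero
  have hfl : IsFiniteLength A (A ⧸ Ideal.span {t}) := by
    rw [isFiniteLength_iff_isNoetherian_isArtinian]
    refine ⟨inferInstance, ?_⟩
    exact isArtinian_of_surjective_algebraMap (R := A ⧸ Ideal.span {t}) Ideal.Quotient.mk_surjective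
  refine ⟨t, hfl, finLen_of_torsion t hfl _ ?_, ?_⟩
  · rintro ⟨m, hm⟩
    exact Subtype.ext hm
  · have : Ring.KrullDimLE 0 (Localization.Away t) := by
      rw [Ring.krullDimLE_zero_iff]
      intro I hI
      obtain ⟨M, hM, hIM⟩ := I.exists_le_maximal hI.ne_top
      have hMp := hM.isPrime
      have key : ∀ J : Ideal (Localization.Away t), J.IsPrime →
          t ∉ J.comap (algebraMap A (Localization.Away t)) := by
        intro J hJ htJ
        exact hJ.ne_top (Ideal.eq_top_of_isUnit_mem _ htJ (IsLocalization.Away.algebraMap_isUnit t))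
      have h2 : (M.comap (algebraMap A (Localization.Away t))).IsPrime := hMp.comap _
      have h3 : (I.comap (algebraMap A (Localization.Away t))).IsPrime := hI.comap _
      rcases h1 _ h2 with h4 | h4
      · have h5 := h4.2 ⟨h3, bot_le⟩ (Ideal.comap_mono hIM)
        have h6 := Ideal.map_mono (f := algebraMap A (Localization.Away t)) h5
        rw [IsLocalization.map_comap (Submonoid.powers t),
          IsLocalization.map_comap (Submonoid.powers t)] at h6
        rwa [le_antisymm hIM h6]
      · exact absurd (IsLocalRing.eq_maximalIdeal h4 ▸ htm) (key M hMp)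
    have : IsNoetherianRing (Localization.Away t) :=
      IsLocalization.isNoetherianRing (Submonoid.powers t) _ inferInstance
    rw [isFiniteLength_iff_isNoetherian_isArtinian]
    exact ⟨inferInstance, IsNoetherianRing.isArtinianRing_of_krullDimLE_zero⟩

theorem ass_TS (A : Type*) [CommRing A] [IsNoetherianRing A] [IsLocalRing A]
    (hA : ringKrullDim A = 1) {n r : ℕ} (F : Fin r → MvPolynomial (Fin n) A) (q : ℕ) :
    (associatedPrimes (MvPolynomial (Fin n) A) (TS F A A q)).Finite := by
  obtain ⟨t, h1, h2, h3⟩ := exists_t A hA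
  refine ((ass_tors F t h1 h2 q).union (ass_loc F (Localization.Away t) t h3 q)).subset ?_
  intro P hP
  by_cases h : (C t : MvPolynomial (Fin n) A) ∈ P
  · exact Or.inl ⟨hP, h⟩
  · exact Or.inr ⟨hP, h⟩

end Ass

end LCFin


namespace LCFin

open CategoryTheory Opposite Limits

universe u

section Model

variable {R : Type u} [CommRing R] (P : ℕᵒᵖ ⥤ ChainComplex (ModuleCat.{u} R) ℕ)

noncomputable def Dtr (j : ℕ) (M : ModuleCat.{u} R) (s t : ℕ) (h : s ≤ t) :
    ((P.obj (op s)).X j ⟶ M) →ₗ[R] ((P.obj (op t)).X j ⟶ M) :=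
  Linear.leftComp R M ((P.map (homOfLE h).op).f j)

theorem Dtr_apply (j : ℕ) (M : ModuleCat.{u} R) (s t : ℕ) (h : s ≤ t)
    (x : (P.obj (op s)).X j ⟶ M) : Dtr P j M s t h x = (P.map (homOfLE h).op).f j ≫ x := rfl

instance (j : ℕ) (M : ModuleCat.{u} R) :
    DirectedSystem (fun t : ℕ => ((P.obj (op t)).X j ⟶ M)) (Dtr P j M · · ·) where
  map_self i x := by
    rw [Dtr_apply]
    have : (homOfLE (le_refl i)).op = 𝟙 (op i) := rfl
    rw [this, P.map_id]; simp
  map_map k j i h1 h2 x := by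
    simp only [Dtr_apply]
    rw [← Category.assoc, ← HomologicalComplex.comp_f, ← P.map_comp]
    rfl

abbrev DT (j : ℕ) (M : ModuleCat.{u} R) : Type u :=
  Module.DirectLimit (fun t : ℕ => ((P.obj (op t)).X j ⟶ M)) (Dtr P j M)

noncomputable def ofD (j : ℕ) (M : ModuleCat.{u} R) (t : ℕ) :
    ((P.obj (op t)).X j ⟶ M) →ₗ[R] DT P j M :=
  Module.DirectLimit.of R ℕ (fun t : ℕ => ((P.obj (op t)).X j ⟶ M)) (Dtr P j M) t

theorem ofD_tr (j : ℕ) (M : ModuleCat.{u} R) {s t : ℕ} (h : s ≤ t)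
    (x : (P.obj (op s)).X j ⟶ M) :
    ofD P j M t ((P.map (homOfLE h).op).f j ≫ x) = ofD P j M s x :=
  Module.DirectLimit.of_f (f := Dtr P j M) (hij := h)

theorem exists_ofD (j : ℕ) (M : ModuleCat.{u} R) (z : DT P j M) : ∃ t x, ofD P j M t x = z :=
  Module.DirectLimit.exists_of z

theorem ofD_zero {j : ℕ} {M : ModuleCat.{u} R} {t : ℕ} {x : (P.obj (op t)).X j ⟶ M}
    (h : ofD P j M t x = 0) : ∃ (s : ℕ) (hs : t ≤ s), (P.map (homOfLE hs).op).f j ≫ x = 0 :=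
  Module.DirectLimit.of.zero_exact (f := Dtr P j M) h

noncomputable def Dd (M : ModuleCat.{u} R) (j : ℕ) : DT P j M →ₗ[R] DT P (j + 1) M :=
  Module.DirectLimit.map (fun t => Linear.leftComp R M ((P.obj (op t)).d (j + 1) j)) (by
    intro s t h
    ext x
    simp [Dtr_apply])

theorem Dd_ofD (M : ModuleCat.{u} R) (j t : ℕ) (x : (P.obj (op t)).X j ⟶ M) :
    Dd P M j (ofD P j M t x) = ofD P (j + 1) M t ((P.obj (op t)).d (j + 1) j ≫ x) :=
  Module.DirectLimit.map_apply_of _ _ _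

theorem Dd_Dd (M : ModuleCat.{u} R) (j : ℕ) (z : DT P j M) : Dd P M (j + 1) (Dd P M j z) = 0 := by
  obtain ⟨t, x, rfl⟩ := exists_ofD P j M z
  rw [Dd_ofD, Dd_ofD, ← Category.assoc, HomologicalComplex.d_comp_d, zero_comp, map_zero]

noncomputable def DC (M : ModuleCat.{u} R) : CochainComplex (ModuleCat.{u} R) ℕ :=
  CochainComplex.of (fun j => ModuleCat.of R (DT P j M)) (fun j => ModuleCat.ofHom (Dd P M j))
    (fun j => ModuleCat.hom_ext (LinearMap.ext fun z => Dd_Dd P M j z))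

theorem DC_d (M : ModuleCat.{u} R) (j : ℕ) :
    (DC P M).d j (j + 1) = ModuleCat.ofHom (Dd P M j) := by
  exact CochainComplex.of_d (fun j => ModuleCat.of R (DT P j M)) (fun j => ModuleCat.ofHom (Dd P M j)) j

noncomputable def Dm {M N : ModuleCat.{u} R} (f : M ⟶ N) (j : ℕ) : DT P j M →ₗ[R] DT P j N :=
  Module.DirectLimit.map (fun t => Linear.rightComp R _ f) (by
    intro s t h
    ext x
    simp [Dtr_apply])

theorem Dm_ofD {M N : ModuleCat.{u} R} (f : M ⟶ N) (j t : ℕ) (x : (P.obj (op t)).X j ⟶ M) :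
    Dm P f j (ofD P j M t x) = ofD P j N t (x ≫ f) :=
  Module.DirectLimit.map_apply_of _ _ _

noncomputable def DF : ModuleCat.{u} R ⥤ CochainComplex (ModuleCat.{u} R) ℕ where
  obj M := DC P M
  map {M N} f := CochainComplex.ofHom (fun j => ModuleCat.ofHom (Dm P f j)) (by
    intro j
    rw [DC_d, DC_d]
    refine ModuleCat.hom_ext (LinearMap.ext fun z => ?_)
    obtain ⟨t, x, rfl⟩ := exists_ofD P j M z
    change Dd P N j (Dm P f j (ofD P j M t x)) = Dm P f (j + 1) (Dd P M j (ofD P j M t x))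
    rw [Dd_ofD, Dm_ofD, Dm_ofD, Dd_ofD, Category.assoc])
  map_id M := by
    refine HomologicalComplex.hom_ext _ _ fun j => ModuleCat.hom_ext (LinearMap.ext fun z => ?_)
    obtain ⟨t, x, rfl⟩ := exists_ofD P j M z
    change Dm P _ j _ = ofD P j M t x
    rw [Dm_ofD, Category.comp_id]
  map_comp {M N L} f g := by
    refine HomologicalComplex.hom_ext _ _ fun j => ModuleCat.hom_ext (LinearMap.ext fun z => ?_)
    obtain ⟨t, x, rfl⟩ := exists_ofD P j M z
    change Dm P (f ≫ g) j (ofD P j M t x) = Dm P g j (Dm P f j (ofD P j M t x))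
    rw [Dm_ofD, Dm_ofD, Dm_ofD, Category.assoc]

instance : (DF P).PreservesZeroMorphisms where
  map_zero M N := by
    refine HomologicalComplex.hom_ext _ _ fun j => ModuleCat.hom_ext (LinearMap.ext fun z => ?_)
    obtain ⟨t, x, rfl⟩ := exists_ofD P j M z
    change Dm P _ j _ = 0
    rw [Dm_ofD, comp_zero, map_zero]

theorem DF_shortExact [∀ t j, Projective ((P.obj t).X j)] (S : ShortComplex (ModuleCat.{u} R))
    (hS : S.ShortExact) : (S.map (DF P)).ShortExact := by
  have := hS.mono_f
  have := hS.epi_g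
  apply HomologicalComplex.shortExact_of_degreewise_shortExact
  intro j
  refine ShortComplex.ShortExact.mk' ?_ ?_ ?_
  · rw [ShortComplex.moduleCat_exact_iff]
    intro z hz
    obtain ⟨t, x, rfl⟩ := exists_ofD P j _ z
    change Dm P S.g j _ = 0 at hz
    rw [Dm_ofD] at hz
    obtain ⟨s, hs, h⟩ := ofD_zero P hz
    rw [← Category.assoc] at h
    refine ⟨ofD P j _ s (hS.exact.lift _ h), ?_⟩
    change Dm P S.f j _ = _
    rw [Dm_ofD, hS.exact.lift_f, ofD_tr]
  · rw [ModuleCat.mono_iff_injective, injective_iff_map_eq_zero]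
    intro z hz
    obtain ⟨t, x, rfl⟩ := exists_ofD P j _ z
    change Dm P S.f j _ = 0 at hz
    rw [Dm_ofD] at hz
    obtain ⟨s, hs, h⟩ := ofD_zero P hz
    rw [← Category.assoc] at h
    have h' := zero_of_comp_mono S.f h
    rw [← ofD_tr P j _ hs, h', map_zero]
    rfl
  · rw [ModuleCat.epi_iff_surjective]
    intro z
    obtain ⟨t, x, rfl⟩ := exists_ofD P j _ z
    refine ⟨ofD P j _ t (Projective.factorThru x S.g), ?_⟩
    change Dm P S.g j _ = _
    rw [Dm_ofD, Projective.factorThru_comp]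

end Model

end LCFin


namespace LCFin

open CategoryTheory Opposite Limits

universe u

section Cmp

variable {R : Type u} [CommRing R]

theorem nat_aux1 {C : Type*} [Category C] {A B A' B' : C} (e : A ≅ B) (e' : A' ≅ B') (f : A ⟶ A')
    (g : B ⟶ B') (h : f ≫ e'.hom = e.hom ≫ g) : g ≫ e'.inv = e.inv ≫ f := by
  rw [Iso.eq_inv_comp, ← Category.assoc, ← h, Category.assoc, Iso.hom_inv_id, Category.comp_id]

theorem nat_aux2 {C : Type*} [Category C] {X1 X2 X3 Y1 Y2 Y3 : C} (a : X1 ⟶ Y1) (b : X2 ⟶ Y2)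
    (c : X3 ⟶ Y3) (p : Y1 ⟶ Y2) (r : Y2 ⟶ Y3) (q : X1 ⟶ X2) (s : X2 ⟶ X3)
    (h1 : a ≫ p = q ≫ b) (h2 : b ≫ r = s ≫ c) : a ≫ (p ≫ r) = (q ≫ s) ≫ c := by
  rw [← Category.assoc, h1, Category.assoc, h2, Category.assoc]

theorem homologyUnop_nat {K L : ChainComplex (ModuleCat.{u} R)ᵒᵖ ℕ} (ψ : K ⟶ L) (i : ℕ) :
    (HomologicalComplex.homologyMap ψ i).unop ≫ (K.homologyUnop i).inv =
      (L.homologyUnop i).inv ≫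
        HomologicalComplex.homologyMap ((HomologicalComplex.unopFunctor _ _).map ψ.op) i := by
  have h := HomologicalComplex.homologyOp_hom_naturality
    ((HomologicalComplex.unopFunctor (ModuleCat.{u} R) (ComplexShape.down ℕ)).map ψ.op) i
  exact nat_aux1 (L.homologyUnop i) (K.homologyUnop i)
    (HomologicalComplex.homologyMap ((HomologicalComplex.unopFunctor _ _).map ψ.op) i)
    (HomologicalComplex.homologyMap ψ i).unop (congrArg Quiver.Hom.unop h).symm

noncomputable def lyMap {P Q : ChainComplex (ModuleCat.{u} R) ℕ} (φ : P ⟶ Q) (M : ModuleCat.{u} R) :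
    Q.linearYonedaObj R M ⟶ P.linearYonedaObj R M :=
  (HomologicalComplex.unopFunctor _ _).map
    ((((linearYoneda R (ModuleCat.{u} R)).obj M).rightOp.mapHomologicalComplex _).map φ).op

theorem lyMap_f {P Q : ChainComplex (ModuleCat.{u} R) ℕ} (φ : P ⟶ Q) (M : ModuleCat.{u} R)
    (j : ℕ) (x : Q.X j ⟶ M) : ((lyMap φ M).f j).hom x = φ.f j ≫ x := rfl

theorem ly_d (P : ChainComplex (ModuleCat.{u} R) ℕ) (M : ModuleCat.{u} R)
    (j k : ℕ) (x : P.X j ⟶ M) : ((P.linearYonedaObj R M).d j k).hom x = P.d k j ≫ x := rfl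

theorem isoExt_nat {X Y : ModuleCat.{u} R} (f : X ⟶ Y) (P : ProjectiveResolution X)
    (Q : ProjectiveResolution Y)
    (φ : P.complex ⟶ Q.complex) (comm : φ.f 0 ≫ Q.π.f 0 = P.π.f 0 ≫ f)
    (n : ℕ) (M : ModuleCat.{u} R) :
    ((Ext R (ModuleCat.{u} R) n).map f.op).app M ≫ (P.isoExt n M).hom =
      (Q.isoExt n M).hom ≫ HomologicalComplex.homologyMap (lyMap φ M) n := by
  have h := ProjectiveResolution.isoLeftDerivedObj_inv_naturality f P Q φ comm
    ((linearYoneda R (ModuleCat.{u} R)).obj M).rightOp n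
  have h' := congrArg Quiver.Hom.unop h
  rw [unop_comp, unop_comp] at h'
  have h2 := homologyUnop_nat
    ((((linearYoneda R (ModuleCat.{u} R)).obj M).rightOp.mapHomologicalComplex _).map φ) n
  exact nat_aux2 _ _ _ _ _ _ _ h' h2


theorem colim_surj (F : (ℕᵒᵖ)ᵒᵖ ⥤ ModuleCat.{u} R) (c : Cocone F) (hc : IsColimit c) (w : c.pt) :
    ∃ t : ℕ, ∃ v : F.obj (op (op t)), (c.ι.app (op (op t))).hom v = w := by
  let N : ℕ → Submodule R c.pt := fun t => LinearMap.range (c.ι.app (op (op t))).hom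
  have hN : Monotone N := by
    intro s t h
    rintro _ ⟨v, rfl⟩
    refine ⟨(F.map (homOfLE h).op.op).hom v, ?_⟩
    have := c.w (homOfLE h).op.op
    rw [← this]
    rfl
  have h0 : ModuleCat.ofHom ((⨆ t, N t).mkQ) = 0 := by
    refine hc.hom_ext fun j => ?_
    refine ModuleCat.hom_ext (LinearMap.ext fun v => ?_)
    change (⨆ t, N t).mkQ ((c.ι.app j).hom v) = 0
    rw [Submodule.mkQ_apply, Submodule.Quotient.mk_eq_zero]
    exact Submodule.mem_iSup_of_mem j.unop.unop ⟨v, rfl⟩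
  have h1 : w ∈ ⨆ t, N t := by
    rw [← Submodule.Quotient.mk_eq_zero]
    exact LinearMap.congr_fun (congrArg ModuleCat.Hom.hom h0) w
  rw [Submodule.mem_iSup_of_directed N hN.directed_le] at h1
  exact h1

/- classes in the homology of a cochain complex of modules -/
noncomputable def hcl (K : CochainComplex (ModuleCat.{u} R) ℕ) (i : ℕ) :
    LinearMap.ker (K.d i (i + 1)).hom →ₗ[R] K.homology i :=
  (K.homologyπ i).hom ∘ₗ (K.liftCycles (ModuleCat.ofHom (LinearMap.ker (K.d i (i + 1)).hom).subtype)
    (i + 1) (by simp) (by ext z; exact z.2)).hom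

noncomputable def hlift (K : CochainComplex (ModuleCat.{u} R) ℕ) (i : ℕ) :
    LinearMap.ker (K.d i (i + 1)).hom →ₗ[R] K.cycles i :=
  (K.liftCycles (ModuleCat.ofHom (LinearMap.ker (K.d i (i + 1)).hom).subtype)
    (i + 1) (by simp) (by ext z; exact z.2)).hom

theorem hcl_def (K : CochainComplex (ModuleCat.{u} R) ℕ) (i : ℕ)
    (z : LinearMap.ker (K.d i (i + 1)).hom) : hcl K i z = (K.homologyπ i).hom (hlift K i z) := rfl

theorem hlift_i (K : CochainComplex (ModuleCat.{u} R) ℕ) (i : ℕ)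
    (z : LinearMap.ker (K.d i (i + 1)).hom) : (K.iCycles i).hom (hlift K i z) = z.1 := by
  have := K.liftCycles_i (ModuleCat.ofHom (LinearMap.ker (K.d i (i + 1)).hom).subtype)
    (i + 1) (by simp) (by ext z; exact z.2)
  exact LinearMap.congr_fun (congrArg ModuleCat.Hom.hom this) z

theorem iCycles_inj (K : CochainComplex (ModuleCat.{u} R) ℕ) (i : ℕ) :
    Function.Injective (K.iCycles i).hom :=
  (ModuleCat.mono_iff_injective (K.iCycles i)).1 inferInstance

theorem hcl_surj (K : CochainComplex (ModuleCat.{u} R) ℕ) (i : ℕ) :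
    Function.Surjective (hcl K i) := by
  intro w
  obtain ⟨c, rfl⟩ := (ModuleCat.epi_iff_surjective (K.homologyπ i)).1 inferInstance w
  refine ⟨⟨(K.iCycles i).hom c, ?_⟩, ?_⟩
  · have := K.iCycles_d i (i + 1)
    exact LinearMap.congr_fun (congrArg ModuleCat.Hom.hom this) c
  · rw [hcl_def]
    change (K.homologyπ i).hom _ = (K.homologyπ i).hom _
    congr 1
    apply iCycles_inj
    rw [hlift_i]

theorem hcl_eq_zero (K : CochainComplex (ModuleCat.{u} R) ℕ) (i : ℕ)
    (z : LinearMap.ker (K.d i (i + 1)).hom) : hcl K i z = 0 ↔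
      ∃ y, (K.d ((ComplexShape.up ℕ).prev i) i).hom y = z.1 := by
  have hex : (ShortComplex.mk _ _ (K.toCycles_comp_homologyπ
      ((ComplexShape.up ℕ).prev i) i)).Exact :=
    ShortComplex.exact_of_g_is_cokernel _ (K.homologyIsCokernel _ i rfl)
  rw [ShortComplex.moduleCat_exact_iff] at hex
  have ht : ∀ y, (K.iCycles i).hom ((K.toCycles ((ComplexShape.up ℕ).prev i) i).hom y) =
      (K.d ((ComplexShape.up ℕ).prev i) i).hom y := fun y =>
    LinearMap.congr_fun (congrArg ModuleCat.Hom.hom (K.toCycles_i ((ComplexShape.up ℕ).prev i) i)) y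
  rw [hcl_def]
  constructor
  · intro h
    obtain ⟨y, hy⟩ := hex _ h
    refine ⟨y, ?_⟩
    rw [← ht, ← hlift_i]
    exact congrArg _ hy
  · rintro ⟨y, hy⟩
    have : hlift K i z = (K.toCycles ((ComplexShape.up ℕ).prev i) i).hom y := by
      apply iCycles_inj
      rw [ht, hy, hlift_i]
    rw [this]
    exact LinearMap.congr_fun (congrArg ModuleCat.Hom.hom (K.toCycles_comp_homologyπ
      ((ComplexShape.up ℕ).prev i) i)) y

theorem hcl_map {K L : CochainComplex (ModuleCat.{u} R) ℕ} (f : K ⟶ L) (i : ℕ)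
    (z : LinearMap.ker (K.d i (i + 1)).hom) (z' : LinearMap.ker (L.d i (i + 1)).hom)
    (h : (f.f i).hom z.1 = z'.1) :
    (HomologicalComplex.homologyMap f i).hom (hcl K i z) = hcl L i z' := by
  have h1 := LinearMap.congr_fun (congrArg ModuleCat.Hom.hom
    (HomologicalComplex.homologyπ_naturality f i)) (hlift K i z)
  have h2 := LinearMap.congr_fun (congrArg ModuleCat.Hom.hom
    (HomologicalComplex.cyclesMap_i f i)) (hlift K i z)
  rw [hcl_def, hcl_def]
  refine h1.trans ?_
  change (L.homologyπ i).hom _ = (L.homologyπ i).hom _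
  congr 1
  apply iCycles_inj
  rw [hlift_i, ← h]
  refine h2.trans ?_
  change (f.f i).hom _ = (f.f i).hom _
  congr 1
  exact hlift_i K i z

theorem isZero_homology_of (K : CochainComplex (ModuleCat.{u} R) ℕ) (i : ℕ)
    (h : ∀ x, (K.d i (i + 1)).hom x = 0 → ∃ y, (K.d ((ComplexShape.up ℕ).prev i) i).hom y = x) :
    Subsingleton (K.homology i) := by
  refine ⟨fun a b => ?_⟩
  obtain ⟨z, hz⟩ := hcl_surj K i (a - b)
  obtain ⟨y, hy⟩ := h z.1 z.2
  rw [(hcl_eq_zero K i z).2 ⟨y, hy⟩] at hz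
  exact (sub_eq_zero.1 hz.symm)

theorem hcl_zero (K : CochainComplex (ModuleCat.{u} R) ℕ) 
    (z : LinearMap.ker (K.d 0 (0 + 1)).hom) : hcl K 0 z = 0 ↔ z.1 = 0 := by
  rw [hcl_eq_zero]
  have : K.d ((ComplexShape.up ℕ).prev 0) 0 = 0 := K.shape _ _ (by simp)
  rw [this]
  constructor
  · rintro ⟨y, hy⟩
    exact hy.symm
  · intro h
    exact ⟨0, h.symm⟩

theorem hcl_succ (K : CochainComplex (ModuleCat.{u} R) ℕ) (i : ℕ)
    (z : LinearMap.ker (K.d (i + 1) (i + 1 + 1)).hom) : hcl K (i + 1) z = 0 ↔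
      ∃ y, (K.d i (i + 1)).hom y = z.1 := by
  rw [hcl_eq_zero]
  have : (ComplexShape.up ℕ).prev (i + 1) = i := by simp
  rw [this]

end Cmp
end LCFin


namespace LCFin

open CategoryTheory Opposite Limits

universe u

section Gen

variable {R : Type u} [CommRing R] (P : ℕᵒᵖ ⥤ ChainComplex (ModuleCat.{u} R) ℕ)
  (M : ModuleCat.{u} R)

theorem DC_d_apply (j : ℕ) (z : DT P j M) :
    ((DC P M).d j (j + 1)).hom z = (Dd P M j z : DT P (j + 1) M) := by
  rw [DC_d]
  rfl

/- the map from the homology of one resolution to the colimit model -/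
noncomputable def toDC (t : ℕ) :
    (P.obj (op t)).linearYonedaObj R M ⟶ DC P M :=
  CochainComplex.ofHom (fun j => ModuleCat.ofHom (ofD P j M t)) (by
    intro j
    rw [DC_d]
    refine ModuleCat.hom_ext (LinearMap.ext fun x => ?_)
    exact Dd_ofD P M j t x)

theorem toDC_f (t j : ℕ) (x : (P.obj (op t)).X j ⟶ M) :
    ((toDC P M t).f j).hom x = ofD P j M t x := rfl

theorem toDC_tr {s t : ℕ} (h : s ≤ t) :
    lyMap (P.map (homOfLE h).op) M ≫ toDC P M t = toDC P M s := by
  refine HomologicalComplex.hom_ext _ _ fun j => ModuleCat.hom_ext (LinearMap.ext fun x => ?_)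
  exact ofD_tr P j M h x

theorem toDC_tr' {s t : ℕ} (h : s ≤ t) (i : ℕ) :
    HomologicalComplex.homologyMap (lyMap (P.map (homOfLE h).op) M) i ≫
    HomologicalComplex.homologyMap (toDC P M t) i = HomologicalComplex.homologyMap (toDC P M s) i := by
  rw [← HomologicalComplex.homologyMap_comp, toDC_tr]

theorem toDC_surj (i : ℕ) (w : (DC P M).homology i) :
    ∃ t v, (HomologicalComplex.homologyMap (toDC P M t) i).hom v = w := by
  obtain ⟨⟨z, hz⟩, rfl⟩ := hcl_surj _ _ w
  obtain ⟨t, x, hx⟩ := exists_ofD P i M z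
  have hz1 : Dd P M i z = 0 := (DC_d_apply P M i z).symm.trans hz
  rw [← hx, Dd_ofD] at hz1
  obtain ⟨s, hs, h⟩ := ofD_zero _ hz1
  have hx' : (((P.obj (op s)).linearYonedaObj R M).d i (i + 1)).hom
      ((P.map (homOfLE hs).op).f i ≫ x) = 0 := by
    refine Eq.trans ?_ h
    have := (P.map (homOfLE hs).op).comm (i + 1) i
    change (P.obj (op s)).d (i + 1) i ≫ (P.map (homOfLE hs).op).f i ≫ x = _
    rw [← Category.assoc, ← Category.assoc, this]
  refine ⟨s, hcl _ i ⟨(P.map (homOfLE hs).op).f i ≫ x, hx'⟩, ?_⟩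
  refine hcl_map (toDC P M s) i _ _ ?_
  exact (ofD_tr P i M hs x).trans hx

theorem P_tr (a b c : ℕ) (h1 : a ≤ b) (h2 : b ≤ c) (j : ℕ) :
      (P.map (homOfLE h2).op).f j ≫ (P.map (homOfLE h1).op).f j = 
        (P.map (homOfLE (h1.trans h2)).op).f j := by
  rw [← HomologicalComplex.comp_f, ← P.map_comp]
  rfl

theorem P_tr' (a b c : ℕ) (h1 : a ≤ b) (h2 : b ≤ c) (j : ℕ) (x : (P.obj (op a)).X j ⟶ M) :
      (P.map (homOfLE h2).op).f j ≫ (P.map (homOfLE h1).op).f j ≫ x = 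
        (P.map (homOfLE (h1.trans h2)).op).f j ≫ x := by
  rw [← Category.assoc, P_tr]

theorem tr_d {s t : ℕ} (h : s ≤ t) (i : ℕ) (z : (P.obj (op s)).X i ⟶ M) :
    (P.obj (op t)).d (i + 1) i ≫ (P.map (homOfLE h).op).f i ≫ z =
      (P.map (homOfLE h).op).f (i + 1) ≫ (P.obj (op s)).d (i + 1) i ≫ z := by
  have := (P.map (homOfLE h).op).comm (i + 1) i
  rw [← Category.assoc, ← this, Category.assoc]

theorem toDC_inj_zero (s : ℕ) (z : (P.obj (op s)).X 0 ⟶ M)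
    (hz : ofD P 0 M s z = 0) : ∃ (t : ℕ) (h : s ≤ t), (P.map (homOfLE h).op).f 0 ≫ z = 0 :=
  ofD_zero P hz

theorem toDC_inj_succ (i s : ℕ) (z : (P.obj (op s)).X (i + 1) ⟶ M) (y : DT P i M)
    (hy2 : Dd P M i y = ofD P (i + 1) M s z) : ∃ (t : ℕ) (h : s ≤ t) (x : (P.obj (op t)).X i ⟶ M),
      (P.obj (op t)).d (i + 1) i ≫ x = (P.map (homOfLE h).op).f (i + 1) ≫ z := by
  obtain ⟨t, x, hx⟩ := exists_ofD P i M y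
  rw [← hx, Dd_ofD, ← ofD_tr P (i + 1) M (le_max_left t s), 
      ← ofD_tr P (i + 1) M (le_max_right t s), ← sub_eq_zero, ← map_sub] at hy2
  obtain ⟨t', h', e⟩ := ofD_zero P hy2
  refine ⟨t', (le_max_right t s).trans h',
      (P.map (homOfLE ((le_max_left t s).trans h')).op).f i ≫ x, ?_⟩
  rw [Preadditive.comp_sub, sub_eq_zero, P_tr', P_tr'] at e
  exact (tr_d P M _ i x).trans e

theorem toDC_inj_ker (i s : ℕ) (z : (P.obj (op s)).X i ⟶ M)
    (hz : (((P.obj (op s)).linearYonedaObj R M).d i (i + 1)).hom z = 0) (t : ℕ) (h : s ≤ t) :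
    (((P.obj (op t)).linearYonedaObj R M).d i (i + 1)).hom
      ((P.map (homOfLE h).op).f i ≫ z) = 0 := by
  refine (tr_d P M h i z).trans ?_
  have hz1 : (P.obj (op s)).d (i + 1) i ≫ z = 0 := hz
  rw [hz1, comp_zero]
  rfl

theorem toDC_inj (i : ℕ) (s : ℕ) (v : ((P.obj (op s)).linearYonedaObj R M).homology i)
    (hv : (HomologicalComplex.homologyMap (toDC P M s) i).hom v = 0) : ∃ (t : ℕ) (h : s ≤ t),
      (HomologicalComplex.homologyMap (lyMap (P.map (homOfLE h).op) M) i).hom v = 0 := by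
  obtain ⟨⟨z, hz⟩, rfl⟩ := hcl_surj _ _ v
  have hz1 : (P.obj (op s)).d (i + 1) i ≫ z = 0 := hz
  have hzz : ((DC P M).d i (i + 1)).hom (ofD P i M s z) = 0 := by
    refine (DC_d_apply P M i _).trans ?_
    refine (Dd_ofD P M i s z).trans ?_
    exact (congrArg (ofD P (i + 1) M s) hz1).trans (map_zero _)
  have hv2 := (hcl_map (toDC P M s) i ⟨z, hz⟩ ⟨ofD P i M s z, hzz⟩ rfl).symm.trans hv
  suffices hh : ∃ (t : ℕ) (h : s ≤ t), 
      hcl ((P.obj (op t)).linearYonedaObj R M) i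
        ⟨(P.map (homOfLE h).op).f i ≫ z, toDC_inj_ker P M i s z hz t h⟩ = 0 by
    obtain ⟨t, h, hy⟩ := hh
    exact ⟨t, h, (hcl_map (lyMap (P.map (homOfLE h).op) M) i ⟨z, hz⟩
      ⟨_, toDC_inj_ker P M i s z hz t h⟩ rfl).trans hy⟩
  cases i with
  | zero =>
    rw [hcl_zero] at hv2
    obtain ⟨t, h, e⟩ := ofD_zero P hv2
    exact ⟨t, h, (hcl_zero _ _).2 e⟩
  | succ i =>
    rw [hcl_succ] at hv2
    obtain ⟨y, hy⟩ := hv2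
    have hy2 : Dd P M i y = ofD P (i + 1) M s z := (DC_d_apply P M i y).symm.trans hy
    obtain ⟨t, h, x, hx⟩ := toDC_inj_succ P M i s z y hy2
    exact ⟨t, h, (hcl_succ _ _ _).2 ⟨x, hx⟩⟩

end Gen

section LC

variable {R : Type u} [CommRing R] (I : Ideal R)

noncomputable abbrev XF : ℕᵒᵖ ⥤ ModuleCat.{u} R :=
  localCohomology.ringModIdeals (localCohomology.idealPowersDiagram I)

noncomputable def rs (t : ℕ) : ProjectiveResolution ((XF I).obj (op t)) := projectiveResolution _

noncomputable def PF : ℕᵒᵖ ⥤ ChainComplex (ModuleCat.{u} R) ℕ :=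
  Functor.ofOpSequence (X := fun t => (rs I t).complex) (fun t =>
    ProjectiveResolution.lift ((XF I).map (homOfLE (Nat.le_add_right t 1)).op) (rs I (t + 1)) (rs I t))

theorem PF_obj (t : ℕ) : (PF I).obj (op t) = (rs I t).complex := rfl

instance (t : ℕᵒᵖ) (j : ℕ) : Projective (((PF I).obj t).X j) :=
  (rs I t.unop).projective j

theorem PF_comm {s t : ℕ} (h : s ≤ t) :
    ((PF I).map (homOfLE h).op).f 0 ≫ (rs I s).π.f 0 =
      (rs I t).π.f 0 ≫ (XF I).map (homOfLE h).op := by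
  obtain ⟨k, rfl⟩ := Nat.exists_eq_add_of_le h
  induction k with
  | zero =>
    have : (homOfLE h).op = 𝟙 (op s) := rfl
    rw [this]
    erw [(PF I).map_id, (XF I).map_id]
    simp
    rfl
  | succ k ih =>
    have h1 : (homOfLE h).op = (homOfLE (Nat.le_add_right (s + k) 1)).op ≫
      (homOfLE (Nat.le_add_right s k)).op := rfl
    rw [h1, Functor.map_comp, Functor.map_comp, HomologicalComplex.comp_f]
    refine (nat_aux2 _ _ _ _ _ _ _ ?_ (ih (Nat.le_add_right s k)).symm).symm
    have := Functor.ofOpSequence_map_homOfLE_succ (X := fun t => (rs I t).complex) (fun t =>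
      ProjectiveResolution.lift ((XF I).map (homOfLE (Nat.le_add_right t 1)).op)
      (rs I (t + 1)) (rs I t)) (s + k)
    have h2 : ((PF I).map (homOfLE (Nat.le_add_right (s + k) 1)).op) = _ := this
    rw [h2]
    exact (ProjectiveResolution.lift_commutes_zero _ _ _).symm

noncomputable abbrev dgM (M : ModuleCat.{u} R) (i : ℕ) : (ℕᵒᵖ)ᵒᵖ ⥤ ModuleCat.{u} R :=
  localCohomology.diagram (localCohomology.idealPowersDiagram I) i ⋙ (evaluation _ _).obj M

noncomputable def dgMap (M : ModuleCat.{u} R) (i : ℕ) (t : ℕ) :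
    (dgM I M i).obj (op (op t)) ⟶ (DC (PF I) M).homology i :=
  ((rs I t).isoExt (R := R) i M).hom ≫ HomologicalComplex.homologyMap (toDC (PF I) M t) i

theorem dgMap_nat (M : ModuleCat.{u} R) (i : ℕ) {s t : ℕ} (h : s ≤ t) :
    (dgM I M i).map (homOfLE h).op.op ≫ dgMap I M i t = dgMap I M i s := by
  have h1 := isoExt_nat ((XF I).map (homOfLE h).op) (rs I t) (rs I s) ((PF I).map (homOfLE h).op)
    (PF_comm I h) i M
  have h2 := toDC_tr' (PF I) M h i
  have h3 := nat_aux2 _ _ (𝟙 _) _ _ _ _ h1 (h2.trans (Category.comp_id _).symm)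
  exact h3.trans (Category.comp_id _)

noncomputable def dgCocone (M : ModuleCat.{u} R) (i : ℕ) : Cocone (dgM I M i) where
  pt := (DC (PF I) M).homology i
  ι := 
    { app := fun j => dgMap I M i j.unop.unop
      naturality := fun s t f => (dgMap_nat I M i (leOfHom f.unop.unop)).trans 
        (Category.comp_id _).symm }

theorem dg_surj (M : ModuleCat.{u} R) (i : ℕ) (w : (DC (PF I) M).homology i) :
    ∃ t v, (dgMap I M i t).hom v = w := by
  obtain ⟨s, v, hv⟩ := toDC_surj (PF I) M i w
  refine ⟨s, ((rs I s).isoExt (R := R) i M).inv.hom v, ?_⟩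
  have h5 := LinearMap.congr_fun (congrArg ModuleCat.Hom.hom
    ((rs I s).isoExt (R := R) i M).inv_hom_id) v
  exact (congrArg (HomologicalComplex.homologyMap (toDC (PF I) M s) i).hom h5).trans hv

theorem dg_inj (M : ModuleCat.{u} R) (i : ℕ) (s : ℕ) (v : (dgM I M i).obj (op (op s)))
    (hv : (dgMap I M i s).hom v = 0) : ∃ (t : ℕ) (h : s ≤ t),
      ((dgM I M i).map (homOfLE h).op.op).hom v = 0 := by
  obtain ⟨t, h, e⟩ := toDC_inj (PF I) M i s (((rs I s).isoExt (R := R) i M).hom.hom v) hv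
  refine ⟨t, h, ?_⟩
  have h1 := isoExt_nat ((XF I).map (homOfLE h).op) (rs I t) (rs I s)
      ((PF I).map (homOfLE h).op) (PF_comm I h) i M
  have h2 : ((rs I t).isoExt (R := R) i M).hom.hom (((dgM I M i).map (homOfLE h).op.op).hom v) = 0 :=
    (LinearMap.congr_fun (congrArg ModuleCat.Hom.hom h1) v).trans e
  have h3 := LinearMap.congr_fun (congrArg ModuleCat.Hom.hom
      ((rs I t).isoExt (R := R) i M).hom_inv_id) (((dgM I M i).map (homOfLE h).op.op).hom v)
  refine h3.symm.trans ?_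
  exact (congrArg (((rs I t).isoExt (R := R) i M).inv.hom) h2).trans (map_zero _)

theorem lcEquiv (M : ModuleCat.{u} R) (i : ℕ) : 
    Nonempty (((localCohomology I i).obj M : ModuleCat.{u} R) ≃ₗ[R] (DC (PF I) M).homology i) := by
  let D := localCohomology.diagram (localCohomology.idealPowersDiagram I) i
  let c : Cocone (dgM I M i) := ((evaluation _ _).obj M).mapCocone (colimit.cocone D)
  let hc : IsColimit c := isColimitOfPreserves ((evaluation _ _).obj M) (colimit.isColimit D)
  let φ : c.pt ⟶ (DC (PF I) M).homology i := hc.desc (dgCocone I M i)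
  have hφ : ∀ t v, φ.hom ((c.ι.app (op (op t))).hom v) = (dgMap I M i t).hom v := fun t v =>
    LinearMap.congr_fun (congrArg ModuleCat.Hom.hom (hc.fac (dgCocone I M i) (op (op t)))) v
  refine ⟨LinearEquiv.ofBijective (show c.pt →ₗ[R] (DC (PF I) M).homology i from φ.hom) ⟨?_, ?_⟩⟩
  · rw [injective_iff_map_eq_zero]
    intro w hw
    obtain ⟨t, v, rfl⟩ := colim_surj _ c hc w
    obtain ⟨t', h, e⟩ := dg_inj I M i t v ((hφ t v).symm.trans hw)
    have := LinearMap.congr_fun (congrArg ModuleCat.Hom.hom (c.w (homOfLE h).op.op)) v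
    refine this.symm.trans ?_
    exact (congrArg (c.ι.app (op (op t'))).hom e).trans (map_zero _)
  · intro w
    obtain ⟨t, v, h⟩ := dg_surj I M i w
    exact ⟨_, (hφ t v).trans h⟩

end LC
end LCFin


namespace LCFin

open CategoryTheory Opposite Limits

universe u

section Stage

variable {R : Type u} [CommRing R] {X : ModuleCat.{u} R} (P : ProjectiveResolution X)
  (M : ModuleCat.{u} R)

/- acyclicity of a module against a resolution, stated elementwise -/
def SA0 : Prop := ∀ x : P.complex.X 0 ⟶ M, P.complex.d 1 0 ≫ x = 0 → x = 0

def SAs (i : ℕ) : Prop := ∀ x : P.complex.X (i + 1) ⟶ M, P.complex.d (i + 2) (i + 1) ≫ x = 0 →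
  ∃ y : P.complex.X i ⟶ M, P.complex.d (i + 1) i ≫ y = x

theorem smul_hom_zero {X Y : ModuleCat.{u} R} (f : R) (hf : f • (𝟙 X) = 0) (g : Y ⟶ X) :
    f • g = 0 := by
  rw [← Category.comp_id g, ← Linear.comp_smul, hf, comp_zero]

theorem htp (f : R) (hf : f • (𝟙 X) = 0) : Nonempty (Homotopy (f • 𝟙 P.complex) 0) := by
  refine ⟨ProjectiveResolution.liftHomotopy (0 : X ⟶ X) (P := P) (Q := P) _ _ ?_ ?_⟩
  · rw [Functor.map_zero, comp_zero]
    refine HomologicalComplex.to_single_hom_ext ?_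
    have h : f • (P.π.f 0) = 0 := smul_hom_zero f hf (P.π.f 0)
    simpa using h
  · simp

theorem htp_rel (f : R) (h : Homotopy (f • 𝟙 P.complex) 0) :
    (∀ w : P.complex.X 0 ⟶ M, P.complex.d 1 0 ≫ w = 0 → f • w = 0) ∧
    (∀ (i : ℕ) (w : P.complex.X (i + 1) ⟶ M), P.complex.d (i + 2) (i + 1) ≫ w = 0 →
      ∃ y : P.complex.X i ⟶ M, P.complex.d (i + 1) i ≫ y = f • w) := by
  constructor
  · intro w hw
    have := h.comm 0
    rw [dNext_eq_zero _ _ (by simp), prevD_eq h.hom (show (ComplexShape.down ℕ).Rel 1 0 by simp)] at this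
    have h2 : f • w = (f • 𝟙 P.complex : P.complex ⟶ P.complex).f 0 ≫ w := by simp
    rw [h2, this]
    simp [hw]
  · intro i w hw
    have := h.comm (i + 1)
    rw [dNext_eq h.hom (show (ComplexShape.down ℕ).Rel (i + 1) i by simp),
      prevD_eq h.hom (show (ComplexShape.down ℕ).Rel (i + 2) (i + 1) by simp)] at this
    have h2 : f • w = (f • 𝟙 P.complex : P.complex ⟶ P.complex).f (i + 1) ≫ w := by simp
    refine ⟨h.hom i (i + 1) ≫ w, ?_⟩
    rw [h2, this]
    simp [hw]

theorem SA_of_bij (f : R) (hf : f • (𝟙 X) = 0)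
    (hM : Function.Bijective (fun m : M => f • m)) : SA0 P M ∧ ∀ i, SAs P M i := by
  obtain ⟨h⟩ := htp P f hf
  let e : M ≃ₗ[R] M := LinearEquiv.ofBijective (LinearMap.lsmul R M f) hM
  have he : ∀ m, f • e.symm m = m := fun m => e.apply_symm_apply m
  have hw : ∀ {Y : ModuleCat.{u} R} (x : Y ⟶ M), ∃ w : Y ⟶ M, f • w = x := by
    intro Y x
    refine ⟨ModuleCat.ofHom (e.symm.toLinearMap ∘ₗ x.hom), ?_⟩
    ext y
    exact he _
  have hi : ∀ {Y : ModuleCat.{u} R} (x : Y ⟶ M), f • x = 0 → x = 0 := by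
    intro Y x hx
    ext y
    apply hM.1
    have : f • x.hom y = 0 := LinearMap.congr_fun (congrArg ModuleCat.Hom.hom hx) y
    exact this.trans (smul_zero f).symm
  constructor
  · intro x hx
    obtain ⟨w, rfl⟩ := hw x
    refine (htp_rel P M f h).1 w (hi _ ?_)
    rw [← Linear.comp_smul, hx]
  · intro i x hx
    obtain ⟨w, rfl⟩ := hw x
    refine (htp_rel P M f h).2 i w (hi _ ?_)
    rw [← Linear.comp_smul, hx]

theorem SA_pi {ι : Type} (N : ι → Type u) [∀ s, AddCommGroup (N s)] [∀ s, Module R (N s)]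
    (h : ∀ s, SA0 P (ModuleCat.of R (N s)) ∧ ∀ i, SAs P (ModuleCat.of R (N s)) i) :
    SA0 P (ModuleCat.of R (∀ s, N s)) ∧ ∀ i, SAs P (ModuleCat.of R (∀ s, N s)) i := by
  let π : ∀ s, ModuleCat.of R (∀ s, N s) ⟶ ModuleCat.of R (N s) := fun s =>
    ModuleCat.ofHom (LinearMap.proj s)
  constructor
  · intro x hx
    ext y s

    have := (h s).1 (x ≫ π s) (by rw [← Category.assoc, hx, zero_comp])
    exact LinearMap.congr_fun (congrArg ModuleCat.Hom.hom this) y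
  · intro i x hx
    have := fun s => (h s).2 i (x ≫ π s) (by rw [← Category.assoc, hx, zero_comp])
    choose y hy using this
    refine ⟨ModuleCat.ofHom (LinearMap.pi fun s => (y s).hom), ?_⟩
    ext z s

    exact LinearMap.congr_fun (congrArg ModuleCat.Hom.hom (hy s)) z

theorem SA_inj [Injective M] (i : ℕ) : SAs P M i := by
  intro x hx
  exact ⟨(P.exact_succ i).descToInjective x hx, (P.exact_succ i).comp_descToInjective x hx⟩

theorem SA0_mono {M' : ModuleCat.{u} R} (f : M ⟶ M') [Mono f] (h : SA0 P M') : SA0 P M := by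
  intro x hx
  refine zero_of_comp_mono f (h _ ?_)
  rw [← Category.assoc, hx, zero_comp]

/- descending a 0-cocycle to the resolved module -/
theorem desc0 (x : P.complex.X 0 ⟶ M) (hx : P.complex.d 1 0 ≫ x = 0) :
    ∃ y : X ⟶ M, P.π.f 0 ≫ y = x := by
  exact ⟨P.exact₀.desc x hx, P.exact₀.g_desc x hx⟩

end Stage
end LCFin


namespace LCFin

open CategoryTheory Opposite Limits

universe u

section Van

variable {R : Type u} [CommRing R] (I : Ideal R) (M : ModuleCat.{u} R)

noncomputable abbrev HH (i : ℕ) : ModuleCat.{u} R := (DC (PF I) M).homology i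

theorem cocycle_rep (j : ℕ) (z : DT (PF I) j M) (hz : Dd (PF I) M j z = 0) :
    ∃ t, ∃ x : (rs I t).complex.X j ⟶ M, (rs I t).complex.d (j + 1) j ≫ x = 0 ∧
      ofD (PF I) j M t x = z := by
  obtain ⟨t, x, rfl⟩ := exists_ofD (PF I) j M z
  rw [Dd_ofD] at hz
  obtain ⟨s, hs, h⟩ := ofD_zero _ hz
  exact ⟨s, ((PF I).map (homOfLE hs).op).f j ≫ x, (tr_d (PF I) M hs j x).trans h,
    ofD_tr (PF I) j M hs x⟩

theorem HH_zero_of (h : ∀ t, SA0 (rs I t) M) : Subsingleton (HH I M 0) := by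
  refine isZero_homology_of _ 0 fun z hz => ⟨0, ?_⟩
  obtain ⟨t, x, hx, hxz⟩ := cocycle_rep I M 0 z ((DC_d_apply (PF I) M 0 z).symm.trans hz)
  have h0 := h t x hx
  refine (map_zero _).trans ?_
  rw [← hxz, h0]
  exact (map_zero (ofD (PF I) 0 M t)).symm

theorem HH_succ_of (i : ℕ) (h : ∀ t, SAs (rs I t) M i) : Subsingleton (HH I M (i + 1)) := by
  refine ⟨fun a b => ?_⟩
  rw [← sub_eq_zero]
  obtain ⟨⟨z, hz⟩, hw⟩ := hcl_surj _ _ (a - b)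
  rw [← hw]
  obtain ⟨t, x, hx, hxz⟩ := cocycle_rep I M (i + 1) z ((DC_d_apply (PF I) M (i + 1) z).symm.trans hz)
  obtain ⟨y, hy⟩ := h t x hx
  refine (hcl_succ _ _ _).2 ⟨ofD (PF I) i M t y, ?_⟩
  refine (DC_d_apply (PF I) M i _).trans ((Dd_ofD (PF I) M i t y).trans ?_)
  exact (congrArg (ofD (PF I) (i + 1) M t) hy).trans hxz

theorem HH_succ_inj [Injective M] (i : ℕ) : Subsingleton (HH I M (i + 1)) :=
  HH_succ_of I M i fun t => SA_inj (rs I t) M i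

theorem smul_XF (f : R) (hf : f ∈ I) (t : ℕ) : (f ^ t) • (𝟙 ((XF I).obj (op t))) = 0 := by
  ext z
  induction z using Submodule.Quotient.induction_on with
  | H r =>
    change f ^ t • (Submodule.Quotient.mk r : R ⧸ I ^ t) = 0
    rw [← Submodule.Quotient.mk_smul, Submodule.Quotient.mk_eq_zero]
    exact Ideal.mul_mem_right _ _ (Ideal.pow_mem_pow hf t)

/- finite or infinite products of modules on which some element of the ideal is bijective -/
theorem SA_prod {ι : Type} (N : ι → Type u) [∀ s, AddCommGroup (N s)] [∀ s, Module R (N s)]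
    (h : ∀ s, ∃ f ∈ I, Function.Bijective (fun m : N s => f • m)) (t : ℕ) :
    SA0 (rs I t) (ModuleCat.of R (∀ s, N s)) ∧ ∀ i, SAs (rs I t) (ModuleCat.of R (∀ s, N s)) i := by
  refine SA_pi _ N fun s => ?_
  obtain ⟨f, hf, hb⟩ := h s
  refine SA_of_bij _ _ (f ^ t) (smul_XF I f hf t) ?_
  have : (fun m : N s => f ^ t • m) = (fun m : N s => f • m)^[t] := by
    rw [smul_iterate]
  exact this ▸ hb.iterate t

end Van

section LES

variable {R : Type u} [CommRing R] (I : Ideal R) {S : ShortComplex (ModuleCat.{u} R)}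

theorem subs_of_exact (T : ShortComplex (ModuleCat.{u} R)) (hT : T.Exact)
    (h1 : Subsingleton T.X₁) (h3 : Subsingleton T.X₃) : Subsingleton T.X₂ := by
  rw [ShortComplex.moduleCat_exact_iff] at hT
  have : ∀ a : T.X₂, a = 0 := by
    intro a
    obtain ⟨y, hy⟩ := hT a (Subsingleton.elim _ _)
    rw [← hy, Subsingleton.elim y 0, map_zero]
  exact ⟨fun a b => (this a).trans (this b).symm⟩

theorem les13 (hS : S.ShortExact) (i : ℕ) (h : Subsingleton (HH I S.X₂ i))
    (h' : Subsingleton (HH I S.X₂ (i + 1))) :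
    Nonempty (HH I S.X₃ i ≃ₗ[R] HH I S.X₁ (i + 1)) := by
  exact ⟨((DF_shortExact (PF I) S hS).δIso i (i + 1) (by simp)
    (ModuleCat.isZero_of_subsingleton (HH I S.X₂ i))
    (ModuleCat.isZero_of_subsingleton (HH I S.X₂ (i + 1)))).toLinearEquiv⟩

theorem les_mid (hS : S.ShortExact) (i : ℕ) (h : Subsingleton (HH I S.X₁ i))
    (h' : Subsingleton (HH I S.X₃ i)) : Subsingleton (HH I S.X₂ i) :=
  subs_of_exact _ ((DF_shortExact (PF I) S hS).homology_exact₂ i) h h'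

theorem les_one (hS : S.ShortExact) (i : ℕ) (h : Subsingleton (HH I S.X₃ i))
    (h' : Subsingleton (HH I S.X₂ (i + 1))) : Subsingleton (HH I S.X₁ (i + 1)) :=
  subs_of_exact _ ((DF_shortExact (PF I) S hS).homology_exact₁ i (i + 1) (by simp)) h h'

theorem les_surj12 (hS : S.ShortExact) (i : ℕ) (h : Subsingleton (HH I S.X₃ i)) :
    ∃ f : HH I S.X₁ i →ₗ[R] HH I S.X₂ i, Function.Surjective f := by
  refine ⟨(HomologicalComplex.homologyMap ((DF (PF I)).map S.f) i).hom, fun a => ?_⟩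
  have := (DF_shortExact (PF I) S hS).homology_exact₂ i
  rw [ShortComplex.moduleCat_exact_iff] at this
  exact this a (Subsingleton.elim (α := HH I S.X₃ i) _ _)

theorem les12 (hS : S.ShortExact) (i : ℕ) (h : Subsingleton (HH I S.X₃ i))
    (h' : Subsingleton (HH I S.X₃ (i + 1))) :
    Nonempty (HH I S.X₁ (i + 1) ≃ₗ[R] HH I S.X₂ (i + 1)) := by
  refine ⟨LinearEquiv.ofBijective
    (HomologicalComplex.homologyMap ((DF (PF I)).map S.f) (i + 1)).hom ⟨?_, fun a => ?_⟩⟩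
  · rw [injective_iff_map_eq_zero]
    intro a ha
    have := (DF_shortExact (PF I) S hS).homology_exact₁ i (i + 1) (by simp)
    rw [ShortComplex.moduleCat_exact_iff] at this
    obtain ⟨y, hy⟩ := this a ha
    refine hy.symm.trans ?_
    exact (congrArg _ (Subsingleton.elim (α := HH I S.X₃ i) y 0)).trans (map_zero _)
  · have := (DF_shortExact (PF I) S hS).homology_exact₂ (i + 1)
    rw [ShortComplex.moduleCat_exact_iff] at this
    exact this a (Subsingleton.elim (α := HH I S.X₃ (i + 1)) _ _)

theorem les23 (hS : S.ShortExact) (i : ℕ) (h : Subsingleton (HH I S.X₁ i))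
    (h' : Subsingleton (HH I S.X₁ (i + 1))) :
    Nonempty (HH I S.X₂ i ≃ₗ[R] HH I S.X₃ i) := by
  refine ⟨LinearEquiv.ofBijective
    (HomologicalComplex.homologyMap ((DF (PF I)).map S.g) i).hom ⟨?_, fun a => ?_⟩⟩
  · rw [injective_iff_map_eq_zero]
    intro a ha
    have := (DF_shortExact (PF I) S hS).homology_exact₂ i
    rw [ShortComplex.moduleCat_exact_iff] at this
    obtain ⟨y, hy⟩ := this a ha
    refine hy.symm.trans ?_
    exact (congrArg _ (Subsingleton.elim (α := HH I S.X₁ i) y 0)).trans (map_zero _)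
  · have := (DF_shortExact (PF I) S hS).homology_exact₃ i (i + 1) (by simp)
    rw [ShortComplex.moduleCat_exact_iff] at this
    exact this a (Subsingleton.elim (α := HH I S.X₁ (i + 1)) _ _)

/- connecting map trick: surjectivity on `X₂ → X₃` kills `X₁` one degree up -/
theorem les_one' (hS : S.ShortExact) (i : ℕ)
    (h : Function.Surjective (HomologicalComplex.homologyMap ((DF (PF I)).map S.g) i).hom)
    (h' : Subsingleton (HH I S.X₂ (i + 1))) : Subsingleton (HH I S.X₁ (i + 1)) := by
  have e1 := (DF_shortExact (PF I) S hS).homology_exact₁ i (i + 1) (by simp)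
  rw [ShortComplex.moduleCat_exact_iff] at e1
  have : ∀ a : HH I S.X₁ (i + 1), a = 0 := by
    intro a
    obtain ⟨y, hy⟩ := e1 a (Subsingleton.elim (α := HH I S.X₂ (i + 1)) _ _)
    obtain ⟨w, hw⟩ := h y
    refine hy.symm.trans ?_
    have h0 := (DF_shortExact (PF I) S hS).comp_δ i (i + 1) (by simp)
    have h1 := LinearMap.congr_fun (congrArg ModuleCat.Hom.hom h0) w
    exact (congrArg _ hw.symm).trans h1
  exact ⟨fun a b => (this a).trans (this b).symm⟩

end LES
end LCFin


namespace LCFin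

open CategoryTheory Opposite Limits

universe u

section Tors

variable {R : Type u} [CommRing R] (I : Ideal R) (M : ModuleCat.{u} R)

def IsTors : Prop := ∀ m : M, ∃ t : ℕ, ∀ a ∈ I ^ t, a • m = 0

variable {M}

noncomputable def sp (t : ℕ) (m : M) (h : ∀ a ∈ I ^ t, a • m = 0) : (XF I).obj (op t) ⟶ M :=
  ModuleCat.ofHom (Submodule.liftQ (I ^ t) (LinearMap.toSpanSingleton R M m)
    (fun a ha => h a ha))

theorem sp_mk (t : ℕ) (m : M) (h : ∀ a ∈ I ^ t, a • m = 0) (r : R) :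
    (sp I t m h).hom (Submodule.Quotient.mk r : R ⧸ I ^ t) = r • m := rfl

theorem XF_ext (t : ℕ) (f g : (XF I).obj (op t) ⟶ M)
    (h : f.hom (Submodule.Quotient.mk 1 : R ⧸ I ^ t) = g.hom (Submodule.Quotient.mk 1 : R ⧸ I ^ t)) :
    f = g := by
  ext z
  induction z using Submodule.Quotient.induction_on with
  | H r =>
    have e : (Submodule.Quotient.mk r : R ⧸ I ^ t) = r • (Submodule.Quotient.mk 1 : R ⧸ I ^ t) := by
      rw [← Submodule.Quotient.mk_smul, smul_eq_mul, mul_one]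
    refine (congrArg f.hom e).trans (Eq.trans ?_ (congrArg g.hom e).symm)
    exact (map_smul f.hom r _).trans ((congrArg (r • ·) h).trans (map_smul g.hom r _).symm)

theorem sp_one (t : ℕ) (m : M) (h : ∀ a ∈ I ^ t, a • m = 0) :
    (sp I t m h).hom (Submodule.Quotient.mk 1 : R ⧸ I ^ t) = m := one_smul R m

theorem hmono {s t : ℕ} (hst : s ≤ t) (m : M) (h : ∀ a ∈ I ^ s, a • m = 0) :
    ∀ a ∈ I ^ t, a • m = 0 := fun a ha => h a (Ideal.pow_le_pow_right hst ha)

theorem XF_sp {s t : ℕ} (hst : s ≤ t) (m : M) (h : ∀ a ∈ I ^ s, a • m = 0) :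
    (XF I).map (homOfLE hst).op ≫ sp I s m h = sp I t m (hmono I hst m h) := by
  apply XF_ext
  rfl

noncomputable def cc (t : ℕ) (m : M) (h : ∀ a ∈ I ^ t, a • m = 0) : DT (PF I) 0 M :=
  ofD (PF I) 0 M t ((rs I t).π.f 0 ≫ sp I t m h)

theorem pi_tr {s t : ℕ} (hst : s ≤ t) (y : (XF I).obj (op s) ⟶ M) :
    ((PF I).map (homOfLE hst).op).f 0 ≫ (rs I s).π.f 0 ≫ y =
      (rs I t).π.f 0 ≫ (XF I).map (homOfLE hst).op ≫ y :=
  (Category.assoc _ _ _).symm.trans ((congrArg (· ≫ y) (PF_comm I hst)).trans (Category.assoc _ _ _))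

theorem cc_tr {s t : ℕ} (hst : s ≤ t) (m : M) (h : ∀ a ∈ I ^ s, a • m = 0) :
    cc I t m (hmono I hst m h) = cc I s m h := by
  unfold cc
  rw [← ofD_tr (PF I) 0 M hst]
  congr 1
  refine Eq.trans ?_ (pi_tr I hst _).symm
  exact congrArg ((rs I t).π.f 0 ≫ ·) (XF_sp I hst m h).symm

theorem cc_indep (s t : ℕ) (m : M) (h : ∀ a ∈ I ^ s, a • m = 0) (h' : ∀ a ∈ I ^ t, a • m = 0) :
    cc I s m h = cc I t m h' :=
  (cc_tr I (le_max_left s t) m h).symm.trans (cc_tr I (le_max_right s t) m h')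

theorem cc_cocycle (t : ℕ) (m : M) (h : ∀ a ∈ I ^ t, a • m = 0) :
    Dd (PF I) M 0 (cc I t m h) = 0 := by
  unfold cc
  refine (Dd_ofD (PF I) M 0 t _).trans ?_
  have : (rs I t).complex.d 1 0 ≫ (rs I t).π.f 0 ≫ sp I t m h = 0 :=
    (Category.assoc _ _ _).symm.trans ((congrArg (· ≫ sp I t m h)
      (rs I t).complex_d_comp_π_f_zero).trans zero_comp)
  exact (congrArg (ofD (PF I) 1 M t) this).trans (map_zero _)

theorem cc_zero (t : ℕ) (m : M) (h : ∀ a ∈ I ^ t, a • m = 0) (h0 : cc I t m h = 0) : m = 0 := by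
  obtain ⟨s, hs, e⟩ := ofD_zero (PF I) h0
  have e2 := (pi_tr I hs (sp I t m h)).symm.trans e
  have e3 : (XF I).map (homOfLE hs).op ≫ sp I t m h = 0 := by
    refine (cancel_epi ((rs I s).π.f 0)).1 ?_
    exact e2.trans comp_zero.symm
  rw [XF_sp] at e3
  rw [← sp_one I s m (hmono I hs m h), e3]
  rfl

theorem cc_surj (z : DT (PF I) 0 M) (hz : Dd (PF I) M 0 z = 0) : ∃ t m h, cc I t m h = z := by
  obtain ⟨t, x, hx, rfl⟩ := cocycle_rep I M 0 z hz
  obtain ⟨y, hy⟩ := desc0 (rs I t) M x hx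
  have h : ∀ a ∈ I ^ t, a • (y.hom (Submodule.Quotient.mk 1 : R ⧸ I ^ t)) = 0 := by
    intro a ha
    refine (map_smul y.hom a _).symm.trans ?_
    have : a • (Submodule.Quotient.mk 1 : R ⧸ I ^ t) = 0 := by
      rw [← Submodule.Quotient.mk_smul, Submodule.Quotient.mk_eq_zero, smul_eq_mul, mul_one]
      exact ha
    exact (congrArg y.hom this).trans (map_zero _)
  refine ⟨t, y.hom (Submodule.Quotient.mk 1 : R ⧸ I ^ t), h, ?_⟩
  unfold cc
  congr 1
  rw [← hy]
  have : sp I t _ h = y := XF_ext I t _ _ (sp_one I t _ h)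
  exact congrArg ((rs I t).π.f 0 ≫ ·) this

noncomputable def ccL (t : ℕ) : ((XF I).obj (op t) ⟶ M) →ₗ[R] DT (PF I) 0 M :=
  (ofD (PF I) 0 M t) ∘ₗ (Linear.leftComp R M ((rs I t).π.f 0))

theorem cc_ccL (t : ℕ) (m : M) (h : ∀ a ∈ I ^ t, a • m = 0) :
    cc I t m h = ccL I t (sp I t m h) := rfl

noncomputable def tE (hM : IsTors I M) : M →ₗ[R] LinearMap.ker ((DC (PF I) M).d 0 (0 + 1)).hom where
  toFun m := ⟨cc I (hM m).choose m (hM m).choose_spec,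
    (DC_d_apply (PF I) M 0 _).trans (cc_cocycle I _ _ _)⟩
  map_add' m m' := by
    apply Subtype.ext
    let t := (hM m).choose
    let t' := (hM m').choose
    have h1 : ∀ a ∈ I ^ max t t', a • m = 0 := hmono I (le_max_left _ _) m (hM m).choose_spec
    have h2 : ∀ a ∈ I ^ max t t', a • m' = 0 := hmono I (le_max_right _ _) m' (hM m').choose_spec
    have h3 : ∀ a ∈ I ^ max t t', a • (m + m') = 0 := by
      intro a ha
      rw [smul_add, h1 a ha, h2 a ha, add_zero]
    change cc I _ (m + m') _ = cc I _ m _ + cc I _ m' _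
    rw [cc_indep I _ (max t t') (m + m') _ h3, cc_indep I _ (max t t') m _ h1,
      cc_indep I _ (max t t') m' _ h2]
    rw [cc_ccL, cc_ccL, cc_ccL, ← map_add]
    congr 1
    apply XF_ext
    refine (sp_one I _ _ h3).trans ?_
    exact (congrArg₂ (· + ·) (sp_one I _ _ h1) (sp_one I _ _ h2)).symm
  map_smul' r m := by
    apply Subtype.ext
    let t := (hM m).choose
    have h1 : ∀ a ∈ I ^ t, a • m = 0 := (hM m).choose_spec
    have h3 : ∀ a ∈ I ^ t, a • (r • m) = 0 := by
      intro a ha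
      rw [smul_comm, h1 a ha, smul_zero]
    change cc I _ (r • m) _ = r • cc I _ m _
    rw [cc_indep I _ t (r • m) _ h3]
    rw [cc_ccL, cc_ccL, ← map_smul]
    congr 1
    apply XF_ext
    refine (sp_one I _ _ h3).trans ?_
    exact (congrArg (r • ·) (sp_one I _ _ h1)).symm

theorem tors_H0 (hM : IsTors I M) : Nonempty (M ≃ₗ[R] HH I M 0) := by
  refine ⟨LinearEquiv.ofBijective (hcl (DC (PF I) M) 0 ∘ₗ tE I hM) ⟨?_, ?_⟩⟩
  · rw [injective_iff_map_eq_zero]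
    intro m hm
    exact cc_zero I _ m (hM m).choose_spec ((hcl_zero _ _).1 hm)
  · intro w
    obtain ⟨⟨z, hz⟩, rfl⟩ := hcl_surj _ _ w
    obtain ⟨t, m, h, rfl⟩ := cc_surj I z ((DC_d_apply (PF I) M 0 z).symm.trans hz)
    refine ⟨m, congrArg (hcl (DC (PF I) M) 0) (Subtype.ext ?_)⟩
    exact cc_indep I _ _ m _ _

theorem tors_H0_surj {J Q : ModuleCat.{u} R} (g : J ⟶ Q) (hg : Function.Surjective g.hom)
    (hJ : IsTors I J) :
    Function.Surjective (HomologicalComplex.homologyMap ((DF (PF I)).map g) 0).hom := by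
  intro w
  obtain ⟨⟨z, hz⟩, rfl⟩ := hcl_surj _ _ w
  obtain ⟨t, m, h, hc⟩ := cc_surj I z ((DC_d_apply (PF I) Q 0 z).symm.trans hz)
  obtain ⟨j, rfl⟩ := hg m
  obtain ⟨t', ht'⟩ := hJ j
  have h2 : ∀ a ∈ I ^ t', a • g.hom j = 0 := by
    intro a ha
    rw [← map_smul, ht' a ha, map_zero]
  refine ⟨hcl (DC (PF I) J) 0 ⟨cc I t' j ht',
    (DC_d_apply (PF I) J 0 _).trans (cc_cocycle I _ _ _)⟩, ?_⟩
  refine hcl_map ((DF (PF I)).map g) 0 _ _ ?_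
  change Dm (PF I) g 0 (cc I t' j ht') = z
  rw [← hc, cc_indep I t t' _ h h2]
  unfold cc
  refine (Dm_ofD (PF I) g 0 t' _).trans ?_
  congr 1
  refine (Category.assoc _ _ _).trans ?_
  refine congrArg ((rs I t').π.f 0 ≫ ·) ?_
  apply XF_ext
  refine Eq.trans ?_ (sp_one I _ _ h2).symm
  exact congrArg g.hom (sp_one I _ _ ht')

end Tors
end LCFin


namespace LCFin

open CategoryTheory Opposite Limits

universe u

section Gam

variable {R : Type u} [CommRing R] (I : Ideal R)

def gam (E : Type u) [AddCommGroup E] [Module R E] : Submodule R E where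
  carrier := {m | ∃ t : ℕ, ∀ a ∈ I ^ t, a • m = 0}
  zero_mem' := ⟨0, fun a _ => smul_zero a⟩
  add_mem' := by
    rintro m m' ⟨t, h⟩ ⟨t', h'⟩
    refine ⟨max t t', fun a ha => ?_⟩
    rw [smul_add, h a (Ideal.pow_le_pow_right (le_max_left _ _) ha),
      h' a (Ideal.pow_le_pow_right (le_max_right _ _) ha), add_zero]
  smul_mem' := by
    rintro r m ⟨t, h⟩
    exact ⟨t, fun a ha => by rw [smul_comm, h a ha, smul_zero]⟩

theorem gam_fg {E : Type u} [AddCommGroup E] [Module R E] (N : Submodule R E) (hN : N.FG)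
    (h : N ≤ gam I E) : ∃ t : ℕ, ∀ a ∈ I ^ t, ∀ m ∈ N, a • m = 0 := by
  induction N, hN using Submodule.fg_induction with
  | singleton x =>
    obtain ⟨t, ht⟩ := h (Submodule.mem_span_singleton_self x)
    refine ⟨t, fun a ha m hm => ?_⟩
    obtain ⟨r, rfl⟩ := Submodule.mem_span_singleton.1 hm
    rw [smul_comm, ht a ha, smul_zero]
  | sup N₁ N₂ _ _ h₁ h₂ =>
    obtain ⟨t, ht⟩ := h₁ (le_sup_left.trans h)
    obtain ⟨t', ht'⟩ := h₂ (le_sup_right.trans h)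
    refine ⟨max t t', fun a ha m hm => ?_⟩
    obtain ⟨x, hx, y, hy, rfl⟩ := Submodule.mem_sup.1 hm
    rw [smul_add, ht a (Ideal.pow_le_pow_right (le_max_left _ _) ha) x hx,
      ht' a (Ideal.pow_le_pow_right (le_max_right _ _) ha) y hy, add_zero]

theorem ext_inj {E : Type u} [AddCommGroup E] [Module R E] [Module.Injective R E]
    {X Y : Type u} [AddCommGroup X] [Module R X] [AddCommGroup Y] [Module R Y]
    (i : X →ₗ[R] Y) (φ : X →ₗ[R] E) (h : LinearMap.ker i ≤ LinearMap.ker φ) :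
    ∃ ψ : Y →ₗ[R] E, ∀ x, ψ (i x) = φ x := by
  obtain ⟨ψ, hψ⟩ := Module.Injective.out ((LinearMap.ker i).liftQ i le_rfl)
    (LinearMap.ker_eq_bot.1 (Submodule.ker_liftQ_eq_bot _ _ _ le_rfl))
    ((LinearMap.ker i).liftQ φ h)
  exact ⟨ψ, fun x => hψ (Submodule.Quotient.mk x)⟩

theorem gam_inj [IsNoetherianRing R] {E : Type u} [AddCommGroup E] [Module R E]
    [Module.Injective R E] : Module.Injective R (gam I E) := by
  refine Module.Baer.injective fun a g => ?_
  obtain ⟨n, hn⟩ := gam_fg I ((LinearMap.range g).map (gam I E).subtype)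
    (by
      rw [LinearMap.range_eq_map]
      exact (((IsNoetherian.noetherian (⊤ : Submodule R a)).map g).map (gam I E).subtype)) (by
      rintro _ ⟨x, -, rfl⟩
      exact x.2)
  obtain ⟨k, hk⟩ := Ideal.exists_pow_inf_eq_pow_smul I (a : Submodule R R)
  have hk1 := hk (n + k) (Nat.le_add_left k n)
  have hsub : ∀ x : a, (x : R) ∈ I ^ (n + k) → g x = 0 := by
    intro x hx
    have h1 : (x : R) ∈ I ^ n • (a : Submodule R R) := by
      have : (x : R) ∈ I ^ (n + k) • (⊤ : Submodule R R) ⊓ (a : Submodule R R) := by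
        refine ⟨?_, x.2⟩
        simpa using hx
      rw [hk1, Nat.add_sub_cancel] at this
      exact Submodule.smul_mono le_rfl inf_le_right this
    have h2 : I ^ n • (a : Submodule R R) ≤ (LinearMap.ker g).map (a : Submodule R R).subtype := by
      rw [Submodule.smul_le]
      intro r hr m hm
      refine ⟨r • ⟨m, hm⟩, ?_, rfl⟩
      change g (r • ⟨m, hm⟩) = 0
      rw [map_smul]
      apply Subtype.ext
      exact hn r hr _ ⟨g ⟨m, hm⟩, ⟨_, rfl⟩, rfl⟩
    obtain ⟨y, hy, e⟩ := h2 h1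
    rw [← Subtype.ext e]
    exact hy
  obtain ⟨ψ, hψ⟩ := ext_inj (E := E) ((I ^ (n + k)).mkQ ∘ₗ (a : Submodule R R).subtype)
    ((gam I E).subtype ∘ₗ g) (by
      intro x hx
      have : (x : R) ∈ I ^ (n + k) := by
        exact (Submodule.Quotient.mk_eq_zero _).1 hx
      change ((g x : gam I E) : E) = 0
      rw [hsub x this]
      rfl)
  have hψ1 : ∀ r : R, ψ ((I ^ (n + k)).mkQ r) ∈ gam I E := by
    intro r
    refine ⟨n + k, fun b hb => ?_⟩
    rw [← map_smul, ← map_smul]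
    have : (I ^ (n + k)).mkQ (b • r) = 0 := by
      rw [Submodule.mkQ_apply, Submodule.Quotient.mk_eq_zero]
      exact Ideal.mul_mem_right _ _ hb
    rw [this, map_zero]
  refine ⟨LinearMap.codRestrict _ (ψ ∘ₗ (I ^ (n + k)).mkQ) hψ1, fun x hx => ?_⟩
  apply Subtype.ext
  exact hψ ⟨x, hx⟩

theorem mkSES {X Y Z : Type u} [AddCommGroup X] [Module R X] [AddCommGroup Y] [Module R Y]
    [AddCommGroup Z] [Module R Z] (f : X →ₗ[R] Y) (g : Y →ₗ[R] Z) (hf : Function.Injective f)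
    (hg : Function.Surjective g) (h0 : ∀ x, g (f x) = 0) (he : ∀ y, g y = 0 → ∃ x, f x = y) :
    (ShortComplex.mk (ModuleCat.ofHom f) (ModuleCat.ofHom g)
      (ModuleCat.hom_ext (LinearMap.ext h0))).ShortExact := by
  refine ShortComplex.ShortExact.mk' ?_ ?_ ?_
  · rw [ShortComplex.moduleCat_exact_iff]
    exact he
  · exact (ModuleCat.mono_iff_injective _).2 hf
  · exact (ModuleCat.epi_iff_surjective _).2 hg

theorem tors_emb [IsNoetherianRing R] (M : ModuleCat.{u} R) (hM : IsTors I M) :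
    ∃ S : ShortComplex (ModuleCat.{u} R), S.ShortExact ∧ S.X₁ = M ∧ IsTors I S.X₂ ∧ IsTors I S.X₃ ∧
      Injective S.X₂ := by
  let E := Injective.under M
  have hE : Module.Injective R E := (Module.injective_iff_injective_object R E).2
    (inferInstanceAs (Injective (Injective.under M)))
  have hi : Function.Injective (Injective.ι M).hom :=
    (ModuleCat.mono_iff_injective (Injective.ι M)).1 inferInstance
  let f : M →ₗ[R] gam I E := LinearMap.codRestrict _ (Injective.ι M).hom (by
    intro m
    obtain ⟨t, ht⟩ := hM m
    refine ⟨t, fun a ha => ?_⟩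
    rw [← map_smul, ht a ha, map_zero])
  have hg := gam_inj I (E := E)
  have htor : IsTors I (ModuleCat.of R (gam I E)) := by
    rintro ⟨m, t, ht⟩
    exact ⟨t, fun a ha => Subtype.ext (ht a ha)⟩
  refine ⟨_, mkSES f (LinearMap.range f).mkQ ?_ (Submodule.mkQ_surjective _) ?_ ?_, rfl, htor, ?_, ?_⟩
  · intro x y hxy
    exact hi (congrArg Subtype.val hxy)
  · intro x
    rw [Submodule.mkQ_apply, Submodule.Quotient.mk_eq_zero]
    exact ⟨x, rfl⟩
  · intro y hy
    rw [Submodule.mkQ_apply, Submodule.Quotient.mk_eq_zero] at hy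
    exact hy
  · intro q
    obtain ⟨y, rfl⟩ := Submodule.mkQ_surjective (LinearMap.range f) q
    obtain ⟨t, ht⟩ := htor y
    refine ⟨t, fun a ha => ?_⟩
    refine (map_smul (LinearMap.range f).mkQ a y).symm.trans ?_
    exact (congrArg (LinearMap.range f).mkQ (ht a ha)).trans (map_zero _)
  · exact (Module.injective_iff_injective_object R (gam I E)).1 hg

theorem tors_van [IsNoetherianRing R] (i : ℕ) : ∀ M : ModuleCat.{u} R, IsTors I M →
    Subsingleton (HH I M (i + 1)) := by
  induction i with
  | zero => 
    intro M hM
    obtain ⟨S, hS, rfl, h2, h3, hinj⟩ := tors_emb I M hM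
    refine les_one' I hS 0 (tors_H0_surj I S.g ?_ h2) (HH_succ_inj I S.X₂ 0)
    exact (ModuleCat.epi_iff_surjective _).1 hS.epi_g
  | succ i ih =>
    intro M hM
    obtain ⟨S, hS, rfl, h2, h3, hinj⟩ := tors_emb I M hM
    exact les_one I hS (i + 1) (ih S.X₃ h3) (HH_succ_inj I S.X₂ (i + 1))

end Gam
end LCFin


namespace LCFin

open CategoryTheory Opposite Limits

universe u

section Cpx

variable {R : Type u} [CommRing R] (I : Ideal R)
  (K : ℕ → Type u) [∀ p, AddCommGroup (K p)] [∀ p, Module R (K p)]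
  (d : ∀ p, K p →ₗ[R] K (p + 1))

theorem ses1 (p : ℕ) : (ShortComplex.mk (ModuleCat.ofHom (LinearMap.ker (d p)).subtype)
    (ModuleCat.ofHom (d p).rangeRestrict)
    (ModuleCat.hom_ext (LinearMap.ext fun z => Subtype.ext z.2))).ShortExact :=
  mkSES _ _ (Submodule.subtype_injective _) (LinearMap.surjective_rangeRestrict _)
    (fun z => Subtype.ext z.2)
    (fun y hy => ⟨⟨y, congrArg Subtype.val hy⟩, rfl⟩)

theorem H0_range (hK : ∀ p t, SA0 (rs I t) (ModuleCat.of R (K (p + 1)))) (p : ℕ) :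
    Subsingleton (HH I (ModuleCat.of R (LinearMap.range (d p))) 0) := by
  refine HH_zero_of I _ fun t => ?_
  have : Mono (ModuleCat.ofHom (LinearMap.range (d p)).subtype) :=
    (ModuleCat.mono_iff_injective _).2 (Submodule.subtype_injective _)
  exact SA0_mono _ _ (ModuleCat.ofHom (LinearMap.range (d p)).subtype) (hK p t)

theorem H0_ker (hK : ∀ p t, SA0 (rs I t) (ModuleCat.of R (K (p + 1)))) (p : ℕ) :
    Subsingleton (HH I (ModuleCat.of R (LinearMap.ker (d (p + 1)))) 0) := by
  refine HH_zero_of I _ fun t => ?_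
  have : Mono (ModuleCat.ofHom (LinearMap.ker (d (p + 1))).subtype) :=
    (ModuleCat.mono_iff_injective _).2 (Submodule.subtype_injective _)
  exact SA0_mono _ _ (ModuleCat.ofHom (LinearMap.ker (d (p + 1))).subtype) (hK p t)

variable [IsNoetherianRing R]
  (hd : ∀ p x, d (p + 1) (d p x) = 0)
  (hK : ∀ p t, SA0 (rs I t) (ModuleCat.of R (K (p + 1))) ∧
    ∀ i, SAs (rs I t) (ModuleCat.of R (K (p + 1))) i)
  (T : ℕ → Type u) [∀ p, AddCommGroup (T p)] [∀ p, Module R (T p)]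
  (c : ∀ p, LinearMap.ker (d (p + 1)) →ₗ[R] T p)
  (hc : ∀ p, Function.Surjective (c p))
  (hc0 : ∀ p z, c p z = 0 ↔ ∃ y, d p y = z.1)
  (hT : ∀ p, IsTors I (ModuleCat.of R (T p)))
  (hZ : IsTors I (ModuleCat.of R (LinearMap.ker (d 0))))

noncomputable def incB (hd : ∀ p x, d (p + 1) (d p x) = 0) (p : ℕ) :
    LinearMap.range (d p) →ₗ[R] LinearMap.ker (d (p + 1)) :=
  Submodule.inclusion (by rintro _ ⟨x, rfl⟩; exact hd p x)

omit [IsNoetherianRing R] in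
theorem ses2 (hd : ∀ p x, d (p + 1) (d p x) = 0) (hc : ∀ p, Function.Surjective (c p))
    (hc0 : ∀ p z, c p z = 0 ↔ ∃ y, d p y = z.1) (p : ℕ) :
    (ShortComplex.mk (ModuleCat.ofHom (incB K d hd p)) (ModuleCat.ofHom (c p))
    (ModuleCat.hom_ext (LinearMap.ext fun z => (hc0 p _).2 z.2))).ShortExact :=
  mkSES _ _ (Submodule.inclusion_injective _) (hc p) (fun z => (hc0 p _).2 z.2) (fun y hy => by
    obtain ⟨x, hx⟩ := (hc0 p y).1 hy
    exact ⟨⟨d p x, x, rfl⟩, Subtype.ext hx⟩)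

include hd hK hc hc0 hT in
theorem shiftB (p i : ℕ) : Nonempty (HH I (ModuleCat.of R (LinearMap.range (d (p + 1)))) (i + 1)
    ≃ₗ[R] HH I (ModuleCat.of R (LinearMap.range (d p))) (i + 2)) := by
  obtain ⟨e1⟩ := les13 I (ses1 K d (p + 1)) (i + 1) (HH_succ_of I _ i fun t => (hK p t).2 i)
    (HH_succ_of I _ (i + 1) fun t => (hK p t).2 (i + 1))
  obtain ⟨e2⟩ := les12 I (ses2 K d T c hd hc hc0 p) (i + 1) (tors_van I i _ (hT p))
    (tors_van I (i + 1) _ (hT p))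
  exact ⟨e1.trans e2.symm⟩

include hd hK hc hc0 hT in
theorem shiftB' (p : ℕ) : ∀ i, Nonempty (HH I (ModuleCat.of R (LinearMap.range (d p))) (i + 1)
    ≃ₗ[R] HH I (ModuleCat.of R (LinearMap.range (d 0))) (i + 1 + p)) := by
  induction p with
  | zero => exact fun i => ⟨LinearEquiv.refl _ _⟩
  | succ p ih =>
    intro i
    obtain ⟨e1⟩ := shiftB I K d hd hK T c hc hc0 hT p i
    obtain ⟨e2⟩ := ih (i + 1)
    have : i + 1 + 1 + p = i + 1 + (p + 1) := by omega
    rw [this] at e2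
    exact ⟨e1.trans e2⟩

include hd hK hc hc0 hT hZ in
theorem cmpT (p : ℕ) : Nonempty (T p ≃ₗ[R] HH I (ModuleCat.of R (K 0)) (p + 1)) := by
  obtain ⟨e1⟩ := tors_H0 I (hT p)
  obtain ⟨e2⟩ := les13 I (ses2 K d T c hd hc hc0 p) 0 (H0_ker I K d (fun p t => (hK p t).1) p)
    (les_one I (ses1 K d (p + 1)) 0 (H0_range I K d (fun p t => (hK p t).1) (p + 1))
      (HH_succ_of I _ 0 fun t => (hK p t).2 0))
  obtain ⟨e3⟩ := shiftB' I K d hd hK T c hc hc0 hT p 0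
  obtain ⟨e4⟩ := les23 I (ses1 K d 0) (p + 1) (tors_van I p _ hZ) (tors_van I (p + 1) _ hZ)
  have : 0 + 1 + p = p + 1 := by omega
  rw [this] at e3
  exact ⟨e1.trans (e2.trans (e3.trans e4.symm))⟩

include hK hZ in
theorem cmp0 [IsNoetherian R (K 0)] : IsNoetherian R (HH I (ModuleCat.of R (K 0)) 0) := by
  obtain ⟨e1⟩ := tors_H0 I hZ
  obtain ⟨f, hf⟩ := les_surj12 I (ses1 K d 0) 0 (H0_range I K d (fun p t => (hK p t).1) 0)
  have hn : IsNoetherian R (LinearMap.ker (d 0)) := inferInstance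
  have hn' : IsNoetherian R (ModuleCat.of R (LinearMap.ker (d 0))) := hn
  exact isNoetherian_of_surjective (f ∘ₗ e1.toLinearMap)
    (LinearMap.range_eq_top.2 (hf.comp e1.surjective))

end Cpx
end LCFin


namespace LCFin

open CategoryTheory

universe u

section Final

theorem isTors_of_gen {R : Type u} [CommRing R] [IsNoetherianRing R] {r : ℕ} (F : Fin r → R)
    (M : Type u) [AddCommGroup M] [Module R M] (h : ∀ (m : M) (j : Fin r), ∃ k : ℕ, F j ^ k • m = 0) :
    IsTors (Ideal.span (Set.range F)) (ModuleCat.of R M) := by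
  intro m
  have hle : Ideal.span (Set.range F) ≤
      Ideal.radical (LinearMap.ker (LinearMap.toSpanSingleton R M m)) := by
    rw [Ideal.span_le]
    rintro _ ⟨j, rfl⟩
    obtain ⟨k, hk⟩ := h m j
    exact ⟨k, hk⟩
  obtain ⟨t, ht⟩ := Ideal.exists_pow_le_of_le_radical_of_fg hle (IsNoetherian.noetherian _)
  exact ⟨t, fun a ha => ht ha⟩

variable {A : Type u} [CommRing A] {n r : ℕ} (F : Fin r → MvPolynomial (Fin n) A)

/-- the differential as a map of modules over the polynomial ring -/
noncomputable def dR (p : ℕ) : CK F A A p →ₗ[MvPolynomial (Fin n) A] CK F A A (p + 1) :=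
  (dK F A A p).restrictScalars (MvPolynomial (Fin n) A)

/-- class map -/
noncomputable def cR (q : ℕ) :
    LinearMap.ker (dR F (q + 1)) →ₗ[MvPolynomial (Fin n) A] TS F A A q where
  toFun z := clS F A A q ⟨z.1, z.2⟩
  map_add' x y := (clS F A A q).map_add ⟨x.1, x.2⟩ ⟨y.1, y.2⟩
  map_smul' a x := clS_R F A A q a ⟨x.1, x.2⟩

/-- degree zero term -/
theorem K0_equiv : Nonempty (CK F A A 0 ≃ₗ[MvPolynomial (Fin n) A] MvPolynomial (Fin n) A) := by
  let e1 : CK F A A 0 ≃ₗ[MvPolynomial (Fin n) A] TL A A (pr F (Fin.elim0 : Fin 0 → Fin r)) :=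
    { toFun := fun z => z Fin.elim0
      invFun := fun y s => (Subsingleton.elim (Fin.elim0 : Fin 0 → Fin r) s) ▸ y
      map_add' := fun _ _ => rfl
      map_smul' := fun _ _ => rfl
      left_inv := fun z => by
        funext s
        obtain rfl := Subsingleton.elim (Fin.elim0 : Fin 0 → Fin r) s
        rfl
      right_inv := fun y => rfl }
  let e2 := flipE A A (pr F (Fin.elim0 : Fin 0 → Fin r))
  let e3 : (TensorProduct A (Loc (pr F (Fin.elim0 : Fin 0 → Fin r))) A) ≃ₗ[MvPolynomial (Fin n) A]
    Loc (pr F (Fin.elim0 : Fin 0 → Fin r)) :=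
    TensorProduct.AlgebraTensorModule.rid A (MvPolynomial (Fin n) A) _
  have hu : IsUnit (pr F (Fin.elim0 : Fin 0 → Fin r)) := by simp [pr]
  let e4 : MvPolynomial (Fin n) A ≃ₐ[MvPolynomial (Fin n) A] Loc (pr F (Fin.elim0 : Fin 0 → Fin r)) :=
    IsLocalization.atUnit _ _ _ hu
  exact ⟨((e1.trans e2).trans e3).trans e4.symm.toLinearEquiv⟩

variable [IsNoetherianRing A]

theorem hKR (p t : ℕ) : SA0 (rs (Ideal.span (Set.range F)) t)
      (ModuleCat.of (MvPolynomial (Fin n) A) (CK F A A (p + 1))) ∧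
    ∀ i, SAs (rs (Ideal.span (Set.range F)) t)
      (ModuleCat.of (MvPolynomial (Fin n) A) (CK F A A (p + 1))) i :=
  SA_prod (Ideal.span (Set.range F)) (fun s : Fin (p + 1) → Fin r => TL A A (pr F s))
    (fun s => ⟨F (s 0), Ideal.subset_span (Set.mem_range_self (s 0)), CK_bij F A p 0 s⟩) t

theorem hTR (q : ℕ) : IsTors (Ideal.span (Set.range F))
    (ModuleCat.of (MvPolynomial (Fin n) A) (TS F A A q)) := by
  refine isTors_of_gen F _ fun m j => ?_
  obtain ⟨z, rfl⟩ := clS_surj F A A q m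
  obtain ⟨k, y, hy⟩ := dK_torsion F A q z.1 z.2 j
  refine ⟨k, ?_⟩
  rw [← clS_R, clS_eq_zero]
  exact ⟨y, hy.symm⟩

theorem hZR : IsTors (Ideal.span (Set.range F))
    (ModuleCat.of (MvPolynomial (Fin n) A) (LinearMap.ker (dR F 0))) := by
  refine isTors_of_gen F _ fun m j => ?_
  obtain ⟨k, hk⟩ := dK_torsion0 F A m.1 m.2 j
  exact ⟨k, Subtype.ext hk⟩

theorem final (A : Type u) [CommRing A] [IsNoetherianRing A] [IsLocalRing A]
    (hA : ringKrullDim A = 1) (n : ℕ) (I : Ideal (MvPolynomial (Fin n) A)) (i : ℕ) :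
    (associatedPrimes (MvPolynomial (Fin n) A)
      ((localCohomology I i).obj
        (ModuleCat.of (MvPolynomial (Fin n) A) (MvPolynomial (Fin n) A)))).Finite := by
  obtain ⟨r, F, hF⟩ := Submodule.fg_iff_exists_fin_generating_family.1
    (IsNoetherian.noetherian I)
  have hF' : Ideal.span (Set.range F) = I := hF
  subst hF'
  obtain ⟨e0⟩ := K0_equiv F
  let e1 := ((localCohomology (Ideal.span (Set.range F)) i).mapIso e0.toModuleIso).toLinearEquiv
  rw [← LinearEquiv.AssociatedPrimes.eq e1]
  obtain ⟨e2⟩ := lcEquiv (Ideal.span (Set.range F))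
    (ModuleCat.of (MvPolynomial (Fin n) A) (CK F A A 0)) i
  rw [LinearEquiv.AssociatedPrimes.eq e2]
  cases i with
  | zero =>
    have : IsNoetherian (MvPolynomial (Fin n) A) (CK F A A 0) :=
      isNoetherian_of_linearEquiv e0.symm
    have h := cmp0 (Ideal.span (Set.range F)) (CK F A A) (dR F) (hKR F) (hZR F)
    have : Module.Finite (MvPolynomial (Fin n) A) (HH (Ideal.span (Set.range F))
      (ModuleCat.of (MvPolynomial (Fin n) A) (CK F A A 0)) 0) := inferInstance
    exact associatedPrimes.finite _ _
  | succ q =>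
    obtain ⟨e3⟩ := cmpT (Ideal.span (Set.range F)) (CK F A A) (dR F)
      (fun p x => dK_dK F A p x) (hKR F) (TS F A A) (cR F)
      (fun p m => by
        obtain ⟨z, rfl⟩ := clS_surj F A A p m
        exact ⟨⟨z.1, z.2⟩, rfl⟩)
      (fun p z => clS_eq_zero F A A p ⟨z.1, z.2⟩) (hTR F) (hZR F) q
    rw [← LinearEquiv.AssociatedPrimes.eq e3]
    exact ass_TS A hA F q

end Final
end LCFin

universe u

open CategoryTheory

theorem associatedPrimes_localCohomology_finite_of_local_dim_one_polynomial
    (A : Type u) [CommRing A] [IsNoetherianRing A] [IsLocalRing A]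
    (hA : ringKrullDim A = 1)
    (n : ℕ) (I : Ideal (MvPolynomial (Fin n) A)) (i : ℕ) :
    (associatedPrimes (MvPolynomial (Fin n) A)
      ((localCohomology I i).obj (ModuleCat.of _ (MvPolynomial (Fin n) A)))).Finite :=
  LCFin.final A hA n I i
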